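/- Let A be a cyclic algebra (L/K, σ, a) where L/K is a cyclic Galois extension of number fields with Galois group generated by σ, and a ∈ K^×. Then the Schur index of A equals the least positive integer m such that a^m lies in the image of the norm map N_{L/K}: L^× → K^×. -/

import Mathlib

open scoped TensorProduct

/-- `A` is the cyclic algebra `(L/K, σ, a)`. -/
def IsCyclicAlgebra (K : Type*) [Field K] (L : Type*) [Field L] [Algebra K L]
    (σ : L ≃ₐ[K] L) (a : L) (A : Type*) [Ring A] [Algebra K A] : Prop :=
  ∃ (ι : L →ₐ[K] A) (u : Aˣ),
    (u : A) ^ Module.finrank K L = ι a ∧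
    (∀ x : L, (u : A) * ι x = ι (σ x) * (u : A)) ∧
    Function.Bijective fun f : Fin (Module.finrank K L) → L =>
      ∑ i, ι (f i) * (u : A) ^ (i : ℕ)

/-- The Schur index of a central simple `K`-algebra. -/
noncomputable def schurIndex (K A : Type*) [Field K] [Ring A] [Algebra K A] : ℕ :=
  sInf {m | ∃ (D : Type) (_ : DivisionRing D) (_ : Algebra K D) (r : ℕ),
      Nonempty (A ≃ₐ[K] Matrix (Fin r) (Fin r) D) ∧ m * m = Module.finrank K D}

/-- Local index at a real embedding. -/
noncomputable def realLocalIndex (K A : Type*) [Field K] [Ring A] [Algebra K A]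
    (φ : K →+* ℝ) : ℕ :=
  letI := φ.toAlgebra
  schurIndex ℝ (ℝ ⊗[K] A)

def IsBrauerEquiv (K A B : Type*) [Field K] [Ring A] [Algebra K A] [Ring B] [Algebra K B] :
    Prop :=
  ∃ r s : ℕ, 0 < r ∧ 0 < s ∧
    Nonempty (Matrix (Fin r) (Fin r) A ≃ₐ[K] Matrix (Fin s) (Fin s) B)

/-- The simple component `Re` of `R`, realized as `R/(1-e)`. -/
abbrev simpleComponent (R : Type*) [Ring R] (e : R) : Type _ :=
  (TwoSidedIdeal.span {1 - e}).ringCon.Quotient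

noncomputable instance (F R : Type*) [CommSemiring F] [Ring R] [Algebra F R] (e : R) :
    Algebra F (simpleComponent R e) :=
  RingHom.toAlgebra' ((TwoSidedIdeal.span {1 - e}).ringCon.mk'.comp (algebraMap F R)) <| by
    intro c x
    induction x using Quotient.inductionOn' with
    | h x =>
        show ((algebraMap F R c : R) : simpleComponent R e) * (x : simpleComponent R e)
          = (x : simpleComponent R e) * ((algebraMap F R c : R) : simpleComponent R e)
        rw [← RingCon.coe_mul, ← RingCon.coe_mul, Algebra.commutes]

/-- `e` is a centrally primitive idempotent. -/
def IsCentrallyPrimitiveIdempotent (R : Type*) [Ring R] (e : R) : Prop :=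
  e ∈ Subring.center R ∧ e * e = e ∧ e ≠ 0 ∧
    ∀ a b : R, a ∈ Subring.center R → b ∈ Subring.center R → a * a = a → b * b = b →
      a * b = 0 → e = a + b → a = 0 ∨ b = 0

set_option linter.unusedSectionVars false

namespace CyclicSchur

section Herbrand

open Polynomial

lemma index_range_comp_mul {Y : Type*} [AddCommGroup Y] (φ ψ : Y →+ Y) :
    (φ.comp ψ).range.index * (Nat.card φ.ker * Nat.card ψ.ker) =
      φ.range.index * ψ.range.index * Nat.card (φ.comp ψ).ker := by
  have h1 : (φ.comp ψ).range.index = φ.range.index * (ψ.range ⊔ φ.ker).index := by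
    rw [AddMonoidHom.range_comp, AddSubgroup.index_map, mul_comm]
  have h2 : ψ.range.index = ψ.range.relIndex φ.ker * (ψ.range ⊔ φ.ker).index := by
    rw [← AddSubgroup.relIndex_mul_index (le_sup_left : ψ.range ≤ ψ.range ⊔ φ.ker),
      AddSubgroup.relIndex_sup_left]
  have h3 : Nat.card φ.ker = Nat.card (φ.ker ⊓ ψ.range : AddSubgroup Y) * ψ.range.relIndex φ.ker := by
    rw [← AddSubgroup.card_mul_index (ψ.range.addSubgroupOf φ.ker)]
    congr 1
    rw [← AddSubgroup.inf_addSubgroupOf_left]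
    exact Nat.card_congr (AddSubgroup.addSubgroupOfEquivOfLe inf_le_left).toEquiv
  have h4 : Nat.card (φ.comp ψ).ker
      = Nat.card ψ.ker * Nat.card (φ.ker ⊓ ψ.range : AddSubgroup Y) := by
    rw [← AddMonoidHom.comap_ker]
    have := AddSubgroup.card_mul_index (ψ.ker.addSubgroupOf (φ.ker.comap ψ))
    rw [← this]
    congr 1
    · exact Nat.card_congr (AddSubgroup.addSubgroupOfEquivOfLe
        (by intro x hx; simp [AddMonoidHom.mem_ker] at hx ⊢; simp [hx])).toEquiv
    · change ψ.ker.relIndex _ = _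
      rw [AddSubgroup.relIndex_ker]
      rw [AddSubgroup.map_comap_eq, inf_comm]
  rw [h1, h2, h3, h4]; ring

/-- The index of the range of an endomorphism. -/
noncomputable def rangeIndex {Y : Type*} [AddCommGroup Y] (f : Module.End ℤ Y) : ℕ :=
  (LinearMap.range f).toAddSubgroup.index

lemma rangeIndex_mul {Y : Type*} [AddCommGroup Y] (φ ψ : Module.End ℤ Y) :
    rangeIndex (φ * ψ) * (Nat.card (LinearMap.ker φ) * Nat.card (LinearMap.ker ψ)) =
      rangeIndex φ * rangeIndex ψ * Nat.card (LinearMap.ker (φ * ψ)) :=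
  index_range_comp_mul φ.toAddMonoidHom ψ.toAddMonoidHom

lemma rangeIndex_pow {Y : Type*} [AddCommGroup Y] (f : Module.End ℤ Y) (m : ℕ)
    (hk : Finite (LinearMap.ker (f ^ m))) : ∀ j ≤ m,
    rangeIndex (f ^ j) * Nat.card (LinearMap.ker f) ^ j =
      rangeIndex f ^ j * Nat.card (LinearMap.ker (f ^ j)) := by
  intro j
  induction j with
  | zero =>
    intro _
    have h1 : LinearMap.range (f ^ 0) = ⊤ := by
      rw [pow_zero, Module.End.one_eq_id, LinearMap.range_id]
    have h2 : LinearMap.ker (f ^ 0) = ⊥ := by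
      rw [pow_zero, Module.End.one_eq_id, LinearMap.ker_id]
    rw [rangeIndex, h1, h2]; simp
  | succ j ih =>
    intro hj
    have ih := ih (by omega)
    have key := rangeIndex_mul f (f ^ j)
    rw [← pow_succ'] at key
    have hle : LinearMap.ker (f ^ j) ≤ LinearMap.ker (f ^ m) := by
      intro x hx
      rw [LinearMap.mem_ker] at hx ⊢
      obtain ⟨i, rfl⟩ : ∃ i, m = i + j := ⟨m - j, by omega⟩
      rw [pow_add, Module.End.mul_apply, hx, map_zero]
    have hfin : Finite (LinearMap.ker (f ^ j)) :=
      Finite.of_injective _ (Submodule.inclusion_injective hle)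
    have hpos : Nat.card (LinearMap.ker (f ^ j)) ≠ 0 := Nat.card_pos.ne'
    apply Nat.eq_of_mul_eq_mul_left (Nat.pos_of_ne_zero hpos)
    linear_combination (Nat.card (LinearMap.ker f) ^ j) * key +
      (rangeIndex f * Nat.card (LinearMap.ker (f ^ (j+1)))) * ih

lemma rangeIndex_congr {A B : Type*} [AddCommGroup A] [AddCommGroup B] (e : A ≃ₗ[ℤ] B)
    (f : Module.End ℤ A) (g : Module.End ℤ B) (h : ∀ x, e (f x) = g (e x)) :
    rangeIndex f = rangeIndex g := by
  have : (LinearMap.range g).toAddSubgroup =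
      (LinearMap.range f).toAddSubgroup.map e.toAddEquiv.toAddMonoidHom := by
    ext y
    constructor
    · rintro ⟨x, rfl⟩
      exact ⟨f (e.symm x), ⟨_, rfl⟩, by simp [h]⟩
    · rintro ⟨_, ⟨x, rfl⟩, rfl⟩
      exact ⟨e x, (h x).symm⟩
  rw [rangeIndex, rangeIndex, this]
  exact (AddSubgroup.index_map_of_bijective (f := e.toAddEquiv.toAddMonoidHom) e.bijective _).symm

lemma rangeIndex_prodMap {A B : Type*} [AddCommGroup A] [AddCommGroup B]
    (f : Module.End ℤ A) (g : Module.End ℤ B) :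
    rangeIndex (LinearMap.prodMap f g : Module.End ℤ (A × B)) = rangeIndex f * rangeIndex g := by
  rw [rangeIndex, rangeIndex, rangeIndex, ← AddSubgroup.index_prod, LinearMap.range_prodMap]
  rfl

lemma finrank_int_eq_zero_of_finite (A : Type*) [AddCommGroup A] [inst : Module ℤ A] [Finite A] :
    Module.finrank ℤ A = 0 := by
  obtain rfl : inst = AddCommGroup.toIntModule A := Subsingleton.elim _ _
  rw [Module.finrank_eq_zero_iff_isTorsion]
  intro x
  have hx := isOfFinAddOrder_of_finite x
  refine ⟨⟨(addOrderOf x : ℤ), ?_⟩, ?_⟩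
  · have := hx.addOrderOf_pos
    simpa [mem_nonZeroDivisors_iff_ne_zero] using this.ne'
  · exact (natCast_zsmul x _).trans (addOrderOf_nsmul_eq_zero x)

lemma rangeIndex_smul_of_fg {A : Type*} [AddCommGroup A] [Module.Finite ℤ A] (p : ℕ)
    (hp : p ≠ 0) :
    rangeIndex ((p : ℤ) • (1 : Module.End ℤ A)) =
      p ^ Module.finrank ℤ A * Nat.card (LinearMap.ker ((p : ℤ) • (1 : Module.End ℤ A))) ∧
    Finite (LinearMap.ker ((p : ℤ) • (1 : Module.End ℤ A))) := by
  have hfg : AddGroup.FG A := Module.Finite.iff_addGroup_fg.mp inferInstance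
  obtain ⟨n, ι, _, q, hq, e, ⟨φ⟩⟩ := AddCommGroup.equiv_free_prod_directSum_zmod A
  have hne : ∀ i, NeZero (q i ^ e i) := fun i => ⟨pow_ne_zero _ (hq i).ne_zero⟩
  let T := DirectSum ι fun i => ZMod (q i ^ e i)
  have : Finite T := Finite.of_equiv _ (DirectSum.addEquivProd (fun i => ZMod (q i ^ e i))).symm.toEquiv
  let Φ : A ≃ₗ[ℤ] (Fin n → ℤ) × T :=
    φ.toIntLinearEquiv.trans ((Finsupp.linearEquivFunOnFinite ℤ ℤ (Fin n)).prodCongr (LinearEquiv.refl ℤ T))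
  have hrank : Module.finrank ℤ A = n := by
    rw [Φ.finrank_eq]
    have h1 := (LinearMap.ker (LinearMap.fst ℤ (Fin n → ℤ) T)).finrank_quotient_add_finrank
    rw [((LinearMap.fst ℤ (Fin n → ℤ) T).quotKerEquivOfSurjective LinearMap.fst_surjective).finrank_eq, Module.finrank_fin_fun] at h1
    have h2 : Module.finrank ℤ (LinearMap.ker (LinearMap.fst ℤ (Fin n → ℤ) T)) = 0 := by
      have : Finite (LinearMap.ker (LinearMap.fst ℤ (Fin n → ℤ) T)) := by
        refine Finite.of_injective (fun x => x.1.2) ?_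
        rintro ⟨⟨a, b⟩, h⟩ ⟨⟨a', b'⟩, h'⟩ hb
        simp only [LinearMap.mem_ker, LinearMap.fst_apply] at h h' hb
        subst h h' hb; rfl
      exact finrank_int_eq_zero_of_finite (LinearMap.ker (LinearMap.fst ℤ (Fin n → ℤ) T))
    omega
  have hcard : Nat.card (LinearMap.ker ((p : ℤ) • (1 : Module.End ℤ A))) =
      Nat.card (LinearMap.ker ((p : ℤ) • (1 : Module.End ℤ T))) ∧
      Finite (LinearMap.ker ((p : ℤ) • (1 : Module.End ℤ A))) := by
    let g : LinearMap.ker ((p : ℤ) • (1 : Module.End ℤ A)) ≃ LinearMap.ker ((p : ℤ) • (1 : Module.End ℤ T)) :=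
    { toFun := fun x => ⟨(Φ x.1).2, by
        have h := x.2
        rw [LinearMap.mem_ker] at h ⊢
        change (p : ℤ) • x.1 = 0 at h
        change (p : ℤ) • (Φ x.1).2 = 0
        rw [← Prod.smul_snd, ← map_smul, h, map_zero]; rfl⟩
      invFun := fun y => ⟨Φ.symm (0, y.1), by
        have h := y.2
        rw [LinearMap.mem_ker] at h ⊢
        change (p : ℤ) • y.1 = 0 at h
        change (p : ℤ) • Φ.symm (0, y.1) = 0
        rw [← map_smul, Prod.smul_mk, h, smul_zero]; exact map_zero _⟩
      left_inv := by
        intro x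
        apply Subtype.ext
        have h := x.2
        rw [LinearMap.mem_ker] at h
        change (p : ℤ) • x.1 = 0 at h
        have h1 : (p : ℤ) • (Φ x.1).1 = 0 := by
          rw [← Prod.smul_fst, ← map_smul, h, map_zero]; rfl
        have h2 : (Φ x.1).1 = 0 := (smul_eq_zero.1 h1).resolve_left (by exact_mod_cast hp)
        change Φ.symm (0, (Φ x.1).2) = x.1
        rw [← h2]; exact Φ.symm_apply_apply _
      right_inv := by
        intro y
        apply Subtype.ext
        change (Φ (Φ.symm (0, y.1))).2 = y.1
        rw [Φ.apply_symm_apply] }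
    exact ⟨Nat.card_congr g, Finite.of_equiv _ g.symm⟩
  refine ⟨?_, hcard.2⟩
  have hZ : rangeIndex ((p : ℤ) • (1 : Module.End ℤ (Fin n → ℤ))) = p ^ n := by
    have : (LinearMap.range ((p : ℤ) • (1 : Module.End ℤ (Fin n → ℤ)))).toAddSubgroup =
        AddSubgroup.pi Set.univ fun _ => AddSubgroup.zmultiples (p : ℤ) := by
      ext x
      simp only [AddSubgroup.mem_pi, Set.mem_univ, true_imp_iff, Int.mem_zmultiples_iff]
      constructor
      · rintro ⟨y, rfl⟩ i
        exact ⟨y i, by simp⟩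
      · intro h
        choose y hy using h
        exact ⟨y, by ext i; simp [hy]⟩
    rw [rangeIndex, this, AddSubgroup.index_pi]
    simp
  have hT : rangeIndex ((p : ℤ) • (1 : Module.End ℤ T)) = Nat.card (LinearMap.ker ((p : ℤ) • (1 : Module.End ℤ T))) :=
    AddSubgroup.index_range (f := ((p : ℤ) • (1 : Module.End ℤ T)).toAddMonoidHom)
  rw [hcard.1, ← hT, hrank, ← hZ, ← rangeIndex_prodMap]
  refine rangeIndex_congr Φ _ _ fun x => ?_
  change Φ ((p : ℤ) • x) = ((p : ℤ) • (Φ x).1, (p : ℤ) • (Φ x).2)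
  rw [map_smul]; rfl

lemma exists_cyclotomic_dvd (p : ℕ) (hp : p.Prime) :
    ∃ A B A' B' : ℤ[X], (X - 1) ^ (p - 1) = A * C (p : ℤ) + B * cyclotomic p ℤ ∧
      C (p : ℤ) = A' * (X - 1) ^ (p - 1) + B' * cyclotomic p ℤ := by
  have hirr : Irreducible (cyclotomic p ℤ) := cyclotomic.irreducible hp.pos
  have : IsDomain (AdjoinRoot (cyclotomic p ℤ)) := AdjoinRoot.isDomain_of_prime hirr.prime
  have hinj : Function.Injective (algebraMap ℤ (AdjoinRoot (cyclotomic p ℤ))) := by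
    apply AdjoinRoot.of.injective_of_degree_ne_zero
    rw [degree_cyclotomic]
    exact_mod_cast (Nat.totient_pos.2 hp.pos).ne'
  have : CharZero (AdjoinRoot (cyclotomic p ℤ)) := charZero_of_injective_algebraMap hinj
  have : NeZero (p : AdjoinRoot (cyclotomic p ℤ)) := ⟨by exact_mod_cast hp.ne_zero⟩
  have hζ : IsPrimitiveRoot (AdjoinRoot.root (cyclotomic p ℤ)) p := by
    rw [← isRoot_cyclotomic_iff]
    have := AdjoinRoot.isRoot_root (cyclotomic p ℤ)
    rwa [map_cyclotomic] at this
  set ζ := AdjoinRoot.root (cyclotomic p ℤ)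
  have hassoc : Associated ((ζ - 1) ^ (p - 1)) (p : AdjoinRoot (cyclotomic p ℤ)) := by
    obtain ⟨n, rfl⟩ : ∃ n, p = n + 1 := ⟨p - 1, by have := hp.pos; omega⟩
    have h := hζ.prod_one_sub_pow_eq_order
    push_cast
    have h' : (ζ - 1) ^ n = ∏ k ∈ Finset.range n, (ζ - 1) := by simp
    rw [← h, h']
    refine Associated.prod _ _ _ fun i hi => ?_
    rw [← neg_sub (ζ ^ (i + 1)), Associated.neg_right_iff]
    apply hζ.associated_sub_one_pow_sub_one_of_coprime
    exact (Nat.coprime_of_lt_prime (by omega) (by simpa using hi) hp).symm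
  obtain ⟨⟨a, ha⟩, b, hb⟩ := And.intro hassoc.dvd hassoc.symm.dvd
  obtain ⟨A, rfl⟩ := AdjoinRoot.mk_surjective b
  obtain ⟨A', rfl⟩ := AdjoinRoot.mk_surjective a
  have e1 : AdjoinRoot.mk (cyclotomic p ℤ) ((X - 1) ^ (p - 1)) =
      AdjoinRoot.mk (cyclotomic p ℤ) (A * C (p : ℤ)) := by
    rw [mul_comm]; simpa using hb
  have e2 : AdjoinRoot.mk (cyclotomic p ℤ) (C (p : ℤ)) =
      AdjoinRoot.mk (cyclotomic p ℤ) (A' * (X - 1) ^ (p - 1)) := by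
    rw [mul_comm]; simpa using ha
  rw [AdjoinRoot.mk_eq_mk] at e1 e2
  obtain ⟨B, hB⟩ := e1
  obtain ⟨B', hB'⟩ := e2
  exact ⟨A, B, A', B', by linear_combination hB, by linear_combination hB'⟩

lemma herbrand_aux {X : Type*} [AddCommGroup X] [Module.Finite ℤ X] (p : ℕ) (hp : p.Prime)
    (σ : Module.End ℤ X) (hσ : σ ^ p = 1)
    (hker : ∀ x, (∑ i ∈ Finset.range p, σ ^ i) x = 0 → ∃ y, (σ - 1) y = x) :
    ((LinearMap.range (∑ i ∈ Finset.range p, σ ^ i)).toAddSubgroup.relIndex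
      (LinearMap.ker (σ - 1)).toAddSubgroup) ^ (p - 1) * p ^ Module.finrank ℤ X =
      p ^ (Module.finrank ℤ (LinearMap.ker (σ - 1)) * p) := by
  set f := σ - 1 with hf
  set g := ∑ i ∈ Finset.range p, σ ^ i with hg
  have hfg : g * f = 0 := by rw [hg, hf, geom_sum_mul, hσ, sub_self]
  have hgf : f * g = 0 := by rw [hg, hf, mul_geom_sum, hσ, sub_self]
  have hY : LinearMap.range f = LinearMap.ker g := by
    ext x
    constructor
    · rintro ⟨y, rfl⟩
      exact LinearMap.congr_fun hfg y
    · exact fun hx => hker x hx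
  have hgI : ∀ x ∈ LinearMap.ker f, g x = (p : ℤ) • x := by
    intro x hx
    have hσx : σ x = x := by simpa [hf, sub_eq_zero] using hx
    have : ∀ i, (σ ^ i) x = x := by
      intro i
      induction i with
      | zero => rfl
      | succ i ih => rw [pow_succ, Module.End.mul_apply, hσx, ih]
    simp [hg, LinearMap.sum_apply, this]
  set I := LinearMap.ker f with hI
  set Y := LinearMap.range f with hYdef
  let fY : Module.End ℤ Y := f.restrict (p := Y) (q := Y) fun x _ => ⟨x, rfl⟩
  have hfY : ∀ y : Y, (fY y : X) = f y := fun y => rfl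
  have hpow : ∀ (i : ℕ) (y : Y), (((fY + 1) ^ i) y : X) = (σ ^ i) y := by
    intro i
    induction i with
    | zero => intro y; rfl
    | succ i ih =>
      intro y
      rw [pow_succ, Module.End.mul_apply, ih, pow_succ, Module.End.mul_apply]
      congr 1
      simp [hfY, hf]
  obtain ⟨A, B, A', B', h1, h2⟩ := exists_cyclotomic_dvd p hp
  have hcyc : aeval (fY + 1) (cyclotomic p ℤ) = 0 := by
    have := Fact.mk hp
    rw [cyclotomic_prime, map_sum]
    simp only [map_pow, aeval_X]
    ext y
    rw [LinearMap.sum_apply, AddSubmonoidClass.coe_finsetSum]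
    simp only [hpow]
    have h : (y : X) ∈ LinearMap.ker g := hY ▸ y.2
    rw [LinearMap.mem_ker, hg, LinearMap.sum_apply] at h
    exact h
  have e1 : fY ^ (p - 1) = aeval (fY + 1) A * ((p : ℤ) • 1) := by
    have := congrArg (aeval (fY + 1)) h1
    simpa [hcyc] using this
  have e2 : ((p : ℤ) • 1 : Module.End ℤ Y) = aeval (fY + 1) A' * fY ^ (p - 1) := by
    have := congrArg (aeval (fY + 1)) h2
    simpa [hcyc] using this
  have c1 : aeval (fY + 1) A * ((p : ℤ) • 1) = ((p : ℤ) • 1) * aeval (fY + 1) A := by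
    simpa using (Nat.cast_commute p (aeval (fY + 1) A)).eq.symm
  have c2 : aeval (fY + 1) A' * fY ^ (p - 1) = fY ^ (p - 1) * aeval (fY + 1) A' := by
    have h3 : (Polynomial.X - 1 : ℤ[X]) ^ (p - 1) * A' = A' * (Polynomial.X - 1) ^ (p - 1) := mul_comm _ _
    have := congrArg (aeval (fY + 1)) h3
    simpa using this.symm
  have hrange : LinearMap.range (fY ^ (p - 1)) = LinearMap.range ((p : ℤ) • (1 : Module.End ℤ Y)) := by
    apply le_antisymm
    · rw [e1, c1]; exact LinearMap.range_comp_le_range _ _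
    · rw [e2, c2]; exact LinearMap.range_comp_le_range _ _
  have hkereq : LinearMap.ker (fY ^ (p - 1)) = LinearMap.ker ((p : ℤ) • (1 : Module.End ℤ Y)) := by
    apply le_antisymm
    · rw [e2]; exact LinearMap.ker_le_ker_comp _ _
    · rw [e1]; exact LinearMap.ker_le_ker_comp _ _
  obtain ⟨hYi, hYfin⟩ := rangeIndex_smul_of_fg (A := Y) p hp.ne_zero
  obtain ⟨hIi, hIfin⟩ := rangeIndex_smul_of_fg (A := I) p hp.ne_zero
  have hP := rangeIndex_pow fY (p - 1) (by rw [hkereq]; exact hYfin) (p - 1) le_rfl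
  have hri : rangeIndex (fY ^ (p - 1)) = rangeIndex ((p : ℤ) • (1 : Module.End ℤ Y)) := by
    rw [rangeIndex, rangeIndex, hrange]
  rw [hri, hkereq, hYi] at hP
  have hposY : 0 < Nat.card (LinearMap.ker ((p : ℤ) • (1 : Module.End ℤ Y))) := Nat.card_pos
  have hP' : p ^ Module.finrank ℤ Y * Nat.card (LinearMap.ker fY) ^ (p - 1) =
      rangeIndex fY ^ (p - 1) := by
    apply Nat.eq_of_mul_eq_mul_left hposY
    linear_combination hP
  have hcard : Nat.card (LinearMap.ker fY) = Nat.card (LinearMap.ker ((p : ℤ) • (1 : Module.End ℤ I))) := by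
    refine Nat.card_congr
      { toFun := fun y => ⟨⟨y.1.1, ?_⟩, ?_⟩
        invFun := fun x => ⟨⟨x.1.1, ?_⟩, ?_⟩
        left_inv := fun y => rfl
        right_inv := fun x => rfl }
    · have := y.2
      rw [LinearMap.mem_ker, ← Subtype.coe_inj] at this
      exact this
    · rw [LinearMap.mem_ker]
      apply Subtype.ext
      have h := y.2
      rw [LinearMap.mem_ker, ← Subtype.coe_inj] at h
      have h3 : (y.1 : X) ∈ LinearMap.ker g := hY ▸ y.1.2
      have h' : f (y.1.1 : X) = 0 := h
      exact (hgI (y.1.1 : X) h').symm.trans h3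
    · rw [hY, LinearMap.mem_ker, hgI _ x.1.2]
      have h := x.2
      rw [LinearMap.mem_ker, ← Subtype.coe_inj] at h
      exact h
    · rw [LinearMap.mem_ker]
      apply Subtype.ext
      exact x.1.2
  have hGI : LinearMap.range g ≤ I := by
    rintro _ ⟨x, rfl⟩
    exact LinearMap.congr_fun hgf x
  have hAidx : rangeIndex fY = (I ⊔ Y).toAddSubgroup.index := by
    have h3 : rangeIndex fY = (Y.toAddSubgroup.map f.toAddMonoidHom).relIndex ((⊤ : AddSubgroup X).map f.toAddMonoidHom) := by
      have : (⊤ : AddSubgroup X).map f.toAddMonoidHom = Y.toAddSubgroup := by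
        ext x; simp [hYdef]
      rw [this, AddSubgroup.relIndex, rangeIndex]
      congr 1
      ext y
      constructor
      · rintro ⟨z, rfl⟩
        exact ⟨z.1, z.2, rfl⟩
      · rintro ⟨z, hz, hzy⟩
        exact ⟨⟨z, hz⟩, Subtype.ext hzy⟩
    rw [h3, AddSubgroup.relIndex_map_map, top_sup_eq, AddSubgroup.relIndex_top_right, sup_comm,
      Submodule.sup_toAddSubgroup]
    rfl
  have hpI : (Submodule.map g I).toAddSubgroup.relIndex I.toAddSubgroup = rangeIndex ((p : ℤ) • (1 : Module.End ℤ I)) := by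
    rw [rangeIndex, AddSubgroup.relIndex]
    congr 1
    ext x
    constructor
    · rintro ⟨z, hz, hzx⟩
      refine ⟨⟨z, hz⟩, Subtype.ext ?_⟩
      rw [hgI z hz] at hzx
      exact hzx
    · rintro ⟨z, rfl⟩
      exact ⟨z.1, z.2, hgI _ z.2⟩
  have hgidx : (Submodule.map g I).toAddSubgroup.relIndex (LinearMap.range g).toAddSubgroup = (I ⊔ Y).toAddSubgroup.index := by
    have h3 : (LinearMap.range g).toAddSubgroup = (⊤ : AddSubgroup X).map g.toAddMonoidHom := by
      ext x; simp
    have h4 : (Submodule.map g I).toAddSubgroup = I.toAddSubgroup.map g.toAddMonoidHom := by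
      ext x; simp
    rw [h3, h4, AddSubgroup.relIndex_map_map, top_sup_eq, AddSubgroup.relIndex_top_right, hY,
      Submodule.sup_toAddSubgroup]
    rfl
  have hmul := AddSubgroup.relIndex_mul_relIndex (Submodule.map g I).toAddSubgroup
    (LinearMap.range g).toAddSubgroup I.toAddSubgroup
    ((Submodule.toAddSubgroup_le _ _).2 (LinearMap.map_le_range)) ((Submodule.toAddSubgroup_le _ _).2 hGI)
  rw [hpI, hIi, hgidx, ← hAidx, ← hcard] at hmul
  have hcpos : 0 < Nat.card (LinearMap.ker fY) := by rw [hcard]; exact Nat.card_pos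
  have hrk : Module.finrank ℤ X = Module.finrank ℤ Y + Module.finrank ℤ I := by
    rw [← (LinearMap.ker f).finrank_quotient_add_finrank, f.quotKerEquivRange.finrank_eq]
  set E := (LinearMap.range g).toAddSubgroup.relIndex I.toAddSubgroup
  have hfinal := congrArg (· ^ (p - 1)) hmul
  simp only [mul_pow] at hfinal
  rw [← hP'] at hfinal
  obtain ⟨q, rfl⟩ : ∃ q, p = q + 1 := ⟨p - 1, by have := hp.pos; omega⟩
  simp only [Nat.add_sub_cancel] at hfinal ⊢
  rw [hrk]
  apply Nat.eq_of_mul_eq_mul_left (pow_pos hcpos q)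
  rw [pow_add]
  rw [← pow_mul] at hfinal
  rw [mul_add, pow_add _ (_ * q), mul_one]
  linear_combination ((q + 1) ^ Module.finrank ℤ I) * hfinal

end Herbrand
end CyclicSchur

namespace CyclicSchur
open NumberField IsDedekindDomain WithZero
open scoped WithZero

/-- Finite places of a number field. -/
abbrev Pl (K : Type*) [Field K] := HeightOneSpectrum (𝓞 K)

/-- The valuation attached to a finite place. -/
noncomputable abbrev vl {K : Type*} [Field K] [NumberField K] (v : Pl K) : Valuation K ℤᵐ⁰ :=
  v.valuation K

section Index
variable {G : Type*} [CommGroup G]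

lemma relIndex_le_card (H J : Subgroup G) {F : Type*} [Finite F] (f : J → F)
    (hf : ∀ x y : J, f x = f y → (x⁻¹ * y : G) ∈ H) :
    H.relIndex J ≤ Nat.card F ∧ H.relIndex J ≠ 0 := by
  have hinj : Function.Injective fun q : J ⧸ H.subgroupOf J => f q.out := by
    intro a b hab
    have := hf _ _ hab
    rw [← Quotient.out_eq a, ← Quotient.out_eq b]
    exact QuotientGroup.eq.2 this
  have : Finite (J ⧸ H.subgroupOf J) := Finite.of_injective _ hinj
  exact ⟨Nat.card_le_card_of_injective _ hinj, (Nat.card_pos (α := J ⧸ H.subgroupOf J)).ne'⟩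

lemma relIndex_eq_card (H J : Subgroup G) {F : Type*} (f : J → F)
    (hf : ∀ x y : J, f x = f y ↔ (x⁻¹ * y : G) ∈ H) (hs : Function.Surjective f) :
    H.relIndex J = Nat.card F := by
  refine Nat.card_congr (Equiv.ofBijective
    (Quotient.lift f fun a b h => (hf a b).2 <| by
      have h' : a⁻¹ * b ∈ H.subgroupOf J := QuotientGroup.leftRel_apply.1 h
      exact h') ⟨?_, ?_⟩)
  · intro a b
    induction a using Quotient.inductionOn
    induction b using Quotient.inductionOn
    intro h
    exact QuotientGroup.eq.2 ((hf _ _).1 h)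
  · intro x
    obtain ⟨y, rfl⟩ := hs x
    exact ⟨Quotient.mk _ y, rfl⟩
end Index

section
variable {K : Type*} [Field K] [NumberField K] (v : Pl K)

lemma exp_neg_le_one (N : ℕ) : (exp (-(N : ℤ)) : ℤᵐ⁰) ≤ 1 := by
  rw [← exp_zero, exp_le_exp]; omega

lemma lt_one_iff_le_exp (x : ℤᵐ⁰) : x < 1 ↔ x ≤ exp (-1) := by
  rw [← exp_zero]
  have := lt_mul_exp_iff_le (x := x) (y := exp (-1)) (by simp)
  rw [← exp_add] at this
  simpa using this

lemma lt_exp_neg_iff (x : ℤᵐ⁰) (M : ℕ) : x < exp (-(M : ℤ)) ↔ x ≤ exp (-((M + 1 : ℕ) : ℤ)) := by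
  have := lt_mul_exp_iff_le (x := x) (y := exp (-((M + 1 : ℕ) : ℤ))) (by simp)
  rw [← exp_add] at this
  rw [← this]
  congr! 2; push_cast; ring

lemma vl_eq_one_of_sub {x : K} (h : vl v (x - 1) < 1) : vl v x = 1 := by
  have := Valuation.map_add_eq_of_lt_right (vl v) (x := x - 1) (y := 1) (by simpa using h)
  simpa using this

/-- Units at `v` that are congruent to `1` modulo the `N`-th power of `v`. -/
def U (N : ℕ) : Subgroup Kˣ where
  carrier := {x | vl v (x : K) = 1 ∧ vl v ((x : K) - 1) ≤ exp (-(N : ℤ))}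
  one_mem' := by simp
  mul_mem' := by
    rintro x y ⟨hx, hx'⟩ ⟨hy, hy'⟩
    refine ⟨by simp [hx, hy], ?_⟩
    have : ((x * y : Kˣ) : K) - 1 = x * (y - 1) + (x - 1) := by push_cast; ring
    rw [this]
    refine (vl v).map_add_le ?_ hx'
    simpa [hx] using hy'
  inv_mem' := by
    rintro x ⟨hx, hx'⟩
    refine ⟨by simp [hx], ?_⟩
    have : ((x⁻¹ : Kˣ) : K) - 1 = -(x⁻¹ * (x - 1)) := by
      rw [mul_sub, Units.inv_mul]; push_cast; ring
    rw [this, Valuation.map_neg, map_mul]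
    simpa [hx] using hx'

variable {v}

lemma mem_U {N : ℕ} {x : Kˣ} :
    x ∈ U v N ↔ vl v (x : K) = 1 ∧ vl v ((x : K) - 1) ≤ exp (-(N : ℤ)) := Iff.rfl

lemma mem_U_of_sub {N : ℕ} (hN : N ≠ 0) {x : Kˣ} (h : vl v ((x : K) - 1) ≤ exp (-(N : ℤ))) :
    x ∈ U v N :=
  ⟨vl_eq_one_of_sub v (h.trans_lt (by rw [← exp_zero, exp_lt_exp]; omega)), h⟩

lemma mem_U_zero {x : Kˣ} : x ∈ U v 0 ↔ vl v (x : K) = 1 := by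
  refine ⟨fun h => h.1, fun h => ⟨h, ?_⟩⟩
  simpa [h] using (vl v).map_sub (x : K) 1

lemma U_anti {M N : ℕ} (h : M ≤ N) : U v N ≤ U v M := fun x hx =>
  ⟨hx.1, hx.2.trans (by rw [exp_le_exp]; omega)⟩

variable (v)

/-- The cardinality of the residue field at `v`. -/
noncomputable def resCard : ℕ := Nat.card (𝓞 K ⧸ v.asIdeal)

instance : Finite (𝓞 K ⧸ v.asIdeal) := Ideal.finiteQuotientOfFreeOfNeBot _ v.ne_bot

lemma exists_int_sub_lt (x : K) (h : vl v x ≤ 1) : ∃ r : 𝓞 K, vl v (x - r) < 1 := by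
  obtain ⟨r, hr⟩ := v.exists_valuation_sub_lt_of_integer h 1
  refine ⟨r, ?_⟩
  rw [← Valuation.map_neg, neg_sub]
  exact hr

open Classical in
/-- The residue class of a `v`-integral element. -/
noncomputable def res (x : K) : 𝓞 K ⧸ v.asIdeal :=
  if h : vl v x ≤ 1 then Ideal.Quotient.mk _ (exists_int_sub_lt v x h).choose else 0

variable {v}

lemma vl_int_lt_iff (a b : 𝓞 K) :
    Ideal.Quotient.mk v.asIdeal a = Ideal.Quotient.mk v.asIdeal b ↔ vl v ((a : K) - b) < 1 := by
  rw [Ideal.Quotient.eq, ← v.valuation_lt_one_iff_mem (K := K)]; simp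

lemma res_eq_mk {x : K} (h : vl v x ≤ 1) {a : 𝓞 K} (ha : vl v (x - a) < 1) :
    res v x = Ideal.Quotient.mk _ a := by
  rw [res, dif_pos h, vl_int_lt_iff]
  have := (exists_int_sub_lt v x h).choose_spec
  have e : ((exists_int_sub_lt v x h).choose : K) - a =
    (x - a) - (x - (exists_int_sub_lt v x h).choose) := by ring
  rw [e]
  exact (vl v).map_sub_lt ha this

lemma res_eq_iff {x y : K} (hx : vl v x ≤ 1) (hy : vl v y ≤ 1) :
    res v x = res v y ↔ vl v (x - y) < 1 := by
  obtain ⟨a, ha⟩ := exists_int_sub_lt v x hx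
  obtain ⟨b, hb⟩ := exists_int_sub_lt v y hy
  rw [res_eq_mk hx ha, res_eq_mk hy hb, vl_int_lt_iff]
  constructor
  · intro h
    have e : x - y = (x - a) - (y - b) + (a - b) := by ring
    rw [e]
    exact (vl v).map_add_lt ((vl v).map_sub_lt ha hb) h
  · intro h
    have e : (a : K) - b = (y - b) - (x - a) + (x - y) := by ring
    rw [e]
    exact (vl v).map_add_lt ((vl v).map_sub_lt hb ha) h

lemma res_surj (r : 𝓞 K ⧸ v.asIdeal) : ∃ a : 𝓞 K, res v (a : K) = r := by
  obtain ⟨a, rfl⟩ := Ideal.Quotient.mk_surjective r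
  exact ⟨a, res_eq_mk (v.valuation_le_one a) (by simp)⟩

variable (v)

lemma exists_unif : ∃ π : Kˣ, vl v (π : K) = exp (-1) := by
  obtain ⟨π, h⟩ := v.valuation_exists_uniformizer K
  exact ⟨Units.mk0 π (by rintro rfl; rw [map_zero] at h; exact exp_ne_zero h.symm), h⟩

lemma relIndex_U_succ {M : ℕ} (hM : M ≠ 0) : (U v (M + 1)).relIndex (U v M) = resCard v := by
  obtain ⟨π, hπ⟩ := exists_unif v
  have hπM : vl v ((π : K) ^ M) = exp (-(M : ℤ)) := by
    rw [map_pow, hπ, ← exp_nsmul]; simp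
  have hπ0 : (π : K) ^ M ≠ 0 := pow_ne_zero _ π.ne_zero
  have key : ∀ x : U v M, vl v (((x.1 : K) - 1) / π ^ M) ≤ 1 := by
    intro x
    rw [map_div₀, hπM]
    exact (div_le_one₀ (by simp)).2 x.2.2
  refine relIndex_eq_card _ _ (fun x => res v (((x.1 : K) - 1) / π ^ M)) ?_ ?_
  · intro x y
    rw [res_eq_iff (key x) (key y), ← sub_div, map_div₀, hπM, div_lt_one₀ (by simp), lt_exp_neg_iff]
    have e : ((x.1⁻¹ * y.1 : Kˣ) : K) - 1 = -(x.1⁻¹ * ((x.1 : K) - 1 - (y.1 - 1))) := by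
      push_cast; field_simp; ring
    have e2 : vl v (((x.1⁻¹ * y.1 : Kˣ) : K) - 1) = vl v ((x.1 : K) - 1 - (y.1 - 1)) := by
      rw [e, Valuation.map_neg, map_mul]; simp [x.2.1]
    rw [← e2]
    exact ⟨fun h => mem_U_of_sub (by omega) h, fun h => h.2⟩
  · intro r
    obtain ⟨a, rfl⟩ := res_surj r
    have h1 : vl v ((1 + π ^ M * (a : K)) - 1) ≤ exp (-(M : ℤ)) := by
      rw [add_sub_cancel_left, map_mul, hπM]
      exact mul_le_of_le_one_right' (v.valuation_le_one a)
    have h2 : (1 + π ^ M * (a : K)) ≠ 0 := by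
      intro h
      rw [h] at h1
      simp only [zero_sub, Valuation.map_neg, map_one] at h1
      rw [← exp_zero, exp_le_exp] at h1; omega
    refine ⟨⟨Units.mk0 _ h2, mem_U_of_sub hM h1⟩, ?_⟩
    simp [π.ne_zero]

lemma relIndex_U_one : (U v 1).relIndex (U v 0) = resCard v - 1 := by
  classical
  have h0 : res v (0 : K) = 0 := by
    rw [res_eq_mk (a := 0) (by simp) (by simp)]; simp
  have hle : ∀ x : U v 0, vl v (x.1 : K) ≤ 1 := fun x => x.2.1.le
  have : Nat.card {r : 𝓞 K ⧸ v.asIdeal // r ≠ 0} = resCard v - 1 := by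
    have := Fintype.ofFinite (𝓞 K ⧸ v.asIdeal)
    rw [Nat.card_eq_fintype_card, Fintype.card_subtype_compl, resCard, Nat.card_eq_fintype_card]
    simp
  rw [← this]
  refine relIndex_eq_card _ _ (fun x => ⟨res v (x.1 : K), ?_⟩) ?_ ?_
  · rw [← h0, Ne, res_eq_iff (hle x) (by simp)]
    simp [x.2.1]
  · intro x y
    rw [Subtype.mk_eq_mk, res_eq_iff (hle x) (hle y)]
    have e : ((x.1⁻¹ * y.1 : Kˣ) : K) - 1 = -(x.1⁻¹ * ((x.1 : K) - y.1)) := by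
      push_cast; field_simp; ring
    have e2 : vl v (((x.1⁻¹ * y.1 : Kˣ) : K) - 1) = vl v ((x.1 : K) - y.1) := by
      rw [e, Valuation.map_neg, map_mul]; simp [x.2.1]
    rw [← e2, lt_one_iff_le_exp]
    exact ⟨fun h => mem_U_of_sub (by omega) (by simpa using h), fun h => by simpa using h.2⟩
  · rintro ⟨r, hr⟩
    obtain ⟨a, rfl⟩ := res_surj r
    have hv : vl v (a : K) = 1 := by
      rw [← h0, Ne, res_eq_iff (v.valuation_le_one a) (by simp)] at hr
      exact le_antisymm (v.valuation_le_one a) (by simpa using hr)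
    have ha : (a : K) ≠ 0 := by intro h; simp [h] at hv
    exact ⟨⟨Units.mk0 _ ha, mem_U_zero.2 hv⟩, rfl⟩

lemma relIndex_U_add {M : ℕ} (hM : M ≠ 0) (d : ℕ) :
    (U v (M + d)).relIndex (U v M) = resCard v ^ d := by
  induction d with
  | zero => simp
  | succ d ih =>
    rw [← Subgroup.relIndex_mul_relIndex (U v (M + (d + 1))) (U v (M + d)) (U v M)
      (U_anti (by omega)) (U_anti (by omega)), ih, ← add_assoc, relIndex_U_succ v (by omega)]
    ring

lemma relIndex_U_zero (i : ℕ) :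
    (U v (i + 1)).relIndex (U v 0) = (resCard v - 1) * resCard v ^ i := by
  rw [← Subgroup.relIndex_mul_relIndex (U v (i + 1)) (U v 1) (U v 0)
      (U_anti (by omega)) (U_anti (by omega)), relIndex_U_one, add_comm, relIndex_U_add v (by omega)]
  ring

lemma one_lt_resCard : 1 < resCard v := by
  have : Nontrivial (𝓞 K ⧸ v.asIdeal) := Ideal.Quotient.nontrivial_iff.2 v.isPrime.ne_top
  exact Finite.one_lt_card

lemma relIndex_U_ne_zero (N : ℕ) : (U v N).relIndex (U v 0) ≠ 0 := by
  cases N with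
  | zero => simp
  | succ i =>
    rw [relIndex_U_zero]
    have := one_lt_resCard v
    exact mul_ne_zero (by omega) (by positivity)
end
end CyclicSchur

namespace CyclicSchur
open NumberField IsDedekindDomain WithZero
open scoped WithZero

lemma pow_sub_one_eq_prod {K : Type*} [Field K] {p : ℕ} (hp : 0 < p) {ζ : K} (hζ : IsPrimitiveRoot ζ p) (x : K) :
    x ^ p - 1 = ∏ i ∈ Finset.range p, (x - ζ ^ i) := by
  classical
  have h := hζ.pow_sub_pow_eq_prod_sub_mul x 1 hp
  have h2 : Polynomial.nthRootsFinset p (1 : K) = (Finset.range p).image (ζ ^ ·) := by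
    symm
    apply Finset.eq_of_subset_of_card_le
    · intro y hy
      obtain ⟨i, -, rfl⟩ := Finset.mem_image.1 hy
      rw [Polynomial.mem_nthRootsFinset hp, ← pow_mul, mul_comm, pow_mul, hζ.pow_eq_one, one_pow]
    · rw [hζ.card_nthRootsFinset, Finset.card_image_of_injOn, Finset.card_range]
      intro a ha b hb
      exact hζ.pow_inj (by simpa using ha) (by simpa using hb)
  rw [h2, Finset.prod_image] at h
  · simpa using h
  · intro a ha b hb
    exact hζ.pow_inj (by simpa using ha) (by simpa using hb)

lemma index_iInf_eq_prod_of_forall {G : Type*} [CommGroup G] {ι : Type*} [Fintype ι]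
    (H : ι → Subgroup G) (h : ∀ x : ι → G, ∃ y, ∀ i, (x i)⁻¹ * y ∈ H i) :
    (⨅ i, H i).index = ∏ i, (H i).index := by
  have hb : Function.Bijective (Subgroup.quotientiInfEmbedding H) := by
    refine ⟨(Subgroup.quotientiInfEmbedding H).injective, fun g => ?_⟩
    choose x hx using fun i => Quotient.exists_rep (g i)
    obtain ⟨y, hy⟩ := h x
    refine ⟨(y : G ⧸ (⨅ i, H i)), funext fun i => ?_⟩
    rw [Subgroup.quotientiInfEmbedding_apply_mk, ← hx i]
    exact (QuotientGroup.eq.2 (hy i)).symm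
  unfold Subgroup.index
  rw [Nat.card_congr (Equiv.ofBijective _ hb), Nat.card_pi]

section
variable {K : Type*} [Field K] [NumberField K]

/-- The subgroup of `p`-th powers. -/
abbrev Pw (K : Type*) [Field K] (p : ℕ) : Subgroup Kˣ := (powMonoidHom p).range

/-- Elements that are `p`-th powers up to a factor close to `1` at `v`. -/
def PP (p : ℕ) (v : Pl K) (N : ℕ) : Subgroup Kˣ := Pw K p ⊔ U v N

lemma PP_anti (p : ℕ) (v : Pl K) {M N : ℕ} (h : M ≤ N) : PP p v N ≤ PP p v M :=
  sup_le_sup_left (U_anti h) _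

lemma exists_ord (v : Pl K) (x : K) (hx : x ≠ 0) : ∃ n : ℤ, vl v x = exp n :=
  ⟨log (vl v x), (exp_log ((vl v).ne_zero_iff.2 hx)).symm⟩

lemma exists_ord_int (v : Pl K) (x : 𝓞 K) (hx : x ≠ 0) : ∃ n : ℕ, vl v (x : K) = exp (-(n : ℤ)) := by
  obtain ⟨n, hn⟩ := exists_ord v (x : K) (by simpa using hx)
  have h := v.valuation_le_one (K := K) x
  rw [hn, ← exp_zero, exp_le_exp] at h
  exact ⟨n.natAbs, by rw [hn]; congr 1; omega⟩

lemma exists_unif_zpow (v : Pl K) (n : ℤ) : ∃ x : Kˣ, vl v (x : K) = exp n := by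
  obtain ⟨π, hπ⟩ := exists_unif v
  refine ⟨π ^ (-n), ?_⟩
  rw [Units.val_zpow_eq_zpow_val, map_zpow₀, hπ, ← exp_zsmul]
  simp

lemma index_Pw_sup_U_zero (p : ℕ) [NeZero p] (v : Pl K) :
    (Pw K p ⊔ U v 0).index ≤ p ∧ (Pw K p ⊔ U v 0).index ≠ 0 := by
  have := relIndex_le_card (Pw K p ⊔ U v 0) ⊤ (F := ZMod p)
    (fun x => ((log (vl v (x.1 : K)) : ℤ) : ZMod p)) ?_
  · rwa [Subgroup.relIndex_top_right, Nat.card_zmod] at this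
  intro x y h
  rw [ZMod.intCast_eq_intCast_iff_dvd_sub] at h
  obtain ⟨k, hk⟩ := h
  obtain ⟨z, hz⟩ := exists_unif_zpow v k
  have : x.1⁻¹ * y.1 = z ^ p * (x.1⁻¹ * y.1 * (z ^ p)⁻¹) := by
    rw [mul_comm (z ^ p), inv_mul_cancel_right]
  change x.1⁻¹ * y.1 ∈ _
  rw [this]
  refine Subgroup.mul_mem_sup ⟨z, rfl⟩ (mem_U_zero.2 ?_)
  obtain ⟨a, ha⟩ := exists_ord v (x.1 : K) x.1.ne_zero
  obtain ⟨b, hb⟩ := exists_ord v (y.1 : K) y.1.ne_zero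
  rw [ha, hb, log_exp, log_exp] at hk
  push_cast
  rw [map_mul, map_mul, map_inv₀, map_inv₀, map_pow, ha, hb, hz, ← exp_neg, ← exp_nsmul, ← exp_neg,
    ← exp_add, ← exp_add, ← exp_zero]
  congr 1
  rw [nsmul_eq_mul]; linarith

lemma vl_root {p : ℕ} (hp : p ≠ 0) {ζ : K} (hζ : ζ ^ p = 1) (v : Pl K) : vl v ζ = 1 := by
  have : vl v ζ ^ p = 1 := by rw [← map_pow, hζ, map_one]
  have h0 : ζ ≠ 0 := by rintro rfl; simp [hp] at hζ
  obtain ⟨n, hn⟩ := exists_ord v ζ h0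
  rw [hn, ← exp_nsmul, ← exp_zero, exp_inj] at this
  have : n = 0 := by simpa [hp] using this
  rw [hn, this, exp_zero]

lemma mem_zeta_sup_U {p : ℕ} (hp : p.Prime) {ζ : Kˣ} (hζ : IsPrimitiveRoot ζ p) (v : Pl K)
    {d N : ℕ} (hd : vl v (p : K) = exp (-(d : ℤ))) (hdN : d < N) {x : Kˣ}
    (hx : x ^ p ∈ U v N) : x ∈ Subgroup.zpowers ζ ⊔ U v (N - d) := by
  have hζ' : IsPrimitiveRoot (ζ : K) p := hζ.map_of_injective (f := Units.coeHom K) Units.val_injective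
  obtain ⟨j, hj, hmin⟩ := (Finset.range p).exists_min_image (fun i => vl v ((x : K) - ζ ^ i))
    ⟨0, by simpa using hp.pos⟩
  set y : Kˣ := x * (ζ ^ j)⁻¹ with hy
  have hvz : ∀ i : ℕ, vl v ((ζ : K) ^ i) = 1 := fun i => by
    rw [map_pow, vl_root hp.ne_zero hζ'.pow_eq_one, one_pow]
  have hyx : ∀ i : ℕ, vl v ((y : K) - ζ ^ i) = vl v ((x : K) - ζ ^ (i + j)) := by
    intro i
    have : (x : K) - ζ ^ (i + j) = ((y : K) - ζ ^ i) * ζ ^ j := by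
      rw [hy]; push_cast; rw [sub_mul, inv_mul_cancel_right₀ (pow_ne_zero _ ζ.ne_zero), pow_add]
    rw [this, map_mul, hvz, mul_one]
  have hmin' : ∀ i : ℕ, vl v ((y : K) - 1) ≤ vl v ((y : K) - ζ ^ i) := by
    intro i
    have h0 := hyx 0
    rw [pow_zero, zero_add] at h0
    rw [h0, hyx i, ← pow_mod_orderOf (ζ : K) (i + j), ← hζ'.eq_orderOf]
    exact hmin _ (Finset.mem_range.2 (Nat.mod_lt _ hp.pos))
  have hyp : y ^ p = x ^ p := by
    rw [hy, mul_pow, inv_pow, ← pow_mul, mul_comm j, pow_mul, hζ.pow_eq_one]; simp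
  rw [← hyp] at hx
  have h1 := pow_sub_one_eq_prod hp.pos hζ' (y : K)
  obtain ⟨n, rfl⟩ : ∃ n, p = n + 1 := ⟨p - 1, by have := hp.pos; omega⟩
  have h2 := hζ'.prod_one_sub_pow_eq_order
  rw [Finset.prod_range_succ'] at h1
  have h3 : vl v ((y : K) - 1) * exp (-(d : ℤ)) ≤ exp (-(N : ℤ)) := by
    refine le_trans ?_ hx.2
    have : ((n : K) + 1) = ((n + 1 : ℕ) : K) := by push_cast; rfl
    rw [Units.val_pow_eq_pow_val, h1, ← hd, ← this, ← h2, map_mul, mul_comm, map_prod, map_prod, pow_zero]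
    have hle : ∀ i ∈ Finset.range n, vl v ((1 : K) - ζ ^ (i + 1)) ≤ vl v ((y : K) - ζ ^ (i + 1)) := ?_
    · have := Finset.prod_le_prod' hle
      gcongr
    intro i _
    have e : (1 : K) - ζ ^ (i + 1) = (y - ζ ^ (i + 1)) - (y - 1) := by ring
    rw [e]
    exact (vl v).map_sub_le le_rfl (hmin' _)
  have h4 : y ∈ U v (N - d) := by
    refine mem_U_of_sub (by omega) ?_
    have : (exp (-((N - d : ℕ) : ℤ)) : ℤᵐ⁰) = exp (-(N : ℤ)) * exp (d : ℤ) := by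
      rw [← exp_add]; congr 1; omega
    rw [this]
    calc vl v ((y : K) - 1) = vl v ((y : K) - 1) * exp (-(d : ℤ)) * exp (d : ℤ) := by
          rw [mul_assoc, ← exp_add]; simp
      _ ≤ _ := by gcongr
  have : x = ζ ^ j * y := by rw [hy, mul_comm, inv_mul_cancel_right]
  rw [this]
  exact Subgroup.mul_mem_sup (Subgroup.npow_mem_zpowers _ _) h4

lemma index_PP_le {p : ℕ} (hp : p.Prime) {ζ : Kˣ} (hζ : IsPrimitiveRoot ζ p) (v : Pl K)
    {d N : ℕ} (hd : vl v (p : K) = exp (-(d : ℤ))) (hdN : d < N) :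
    (PP p v N).index ≤ p ^ 2 * resCard v ^ d ∧ (PP p v N).index ≠ 0 := by
  have : NeZero p := ⟨hp.ne_zero⟩
  obtain ⟨h0, h0'⟩ := index_Pw_sup_U_zero (K := K) p v
  let φ : Kˣ →* Kˣ := powMonoidHom p
  have hU0 := relIndex_U_ne_zero v N
  -- comparison of the image and the kernel of the `p`-th power map on units at `v`
  let A := (U v 0).map φ ⊔ U v N
  let B := (U v N).comap φ ⊓ U v 0
  have hAle : A ≤ U v 0 := by
    refine sup_le ?_ (U_anti (Nat.zero_le _))
    rintro _ ⟨x, hx, rfl⟩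
    exact (U v 0).pow_mem hx p
  have hBge : U v N ≤ B := le_inf (fun x hx => (U v N).pow_mem hx p) (U_anti (Nat.zero_le _))
  have e1 : (U v N).relIndex A = B.relIndex (U v 0) := by
    rw [Subgroup.relIndex_sup_right, Subgroup.inf_relIndex_right, Subgroup.relIndex_comap]
  have e2 : (U v N).relIndex A * A.relIndex (U v 0) = (U v N).relIndex (U v 0) :=
    Subgroup.relIndex_mul_relIndex _ _ _ le_sup_right hAle
  have e3 : (U v N).relIndex B * B.relIndex (U v 0) = (U v N).relIndex (U v 0) :=
    Subgroup.relIndex_mul_relIndex _ _ _ hBge inf_le_right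
  have hA0 : A.relIndex (U v 0) ≠ 0 := fun h => hU0 (by rw [← e2, h, mul_zero])
  have hB0 : B.relIndex (U v 0) ≠ 0 := fun h => hU0 (by rw [← e3, h, mul_zero])
  have e4 : A.relIndex (U v 0) = (U v N).relIndex B := by
    rw [e1, ← e3, mul_comm] at e2
    exact Nat.eq_of_mul_eq_mul_right (Nat.pos_of_ne_zero hB0) e2
  let C := Subgroup.zpowers ζ ⊔ U v (N - d)
  have hBC : B ≤ C := fun x hx => mem_zeta_sup_U hp hζ v hd hdN hx.1
  have hC1 : (U v (N - d)).relIndex C ≤ p ∧ (U v (N - d)).relIndex C ≠ 0 := by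
    have hcard : Nat.card (Subgroup.zpowers ζ) = p := by
      rw [Nat.card_zpowers, hζ.eq_orderOf]
    have hdvd := Subgroup.relIndex_dvd_card (U v (N - d)) (Subgroup.zpowers ζ)
    rw [hcard] at hdvd
    rw [Subgroup.relIndex_sup_right]
    exact ⟨Nat.le_of_dvd hp.pos hdvd, fun h => hp.ne_zero (by simpa [h] using hdvd)⟩
  have hC2 : (U v N).relIndex (U v (N - d)) = resCard v ^ d := by
    have := relIndex_U_add v (M := N - d) (by omega) d
    rwa [Nat.sub_add_cancel hdN.le] at this
  have hC3 : (U v N).relIndex C = resCard v ^ d * (U v (N - d)).relIndex C := by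
    rw [← hC2]
    exact (Subgroup.relIndex_mul_relIndex _ _ _ (U_anti (Nat.sub_le _ _)) le_sup_right).symm
  have hq := one_lt_resCard v
  have hC0 : (U v N).relIndex C ≠ 0 := by
    rw [hC3]; exact mul_ne_zero (by positivity) hC1.2
  have hB : (U v N).relIndex B ≤ resCard v ^ d * p :=
    (Subgroup.relIndex_le_of_le_right hBC hC0).trans (by rw [hC3]; gcongr; exact hC1.1)
  have hAPP : A ≤ PP p v N := sup_le_sup_right (by rintro _ ⟨x, -, rfl⟩; exact ⟨x, rfl⟩) _
  have h1 : (PP p v N).relIndex (U v 0) ≤ resCard v ^ d * p :=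
    (Subgroup.relIndex_le_of_le_left hAPP hA0).trans (e4 ▸ hB)
  have h1' : (PP p v N).relIndex (U v 0) ≠ 0 := by
    have := Subgroup.relIndex_dvd_of_le_left (U v 0) hAPP
    intro h
    rw [h] at this
    exact hA0 (Nat.eq_zero_of_zero_dvd this)
  have e5 : (PP p v N).relIndex (Pw K p ⊔ U v 0) = (PP p v N).relIndex (U v 0) := by
    have : Pw K p ⊔ U v 0 = U v 0 ⊔ PP p v N := by
      rw [PP, sup_left_comm, sup_eq_left.2 (U_anti (Nat.zero_le N))]
    rw [this, Subgroup.relIndex_sup_right]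
  have e6 : (PP p v N).relIndex (Pw K p ⊔ U v 0) * (Pw K p ⊔ U v 0).index = (PP p v N).index :=
    Subgroup.relIndex_mul_index (sup_le_sup_left (U_anti (Nat.zero_le _)) _)
  rw [← e6, e5]
  refine ⟨?_, mul_ne_zero h1' h0'⟩
  calc _ ≤ resCard v ^ d * p * p := Nat.mul_le_mul h1 h0
    _ = _ := by ring

lemma prod_resCard_pow_le {p : ℕ} (hp : p.Prime) (S : Finset (Pl K)) (d : Pl K → ℕ)
    (hd : ∀ v ∈ S, vl v (p : K) = exp (-(d v : ℤ))) :
    ∏ v ∈ S, resCard v ^ d v ≤ p ^ Module.finrank ℚ K := by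
  have h1 : ∏ v ∈ S, v.asIdeal ^ d v ∣ Ideal.span {(p : 𝓞 K)} := by
    apply Finset.prod_dvd_of_coprime
    · intro v _ w _ hvw
      apply IsCoprime.pow
      have := v.isMaximal
      have := w.isMaximal
      rw [Ideal.isCoprime_iff_sup_eq]
      exact Ideal.IsMaximal.coprime_of_ne ‹_› ‹_› fun h => hvw (HeightOneSpectrum.ext h)
    · intro v hv
      rw [← v.intValuation_le_pow_iff_dvd]
      have := hd v hv
      rw [← this]
      have h := v.valuation_of_algebraMap (K := K) (p : 𝓞 K)
      have h' : algebraMap (𝓞 K) K (p : 𝓞 K) = p := map_natCast _ p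
      exact (h.symm.trans (congrArg (vl v) h')).le
  have h2 := map_dvd Ideal.absNorm h1
  have h3 : Ideal.absNorm (Ideal.span {(p : 𝓞 K)}) = p ^ Module.finrank ℚ K := by
    rw [Ideal.absNorm_span_natCast, RingOfIntegers.rank]
  rw [map_prod] at h2
  simp only [map_pow] at h2
  rw [h3] at h2
  exact Nat.le_of_dvd (pow_pos hp.pos _) h2

/-- Bound for the index of the elements that are locally almost `p`-th powers. -/
lemma index_iInf_PP_le {p : ℕ} (hp : p.Prime) {ζ : Kˣ} (hζ : IsPrimitiveRoot ζ p) (S : Finset (Pl K)) :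
    ∃ N₀ : ℕ, ∀ N ≥ N₀, (⨅ v : S, PP p v.1 N).index ≤ p ^ (2 * S.card + Module.finrank ℚ K) ∧
      (⨅ v : S, PP p v.1 N).index ≠ 0 := by
  have hp0 : (p : 𝓞 K) ≠ 0 := by exact_mod_cast hp.ne_zero
  have hd : ∀ v : Pl K, ∃ d : ℕ, vl v (p : K) = exp (-(d : ℤ)) := fun v => by
    simpa using exists_ord_int v (p : 𝓞 K) hp0
  choose d hd using hd
  refine ⟨S.sup d + 1, fun N hN => ?_⟩
  have h := fun v : S => index_PP_le hp hζ v.1 (hd v.1)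
    (lt_of_lt_of_le (Nat.lt_succ_of_le (Finset.le_sup (f := d) v.2)) hN)
  refine ⟨?_, Subgroup.index_iInf_ne_zero fun v => (h v).2⟩
  calc _ ≤ ∏ v : S, (PP p v.1 N).index := Subgroup.index_iInf_le _
    _ ≤ ∏ v : S, p ^ 2 * resCard v.1 ^ d v.1 := Finset.prod_le_prod' fun v _ => (h v).1
    _ = ∏ v ∈ S, p ^ 2 * resCard v ^ d v := Finset.prod_coe_sort S fun v => p ^ 2 * resCard v ^ d v
    _ ≤ _ := by
      rw [Finset.prod_mul_distrib, Finset.prod_const, ← pow_mul, pow_add]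
      exact Nat.mul_le_mul le_rfl (prod_resCard_pow_le hp S d fun v _ => hd v)

lemma weak_approx (S : Finset (Pl K)) (N : ℕ) (x : Pl K → Kˣ) :
    ∃ y : Kˣ, ∀ v ∈ S, (x v)⁻¹ * y ∈ U v N := by
  classical
  obtain rfl | hS := S.eq_empty_or_nonempty
  · exact ⟨1, by simp⟩
  obtain ⟨d, hd⟩ := IsLocalization.exist_integer_multiples (nonZeroDivisors (𝓞 K)) S
    (fun v => (x v : K))
  have hd0 : (algebraMap (𝓞 K) K d) ≠ 0 := by simp
  choose! a ha using hd
  have ha0 : ∀ v ∈ S, a v ≠ 0 := by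
    intro v hv h
    have := ha v hv
    rw [h, map_zero, Algebra.smul_def] at this
    exact mul_ne_zero hd0 (x v).ne_zero this.symm
  choose! n hn using fun v hv => exists_ord_int v (a v) (ha0 v hv)
  obtain ⟨y, hy⟩ := IsDedekindDomain.exists_forall_sub_mem_ideal (s := S)
    (fun v : Pl K => v.asIdeal) (fun v => n v + N + 1)
    (fun v _ => v.prime) (fun v _ w _ h h' => h (HeightOneSpectrum.ext h')) (fun v => a v)
  have key : ∀ v ∈ S, vl v ((y : K) / a v - 1) ≤ exp (-((N + 1 : ℕ) : ℤ)) := by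
    intro v hv
    have h := (v.intValuation_le_pow_iff_mem _ _).2 (hy v hv)
    rw [← v.valuation_of_algebraMap (K := K)] at h
    have e2 : algebraMap (𝓞 K) K (y - a v) = (y : K) - a v := map_sub _ _ _
    replace h := (congrArg (vl v) e2).ge.trans h
    have hav : (a v : K) ≠ 0 := by simpa using ha0 v hv
    rw [div_sub_one hav, map_div₀, hn v hv, div_eq_mul_inv, ← exp_neg]
    calc _ ≤ exp (-((n v + N + 1 : ℕ) : ℤ)) * exp (- -(n v : ℤ)) := by gcongr
      _ = _ := by rw [← exp_add]; congr 1; push_cast; ring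
  have hy0 : (y : K) ≠ 0 := by
    obtain ⟨v, hv⟩ := hS
    intro h
    have := key v hv
    rw [h, zero_div, zero_sub, Valuation.map_neg, map_one, ← exp_zero, exp_le_exp] at this
    push_cast at this; linarith
  refine ⟨Units.mk0 (y : K) hy0 / Units.mk0 _ hd0, fun v hv => U_anti (Nat.le_succ N) ?_⟩
  refine mem_U_of_sub (by simp) ?_
  have e := ha v hv
  rw [Algebra.smul_def] at e
  convert key v hv using 3
  push_cast
  have e' : (a v : K) = algebraMap (𝓞 K) K d * x v := e
  rw [e', Units.val_mk0, Units.val_mk0]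
  have := (x v).ne_zero
  field_simp

lemma index_iInf_eq_prod (S : Finset (Pl K)) (N : ℕ) (H : Pl K → Subgroup Kˣ)
    (hH : ∀ v ∈ S, U v N ≤ H v) : (⨅ v : S, H v.1).index = ∏ v ∈ S, (H v).index := by
  classical
  rw [← Finset.prod_coe_sort]
  refine index_iInf_eq_prod_of_forall _ fun x => ?_
  obtain ⟨y, hy⟩ := weak_approx S N (fun v => if h : v ∈ S then x ⟨v, h⟩ else 1)
  refine ⟨y, fun v => ?_⟩
  have := hH v.1 v.2 (hy v.1 v.2)
  rwa [dif_pos v.2] at this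

end
end CyclicSchur

namespace CyclicSchur
open NumberField IsDedekindDomain WithZero
open scoped WithZero

section
variable {K L : Type*} [Field K] [NumberField K] [Field L] [NumberField L]

/-- Transport of a place along an isomorphism of fields. -/
noncomputable def tr (e : K ≃+* L) (W : Pl K) : Pl L :=
  HeightOneSpectrum.equivOfRingEquiv (RingOfIntegers.mapRingEquiv e) W

lemma mem_tr (e : K ≃+* L) (W : Pl K) (x : 𝓞 K) :
    RingOfIntegers.mapRingEquiv e x ∈ (tr e W).asIdeal ↔ x ∈ W.asIdeal := by
  change (RingOfIntegers.mapRingEquiv e).symm (RingOfIntegers.mapRingEquiv e x) ∈ W.asIdeal ↔ _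
  rw [RingEquiv.symm_apply_apply]

lemma vl_le_iff_of_int (v : Pl K) (x : 𝓞 K) (n : ℕ) : vl v (x : K) ≤ exp (-(n : ℤ)) ↔ x ∈ v.asIdeal ^ n := by
  rw [← v.intValuation_le_pow_iff_mem, ← v.valuation_of_algebraMap (K := K)]

lemma eq_of_le_iff {a b : ℤᵐ⁰} (ha : ∃ n : ℕ, a = exp (-(n : ℤ))) (hb : ∃ n : ℕ, b = exp (-(n : ℤ)))
    (h : ∀ n : ℕ, a ≤ exp (-(n : ℤ)) ↔ b ≤ exp (-(n : ℤ))) : a = b := by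
  obtain ⟨n, rfl⟩ := ha
  obtain ⟨m, rfl⟩ := hb
  exact le_antisymm ((h m).2 le_rfl) ((h n).1 le_rfl)

lemma vl_tr (e : K ≃+* L) (W : Pl K) (x : K) : vl (tr e W) (e x) = vl W x := by
  have key : ∀ x : 𝓞 K, vl (tr e W) (e (x : K)) = vl W (x : K) := by
    intro x
    by_cases hx : x = 0
    · simp [hx]
    have hI : (tr e W).asIdeal = W.asIdeal.map (RingOfIntegers.mapRingEquiv e) := by
      ext y
      obtain ⟨x, rfl⟩ := (RingOfIntegers.mapRingEquiv e).surjective y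
      rw [mem_tr, Ideal.apply_mem_of_equiv_iff]
    rw [← RingOfIntegers.mapRingEquiv_apply]
    refine eq_of_le_iff (exists_ord_int _ _ (by simpa using hx)) (exists_ord_int _ _ hx) fun n => ?_
    rw [vl_le_iff_of_int, vl_le_iff_of_int, hI, ← Ideal.map_pow, Ideal.apply_mem_of_equiv_iff]
  obtain ⟨a, b, hb, rfl⟩ := IsFractionRing.div_surjective (A := 𝓞 K) x
  rw [map_div₀, map_div₀, map_div₀]
  congr 1
  · exact key a
  · exact key b

lemma Pl_ext {v w : Pl K} (h : ∀ x : K, vl v x = vl w x) : v = w := by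
  refine HeightOneSpectrum.ext (Ideal.ext fun x => ?_)
  rw [← v.valuation_lt_one_iff_mem (K := K), ← w.valuation_lt_one_iff_mem (K := K), h]

variable [Algebra K L]

/-- The place below a place. -/
noncomputable def dn (K : Type*) [Field K] [NumberField K] {L : Type*} [Field L] [NumberField L] [Algebra K L]
    (W : Pl L) : Pl K := W.under (𝓞 K)

instance (W : Pl L) : W.asIdeal.LiesOver (dn K W).asIdeal := ⟨rfl⟩

/-- Ramification index. -/
noncomputable def rI (K : Type*) [Field K] [NumberField K] {L : Type*} [Field L] [NumberField L] [Algebra K L]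
    (W : Pl L) : ℕ := W.asIdeal.ramificationIdx (𝓞 K)

/-- Residue degree. -/
noncomputable def rD (K : Type*) [Field K] [NumberField K] {L : Type*} [Field L] [NumberField L] [Algebra K L]
    (W : Pl L) : ℕ := W.asIdeal.inertiaDeg (𝓞 K)

lemma vl_algebraMap (W : Pl L) (x : K) : vl W (algebraMap K L x) = vl (dn K W) x ^ rI K W := by
  rw [← HeightOneSpectrum.valuation_liesOver L (dn K W) W x, rI,
    Ideal.ramificationIdx'_eq_ramificationIdx (dn K W).asIdeal W.asIdeal (dn K W).ne_bot]

lemma rI_pos (W : Pl L) : 0 < rI K W := Ideal.ramificationIdx_pos _ _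

lemma resCard_eq (W : Pl L) : resCard W = resCard (dn K W) ^ rD K W := by
  have := Ideal.absNorm_eq_pow_inertiaDeg'_of_liesOver W.asIdeal (dn K W).asIdeal (dn K W).isPrime
    (dn K W).ne_bot
  have := (dn K W).isMaximal
  rw [rD, ← Ideal.inertiaDeg'_eq_inertiaDeg (dn K W).asIdeal W.asIdeal]
  assumption

lemma dn_eq_iff {W : Pl L} {v : Pl K} : dn K W = v ↔ ∀ x : K, vl v x < 1 ↔ vl W (algebraMap K L x) < 1 := by
  constructor
  · rintro rfl x
    rw [vl_algebraMap, pow_lt_one_iff (rI_pos W).ne']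
  · intro h
    refine HeightOneSpectrum.ext (Ideal.ext fun x => ?_)
    rw [← v.valuation_lt_one_iff_mem (K := K), ← (dn K W).valuation_lt_one_iff_mem (K := K), h,
      vl_algebraMap, pow_lt_one_iff (rI_pos W).ne']

lemma exists_up (L : Type*) [Field L] [NumberField L] [Algebra K L] (v : Pl K) : ∃ W : Pl L, dn K W = v := by
  obtain ⟨Q, hQ, h⟩ := (inferInstance : Nonempty (v.asIdeal.primesOver (𝓞 L)))
  refine ⟨⟨Q, hQ, ?_⟩, ?_⟩
  · rintro rfl
    exact v.ne_bot (by rw [h.over]; simp)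
  · exact HeightOneSpectrum.ext h.over.symm

lemma finite_up (v : Pl K) : {W : Pl L | dn K W = v}.Finite := by
  have := IsDedekindDomain.primesOver_finite v.asIdeal (𝓞 L)
  refine Set.Finite.of_finite_image (f := fun W : Pl L => W.asIdeal) (this.subset ?_) fun W _ W' _ h => HeightOneSpectrum.ext h
  rintro _ ⟨W, rfl, rfl⟩
  exact ⟨W.isPrime, ⟨rfl⟩⟩

lemma dn_tr (σ : L ≃ₐ[K] L) (W : Pl L) : dn K (tr (σ : L ≃+* L) W) = dn K W := by
  rw [dn_eq_iff]
  intro x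
  have h := vl_tr (σ : L ≃+* L) W (algebraMap K L x)
  have h2 : (σ : L ≃+* L) (algebraMap K L x) = algebraMap K L x := σ.commutes x
  rw [h2] at h
  rw [h, dn_eq_iff.1 rfl]

variable [IsGalois K L]

lemma exists_tr_eq {W W' : Pl L} (h : dn K W = dn K W') : ∃ σ : L ≃ₐ[K] L, tr (σ : L ≃+* L) W = W' := by
  have : W'.asIdeal.LiesOver (dn K W).asIdeal := by rw [h]; infer_instance
  obtain ⟨σ, hσ⟩ := Ideal.exists_smul_eq_of_isGaloisGroup (dn K W).asIdeal W.asIdeal W'.asIdeal (L ≃ₐ[K] L)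
  refine ⟨σ, HeightOneSpectrum.ext (Ideal.ext fun y => ?_)⟩
  obtain ⟨x, rfl⟩ := (RingOfIntegers.mapRingEquiv (σ : L ≃+* L)).surjective y
  have e : RingOfIntegers.mapRingEquiv (σ : L ≃+* L) x = σ • x := RingOfIntegers.ext rfl
  rw [mem_tr, ← hσ, e, Ideal.smul_mem_pointwise_smul_iff]

lemma efg (W : Pl L) : {W' : Pl L | dn K W' = dn K W}.ncard * (rI K W * rD K W) = Module.finrank K L := by
  have h := Ideal.ncard_primesOver_mul_ramificationIdxIn_mul_inertiaDegIn (dn K W).asIdeal (𝓞 L) (L ≃ₐ[K] L)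
  rw [Ideal.ramificationIdxIn_eq_ramificationIdx _ W.asIdeal (L ≃ₐ[K] L),
    Ideal.inertiaDegIn_eq_inertiaDeg _ W.asIdeal (L ≃ₐ[K] L), IsGalois.card_aut_eq_finrank] at h
  rw [← h]
  congr 1
  refine Set.ncard_congr (fun W' _ => W'.asIdeal) ?_ (fun W _ W' _ h => HeightOneSpectrum.ext h) ?_
  · rintro W' h
    refine ⟨W'.isPrime, ?_⟩
    rw [← h]; infer_instance
  · rintro Q ⟨hQ, hQ'⟩
    refine ⟨⟨Q, hQ, ?_⟩, ?_, rfl⟩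
    · rintro rfl
      exact (dn K W).ne_bot (by rw [hQ'.over]; simp)
    · exact HeightOneSpectrum.ext hQ'.over.symm

end
end CyclicSchur

namespace CyclicSchur
open NumberField IsDedekindDomain WithZero
open scoped WithZero

section
variable {K L : Type*} [Field K] [Field L] [Algebra K L] [FiniteDimensional K L] [IsGalois K L]

lemma orderOf_gen {σ : L ≃ₐ[K] L} (hσ : ∀ τ, τ ∈ Subgroup.zpowers σ) :
    orderOf σ = Module.finrank K L := by
  rw [orderOf_eq_card_of_forall_mem_zpowers hσ, IsGalois.card_aut_eq_finrank]

lemma norm_eq_prod_pow {σ : L ≃ₐ[K] L} (hσ : ∀ τ, τ ∈ Subgroup.zpowers σ) (x : L) :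
    algebraMap K L (Algebra.norm K x) = ∏ i ∈ Finset.range (Module.finrank K L), (σ ^ i) x := by
  classical
  rw [Algebra.norm_eq_prod_automorphisms]
  symm
  refine Finset.prod_nbij (fun i => σ ^ i) (by simp) ?_ ?_ (by simp)
  · intro i hi j hj h
    exact pow_injOn_Iio_orderOf (by simpa [orderOf_gen hσ] using hi) (by simpa [orderOf_gen hσ] using hj) h
  · intro τ _
    have := hσ τ
    rw [mem_zpowers_iff_mem_range_orderOf, orderOf_gen hσ] at this
    simpa using this

/-- The norm on units. -/
noncomputable abbrev Nm (K : Type*) {L : Type*} [Field K] [Field L] [Algebra K L] : Lˣ →* Kˣ :=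
  Units.map (Algebra.norm K)

end

section
variable {K L : Type*} [Field K] [NumberField K] [Field L] [NumberField L] [Algebra K L]

lemma exists_int_sub_lt_of_rD {W : Pl L} (h : rD K W = 1) {y : L} (hy : vl W y ≤ 1) :
    ∃ r : 𝓞 K, vl W (y - algebraMap K L r) < 1 := by
  obtain ⟨s, hs⟩ := exists_int_sub_lt W y hy
  let f : 𝓞 K ⧸ (dn K W).asIdeal →+* 𝓞 L ⧸ W.asIdeal :=
    Ideal.quotientMap W.asIdeal (algebraMap (𝓞 K) (𝓞 L)) le_rfl
  have hf : Function.Injective f := Ideal.quotientMap_injective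
  have hb : Function.Bijective f := by
    refine (Nat.bijective_iff_injective_and_card f).2 ⟨hf, ?_⟩
    have := resCard_eq (K := K) W
    rw [h, pow_one] at this
    exact this.symm
  obtain ⟨q, hq⟩ := hb.2 (Ideal.Quotient.mk _ s)
  obtain ⟨r, rfl⟩ := Ideal.Quotient.mk_surjective q
  refine ⟨r, ?_⟩
  have e : Ideal.Quotient.mk W.asIdeal s = Ideal.Quotient.mk W.asIdeal (algebraMap (𝓞 K) (𝓞 L) r) :=
    hq.symm.trans (Ideal.quotientMap_mk ..)
  rw [vl_int_lt_iff] at e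
  have : y - algebraMap K L r = (y - s) + (s - algebraMap (𝓞 K) (𝓞 L) r) := by
    have : algebraMap K L r = (algebraMap (𝓞 K) (𝓞 L) r : 𝓞 L) := rfl
    rw [this]; ring
  rw [this]
  exact (vl W).map_add_lt hs e

lemma exists_approx {W : Pl L} (he : rI K W = 1) (hf : rD K W = 1) (x : L) (N : ℕ) :
    ∃ c : K, vl W (x - algebraMap K L c) ≤ exp (-(N : ℤ)) := by
  have hW : ∀ c : K, vl W (algebraMap K L c) = vl (dn K W) c := fun c => by rw [vl_algebraMap, he, pow_one]
  have key : ∀ (N : ℕ) (x : L), vl W x ≤ 1 → ∃ c : K, vl W (x - algebraMap K L c) ≤ exp (-(N : ℤ)) := by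
    intro N
    induction N with
    | zero => intro x hx; exact ⟨0, by simpa using hx⟩
    | succ N ih =>
      intro x hx
      obtain ⟨c, hc⟩ := ih x hx
      obtain ⟨π, hπ⟩ := exists_unif_zpow (dn K W) (-(N : ℤ))
      have hπ0 : algebraMap K L π ≠ 0 := by simp
      have h1 : vl W ((x - algebraMap K L c) / algebraMap K L π) ≤ 1 := by
        rw [map_div₀, hW, hπ, div_eq_mul_inv, ← exp_neg]
        calc _ ≤ exp (-(N : ℤ)) * exp (- -(N : ℤ)) := by gcongr
          _ = 1 := by rw [← exp_add]; simp
      obtain ⟨r, hr⟩ := exists_int_sub_lt_of_rD hf h1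
      refine ⟨c + π * r, ?_⟩
      have : x - algebraMap K L (c + π * r) = algebraMap K L π * ((x - algebraMap K L c) / algebraMap K L π - algebraMap K L r) := by
        rw [mul_sub, mul_div_cancel₀ _ hπ0, map_add, map_mul]; ring
      rw [this, map_mul, hW, hπ]
      rw [lt_one_iff_le_exp] at hr
      calc _ ≤ exp (-(N : ℤ)) * exp (-1) := by gcongr
        _ = _ := by rw [← exp_add]; congr 1; push_cast; ring
  by_cases hx : x = 0
  · exact ⟨0, by simp [hx]⟩
  obtain ⟨n, hn⟩ := exists_ord W x hx
  obtain ⟨π, hπ⟩ := exists_unif_zpow (dn K W) n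
  have hπ0 : algebraMap K L π ≠ 0 := by simp
  have h1 : vl W (x / algebraMap K L π) ≤ 1 := by
    rw [map_div₀, hW, hπ, hn, div_self exp_ne_zero]
  obtain ⟨c, hc⟩ := key (N + n.natAbs) _ h1
  refine ⟨π * c, ?_⟩
  have : x - algebraMap K L (π * c) = algebraMap K L π * (x / algebraMap K L π - algebraMap K L c) := by
    rw [mul_sub, mul_div_cancel₀ _ hπ0, map_mul]
  rw [this, map_mul, hW, hπ]
  calc _ ≤ exp n * exp (-((N + n.natAbs : ℕ) : ℤ)) := by gcongr
    _ ≤ _ := by rw [← exp_add, exp_le_exp]; omega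

/-- Invariance of a place under an automorphism. -/
def Inv (σ : L ≃ₐ[K] L) (W : Pl L) : Prop := ∀ x, vl W (σ x) = vl W x

lemma inv_iff {σ : L ≃ₐ[K] L} {W : Pl L} : Inv σ W ↔ tr (σ : L ≃+* L) W = W := by
  constructor
  · intro h
    refine Pl_ext fun x => ?_
    obtain ⟨x, rfl⟩ := σ.surjective x
    rw [h]
    exact vl_tr (σ : L ≃+* L) W x
  · intro h x
    have := vl_tr (σ : L ≃+* L) W x
    rw [h] at this
    exact this

lemma Inv.pow {σ : L ≃ₐ[K] L} {W : Pl L} (h : Inv σ W) (i : ℕ) : Inv (σ ^ i) W := by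
  induction i with
  | zero => intro x; simp
  | succ i ih => intro x; rw [pow_succ', AlgEquiv.mul_apply, h, ih]

lemma Inv.symm {σ : L ≃ₐ[K] L} {W : Pl L} (h : Inv σ W) : Inv σ⁻¹ W := fun x => by
  rw [← h, AlgEquiv.aut_inv, AlgEquiv.apply_symm_apply]

lemma Inv.of_mem {σ : L ≃ₐ[K] L} {W : Pl L} (h : Inv σ W) {τ : L ≃ₐ[K] L} (hτ : τ ∈ Subgroup.zpowers σ) :
    Inv τ W := by
  obtain ⟨i, rfl⟩ := hτ
  obtain ⟨n, rfl | rfl⟩ := i.eq_nat_or_neg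
  · simpa using h.pow n
  · simpa using (h.pow n).symm

variable [IsGalois K L]

lemma Inv.unique {σ : L ≃ₐ[K] L} (hσ : ∀ τ, τ ∈ Subgroup.zpowers σ) {W W' : Pl L} (h : Inv σ W)
    (hW : dn K W = dn K W') : W' = W := by
  obtain ⟨τ, rfl⟩ := exists_tr_eq hW
  exact inv_iff.1 (h.of_mem (hσ τ))

lemma Inv.ef {σ : L ≃ₐ[K] L} (hσ : ∀ τ, τ ∈ Subgroup.zpowers σ) {W : Pl L} (h : Inv σ W) :
    rI K W * rD K W = Module.finrank K L := by
  have := efg (K := K) W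
  rwa [show {W' : Pl L | dn K W' = dn K W} = {W} from
    Set.eq_singleton_iff_unique_mem.2 ⟨rfl, fun W' hW' => h.unique hσ hW'.symm⟩,
    Set.ncard_singleton, one_mul] at this

lemma tr_pow_succ (σ : L ≃ₐ[K] L) (i : ℕ) (W : Pl L) :
    tr ((σ ^ (i + 1) : L ≃ₐ[K] L) : L ≃+* L) W = tr (σ : L ≃+* L) (tr ((σ ^ i : L ≃ₐ[K] L) : L ≃+* L) W) := by
  refine Pl_ext fun x => ?_
  obtain ⟨x, rfl⟩ := (σ ^ (i + 1)).surjective x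
  trans vl W x
  · exact vl_tr _ W x
  · rw [pow_succ', AlgEquiv.mul_apply]
    exact ((vl_tr (σ : L ≃+* L) _ _).trans (vl_tr ((σ ^ i : L ≃ₐ[K] L) : L ≃+* L) W x)).symm

lemma split_of_not_inv {p : ℕ} (hp : p.Prime) (hL : Module.finrank K L = p) {σ : L ≃ₐ[K] L}
    {W : Pl L} (h : ¬ Inv σ W) :
    {W' : Pl L | dn K W' = dn K W}.ncard = p ∧ rI K W = 1 ∧ rD K W = 1 := by
  have h1 := efg (K := K) W
  rw [hL] at h1
  have h2 : {W' : Pl L | dn K W' = dn K W}.ncard ≠ 1 := by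
    intro h3
    obtain ⟨W', h4⟩ := Set.ncard_eq_one.1 h3
    refine h (inv_iff.2 ?_)
    have h5 : W ∈ {W' : Pl L | dn K W' = dn K W} := rfl
    have h6 : tr (σ : L ≃+* L) W ∈ {W' : Pl L | dn K W' = dn K W} := dn_tr σ W
    rw [h4] at h5 h6
    exact h6.trans h5.symm
  rcases (Nat.dvd_prime hp).1 (Dvd.intro _ h1) with h3 | h3
  · exact absurd h3 h2
  · rw [h3] at h1
    have := Nat.eq_of_mul_eq_mul_left hp.pos (h1.trans (mul_one p).symm)
    exact ⟨h3, Nat.eq_one_of_mul_eq_one_right this, Nat.eq_one_of_mul_eq_one_left this⟩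

lemma vl_norm {σ : L ≃ₐ[K] L} (hσ : ∀ τ, τ ∈ Subgroup.zpowers σ) {W : Pl L} (h : Inv σ W) (x : L) :
    vl (dn K W) (Algebra.norm K x) ^ rI K W = vl W x ^ Module.finrank K L := by
  rw [← vl_algebraMap, norm_eq_prod_pow hσ, map_prod, Finset.prod_congr rfl fun i _ => h.pow i x]
  simp

end
end CyclicSchur

namespace CyclicSchur
open NumberField IsDedekindDomain WithZero
open scoped WithZero

lemma exists_geom_eq {p : ℕ} (hp : p.Prime) : ∃ h : Polynomial ℤ,
    ∑ j ∈ Finset.range p, (Polynomial.X : Polynomial ℤ) ^ j = (Polynomial.X - 1) ^ (p - 1) + Polynomial.C (p : ℤ) * h := by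
  have : Fact p.Prime := ⟨hp⟩
  have h1 : ((∑ j ∈ Finset.range p, (Polynomial.X : Polynomial ℤ) ^ j) - (Polynomial.X - 1) ^ (p - 1)).map
      (Int.castRingHom (ZMod p)) = 0 := by
    simp only [Polynomial.map_sub, Polynomial.map_pow, Polynomial.map_sum, Polynomial.map_X, Polynomial.map_one]
    have h2 : (Polynomial.X - 1 : Polynomial (ZMod p)) ≠ 0 := by
      simpa using Polynomial.X_sub_C_ne_zero (1 : ZMod p)
    refine mul_right_cancel₀ h2 ?_
    rw [sub_mul, geom_sum_mul, pow_sub_one_mul hp.ne_zero, sub_pow_char, one_pow, sub_self, zero_mul]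
  have h3 : Polynomial.C (p : ℤ) ∣ (∑ j ∈ Finset.range p, (Polynomial.X : Polynomial ℤ) ^ j) - (Polynomial.X - 1) ^ (p - 1) := by
    rw [Polynomial.C_dvd_iff_dvd_coeff]
    intro i
    have := congrArg (fun f => Polynomial.coeff f i) h1
    simp only [Polynomial.coeff_map, Polynomial.coeff_zero] at this
    exact (ZMod.intCast_zmod_eq_zero_iff_dvd _ _).1 (by simpa using this)
  obtain ⟨h, hh⟩ := h3
  exact ⟨h, by rw [← hh]; ring⟩

lemma exists_esymm_le {L : Type*} [Field L] (w : Valuation L ℤᵐ⁰) {p : ℕ} (x : Fin p → L) (c : ℤᵐ⁰) (hc : c ≤ 1)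
    (h_lt : ∀ k : ℕ, 0 < k → k < p → w k = 1)
    (h : ∀ k : ℕ, 0 < k → w (∑ i, x i ^ k) ≤ c) (hN : w (∏ i, x i) ≤ c) :
    w (∏ i, (1 + x i) - 1) ≤ c := by
  let E : ℕ → L := fun k => MvPolynomial.aeval x (MvPolynomial.esymm (Fin p) ℤ k)
  have hE : ∀ k, E k = ∑ t ∈ Finset.powersetCard k Finset.univ, ∏ i ∈ t, x i := fun k => by
    simp [E, MvPolynomial.esymm]
  have hE0 : E 0 = 1 := by rw [hE]; simp
  have hk : ∀ k, 0 < k → k < p → w (E k) ≤ c := by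
    intro k
    induction k using Nat.strong_induction_on with
    | _ k ih =>
      intro hk0 hkp
      have := congrArg (MvPolynomial.aeval x) (MvPolynomial.mul_esymm_eq_sum (Fin p) ℤ k)
      simp only [map_mul, map_natCast, map_sum, map_pow, map_neg, map_one] at this
      change (k : L) * E k = _ at this
      have h2 := congrArg w this
      rw [map_mul, h_lt k hk0 hkp, one_mul] at h2
      rw [h2, map_mul, map_pow, Valuation.map_neg, map_one, one_pow, one_mul]
      refine w.map_sum_le fun a ha => ?_
      rw [Finset.mem_filter] at ha
      have ha1 := Finset.HasAntidiagonal.mem_antidiagonal.1 ha.1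
      have ha2 := ha.2
      have hps : w (MvPolynomial.aeval x (MvPolynomial.psum (Fin p) ℤ a.2)) ≤ c := by
        have : MvPolynomial.aeval x (MvPolynomial.psum (Fin p) ℤ a.2) = ∑ i, x i ^ a.2 := by
          simp [MvPolynomial.psum]
        rw [this]
        exact h _ (by omega)
      have he : w (E a.1) ≤ 1 := by
        rcases Nat.eq_zero_or_pos a.1 with h0 | h0
        · rw [h0, hE0, map_one]
        · exact (ih a.1 ha2 h0 (by omega)).trans hc
      rw [map_mul, map_mul, map_pow, Valuation.map_neg, map_one, one_pow, one_mul]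
      calc _ ≤ 1 * c := mul_le_mul' he hps
        _ = c := one_mul c
  have hsum : ∏ i, (1 + x i) = ∑ k ∈ Finset.range (p + 1), E k := by
    rw [Finset.prod_one_add, Finset.sum_powerset]
    simp only [hE, Finset.card_univ, Fintype.card_fin]
  obtain rfl | hp := Nat.eq_zero_or_pos p
  · simp
  rw [hsum, Finset.sum_range_succ', hE0, add_sub_cancel_right]
  refine w.map_sum_le fun k hk' => ?_
  rcases (Nat.lt_or_ge (k + 1) p) with h1 | h1
  · exact hk _ (Nat.succ_pos _) h1
  · have : k + 1 = p := le_antisymm (by simpa using hk') h1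
    rw [this, hE]
    have : Finset.powersetCard p (Finset.univ : Finset (Fin p)) = {Finset.univ} := by
      simpa using Finset.powersetCard_self (Finset.univ : Finset (Fin p))
    rw [this]
    simpa using hN

section
variable {K L : Type*} [Field K] [NumberField K] [Field L] [NumberField L] [Algebra K L]

/-- The action of an automorphism on units. -/
abbrev sg (σ : L ≃ₐ[K] L) : Lˣ →* Lˣ := Units.map (σ : L →* L)

lemma exists_ram_break {σ : L ≃ₐ[K] L} {W : Pl L} (hinv : Inv σ W) (hf : rD K W = 1)
    (hne : ∃ x, σ x ≠ x) : ∃ t : ℕ, (∀ x, vl W x ≤ 1 → vl W (σ x - x) ≤ exp (-((t + 1 : ℕ) : ℤ))) ∧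
      ∀ π, vl W π = exp (-1) → ¬ vl W (σ π - π) ≤ exp (-((t + 2 : ℕ) : ℤ)) := by
  classical
  let P : ℕ → Prop := fun m => ∀ x, vl W x ≤ 1 → vl W (σ x - x) ≤ exp (-(m : ℤ))
  have hfix : ∀ (x : L) (r : 𝓞 K), σ x - x = σ (x - algebraMap K L r) - (x - algebraMap K L r) := by
    intro x r; rw [map_sub, AlgEquiv.commutes]; ring
  have hlt : ∀ x, vl W x < 1 → vl W (σ x - x) < 1 := fun x hx =>
    (vl W).map_sub_lt ((hinv x).trans_lt hx) hx
  have hP1 : P 1 := by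
    intro x hx
    obtain ⟨r, hr⟩ := exists_int_sub_lt_of_rD hf hx
    rw [hfix x r]
    exact (lt_one_iff_le_exp _).1 (hlt _ hr)
  have hnot : ∃ m, ¬ P m := by
    by_contra! hall
    obtain ⟨x, hx⟩ := hne
    obtain ⟨a, b, hb, rfl⟩ := IsFractionRing.div_surjective (A := 𝓞 L) x
    have hz : ∀ a : 𝓞 L, σ (a : L) = a := by
      intro a
      by_contra h
      obtain ⟨n, hn⟩ := exists_ord W _ (sub_ne_zero.2 h)
      have := hall (n.natAbs + 1) a (W.valuation_le_one a)
      rw [hn, exp_le_exp] at this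
      push_cast at this
      have := neg_abs_le n
      linarith
    exact hx (by rw [map_div₀]; exact congrArg₂ (· / ·) (hz a) (hz b))
  have hm := Nat.find_spec hnot
  have hmin := fun k => Nat.find_min hnot (m := k)
  set m := Nat.find hnot
  have hm0 : m ≠ 0 := by
    rintro h
    rw [h] at hm
    exact hm fun x hx => (hP1 x hx).trans (by rw [exp_le_exp]; simp)
  have hm1 : m ≠ 1 := fun h => hm (h ▸ hP1)
  obtain ⟨t, ht⟩ : ∃ t, m = t + 2 := ⟨m - 2, by omega⟩
  refine ⟨t, not_not.1 (hmin (t + 1) (by omega)), fun π hπ hle => hm ?_⟩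
  rw [ht]
  intro x hx
  obtain ⟨r, hr⟩ := exists_int_sub_lt_of_rD hf hx
  rw [hfix x r]
  set y := x - algebraMap K L r
  have hπ0 : π ≠ 0 := by rintro rfl; rw [map_zero] at hπ; exact exp_ne_zero hπ.symm
  have hy : vl W (y / π) ≤ 1 := by
    rw [map_div₀, hπ, div_eq_mul_inv, ← exp_neg]
    calc _ ≤ exp (-1) * exp (- -1) := by gcongr; exact (lt_one_iff_le_exp _).1 hr
      _ = 1 := by rw [← exp_add]; simp
  have e : σ y - y = σ π * (σ (y / π) - y / π) + (σ π - π) * (y / π) := by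
    have : σ y = σ π * σ (y / π) := by rw [← map_mul, mul_div_cancel₀ _ hπ0]
    rw [this]; field_simp; ring
  rw [e]
  refine (vl W).map_add_le ?_ ?_
  · rw [map_mul, hinv, hπ]
    calc _ ≤ exp (-1) * exp (-((t + 1 : ℕ) : ℤ)) := by
          gcongr; exact not_not.1 (hmin (t + 1) (by omega)) _ hy
      _ = _ := by rw [← exp_add]; congr 1; push_cast; ring
  · rw [map_mul]
    calc _ ≤ exp (-((t + 2 : ℕ) : ℤ)) * 1 := mul_le_mul' hle hy
      _ = _ := mul_one _

lemma vl_sub_le {σ : L ≃ₐ[K] L} {W : Pl L} (hinv : Inv σ W) {t : ℕ}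
    (h : ∀ x, vl W x ≤ 1 → vl W (σ x - x) ≤ exp (-((t + 1 : ℕ) : ℤ))) (z : L) :
    vl W (σ z - z) ≤ vl W z * exp (-(t : ℤ)) := by
  by_cases hz : z = 0
  · simp [hz]
  rcases Nat.eq_zero_or_pos t with rfl | ht
  · simpa [hinv z] using (vl W).map_sub (σ z) z
  obtain ⟨π, hπ⟩ := exists_unif W
  obtain ⟨n, hn⟩ := exists_ord W z hz
  have hφ : ∀ x : Lˣ, sg σ x / x ∈ U W t ↔ vl W (σ x - x) ≤ vl W (x : L) * exp (-(t : ℤ)) := by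
    intro x
    have e : (((sg σ x / x : Lˣ) : L) - 1) = (σ x - x) / x := by
      push_cast
      rw [sub_div, div_self x.ne_zero]; rfl
    have e2 : vl W (((sg σ x / x : Lˣ) : L) - 1) ≤ exp (-(t : ℤ)) ↔
        vl W (σ x - x) ≤ vl W (x : L) * exp (-(t : ℤ)) := by
      rw [e, map_div₀, mul_comm, div_le_iff₀ (zero_lt_iff.2 ((vl W).ne_zero_iff.2 x.ne_zero))]
    rw [← e2]
    exact ⟨fun h => h.2, fun h => mem_U_of_sub ht.ne' h⟩
  have hmul : ∀ x y : Lˣ, sg σ (x * y) / (x * y) = sg σ x / x * (sg σ y / y) := fun x y => by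
    rw [map_mul, mul_div_mul_comm]
  have hpow : ∀ (x : Lˣ) (n : ℤ), sg σ (x ^ n) / (x ^ n) = (sg σ x / x) ^ n := fun x n => by
    rw [map_zpow, div_zpow]
  have h1 : sg σ π / π ∈ U W t := by
    rw [hφ, hπ, ← exp_add]
    refine (h π (by rw [hπ, ← exp_zero, exp_le_exp]; simp)).trans_eq ?_
    congr 1; push_cast; ring
  set u : Lˣ := π ^ n * Units.mk0 z hz with hu
  have hu1 : vl W (u : L) = 1 := by
    rw [hu]; push_cast
    rw [Units.val_mk0, map_mul, map_zpow₀, hπ, hn, ← exp_zsmul, ← exp_add]; simp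
  have h2 : sg σ u / u ∈ U W t := by
    rw [hφ, hu1, one_mul]
    refine (h u hu1.le).trans ?_
    rw [exp_le_exp]; push_cast; linarith
  have h3 : Units.mk0 z hz = π ^ (-n) * u := by rw [hu, zpow_neg, inv_mul_cancel_left]
  have h4 := (hφ (Units.mk0 z hz)).1 (by
    rw [h3, hmul, hpow]
    exact (U W t).mul_mem ((U W t).zpow_mem h1 _) h2)
  simpa using h4

lemma vl_int_le_one (v : Pl K) (n : ℤ) : vl v (n : K) ≤ 1 := by
  have := v.valuation_le_one (K := K) (n : 𝓞 K)
  simpa using this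

lemma vl_trace_le {p : ℕ} (hp : p.Prime) {σ : L ≃ₐ[K] L} {W : Pl L} (hinv : Inv σ W) {t : ℕ}
    (h : ∀ z, vl W (σ z - z) ≤ vl W z * exp (-(t : ℤ)))
    (hpt : vl W (p : L) ≤ exp (-((t * (p - 1) : ℕ) : ℤ))) (z : L) :
    vl W (∑ i ∈ Finset.range p, (σ ^ i) z) ≤ vl W z * exp (-((t * (p - 1) : ℕ) : ℤ)) := by
  obtain ⟨g, hg⟩ := exists_geom_eq hp
  let S : Module.End ℤ L := (σ : L →+ L).toIntLinearMap
  have hS : ∀ x, S x = σ x := fun x => rfl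
  have hSi : ∀ (i : ℕ) x, (S ^ i) x = (σ ^ i) x := by
    intro i
    induction i with
    | zero => intro x; rfl
    | succ i ih => intro x; rw [pow_succ', pow_succ', Module.End.mul_apply, ih, hS]; rfl
  have h1 := congrArg (fun f => Polynomial.aeval S f z) hg
  simp only [map_sum, map_pow, Polynomial.aeval_X, map_add, map_sub, map_one, map_mul,
    Polynomial.aeval_C, LinearMap.sum_apply, LinearMap.add_apply, Module.End.mul_apply] at h1
  simp only [hSi] at h1
  rw [h1]
  refine (vl W).map_add_le ?_ ?_
  · have : ∀ m : ℕ, vl W (((S - 1) ^ m) z) ≤ vl W z * exp (-((t * m : ℕ) : ℤ)) := by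
      intro m
      induction m with
      | zero => simp
      | succ m ih =>
        rw [pow_succ', Module.End.mul_apply]
        calc _ ≤ vl W (((S - 1) ^ m) z) * exp (-(t : ℤ)) := h _
          _ ≤ vl W z * exp (-((t * m : ℕ) : ℤ)) * exp (-(t : ℤ)) := by gcongr
          _ = _ := by rw [mul_assoc, ← exp_add]; congr 2; push_cast; ring
    exact this _
  · have hg' : ∀ g : Polynomial ℤ, vl W (Polynomial.aeval S g z) ≤ vl W z := by
      intro g
      rw [Polynomial.aeval_eq_sum_range, LinearMap.sum_apply]
      refine (vl W).map_sum_le fun i _ => ?_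
      rw [LinearMap.smul_apply, zsmul_eq_mul, map_mul, hSi, hinv.pow i]
      exact mul_le_of_le_one_left' (vl_int_le_one W _)
    have e : (algebraMap ℤ (Module.End ℤ L) (p : ℤ)) (Polynomial.aeval S g z) = (p : L) * Polynomial.aeval S g z := by
      simp
    rw [e, map_mul, mul_comm]
    exact mul_le_mul' (hg' g) hpt

end

end CyclicSchur

namespace CyclicSchur
open NumberField IsDedekindDomain WithZero
open scoped WithZero

section
variable {K L : Type*} [Field K] [NumberField K] [Field L] [NumberField L] [Algebra K L]

/-- Elements of `Kˣ` which are approximately norms from `L` at the place `v`. -/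
noncomputable def NN (L : Type*) [Field L] [Algebra K L] (v : Pl K) (N : ℕ) : Subgroup Kˣ :=
  (Nm K (L := L)).range ⊔ U v N

lemma NN_anti (v : Pl K) {M N : ℕ} (h : M ≤ N) : NN L v N ≤ NN L v M :=
  sup_le_sup_left (U_anti h) _

lemma vl_le_of_vl_dn_lt {W : Pl L} {p : ℕ} (he : rI K W = p) {x : K} {t : ℕ}
    (h : vl W (algebraMap K L x) ≤ exp (-((t * p + 1 : ℕ) : ℤ))) : vl (dn K W) x ≤ exp (-((t + 1 : ℕ) : ℤ)) := by
  rw [vl_algebraMap, he] at h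
  by_cases hx : x = 0
  · simp [hx]
  obtain ⟨n, hn⟩ := exists_ord (dn K W) x hx
  rw [hn, ← exp_nsmul, exp_le_exp] at h
  rw [hn, exp_le_exp]
  push_cast at *
  by_contra! hc
  have : -(t : ℤ) ≤ n := by omega
  have h3 : -(t : ℤ) * p ≤ n * p := mul_le_mul_of_nonneg_right this (by positivity)
  simp only [nsmul_eq_mul] at h
  linarith

lemma vl_natCast_eq_one {W : Pl L} {p : ℕ} (hp : p.Prime) (h : vl W (p : L) < 1) (k : ℕ) (hk : 0 < k) (hkp : k < p) :
    vl W (k : L) = 1 := by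
  refine le_antisymm (by simpa using vl_int_le_one W (k : ℤ)) ?_
  by_contra! hlt
  have hc : IsCoprime (k : ℤ) (p : ℤ) := by
    rw [Nat.isCoprime_iff_coprime]
    exact (Nat.Coprime.symm ((Nat.Prime.coprime_iff_not_dvd hp).2 fun h => absurd (Nat.le_of_dvd hk h) (by omega)))
  obtain ⟨a, b, hab⟩ := hc
  have : vl W (((a * k + b * p : ℤ)) : L) < 1 := by
    push_cast
    refine (vl W).map_add_lt ?_ ?_
    · rw [map_mul]; exact mul_lt_one_of_nonneg_of_lt_one_right (vl_int_le_one W a) zero_le hlt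
    · rw [map_mul]; exact mul_lt_one_of_nonneg_of_lt_one_right (vl_int_le_one W b) zero_le h
  rw [hab] at this
  simp at this

variable [IsGalois K L] {p : ℕ} (hp : p.Prime) (hL : Module.finrank K L = p) {σ : L ≃ₐ[K] L}
  (hσ : ∀ τ, τ ∈ Subgroup.zpowers σ) {W : Pl L}
include hp hL hσ

lemma norm_mem_U_of_ram (hinv : Inv σ W) (he : rI K W = p) {t : ℕ}
    (h : ∀ z, vl W (σ z - z) ≤ vl W z * exp (-(t : ℤ)))
    (hpt : vl W (p : L) ≤ exp (-((t * (p - 1) : ℕ) : ℤ))) {y : Lˣ} (hy : y ∈ U W (t + 1)) :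
    Nm K y ∈ U (dn K W) (t + 1) := by
  refine mem_U_of_sub (Nat.succ_ne_zero t) (vl_le_of_vl_dn_lt he ?_)
  set z : L := (y : L) - 1 with hz
  have hzle : vl W z ≤ exp (-((t + 1 : ℕ) : ℤ)) := hy.2
  have hN : algebraMap K L ((Nm K y : Kˣ) - 1 : K) = ∏ i : Fin p, (1 + (σ ^ (i : ℕ)) z) - 1 := by
    have e0 : ((Nm K y : Kˣ) : K) = Algebra.norm K (y : L) := rfl
    rw [map_sub, map_one, e0, norm_eq_prod_pow hσ, hL, Finset.prod_range]
    congr 1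
    refine Finset.prod_congr rfl fun i _ => ?_
    rw [hz, map_sub, map_one]; ring
  have hzi : ∀ i : ℕ, vl W ((σ ^ i) z) ≤ exp (-((t + 1 : ℕ) : ℤ)) := fun i => (hinv.pow i z).trans_le hzle
  rw [hN]
  rcases Nat.eq_zero_or_pos t with rfl | ht
  · have hu : ∀ i : Fin p, Units.map ((σ ^ (i : ℕ) : L ≃ₐ[K] L) : L →* L) y ∈ U W 1 := by
      intro i
      refine mem_U_of_sub one_ne_zero ?_
      have := hzi i
      rw [hz, map_sub, map_one] at this
      simpa using this
    have := ((U W 1).prod_mem (t := Finset.univ) fun i _ => hu i).2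
    simp only [Units.coe_prod] at this
    have e : ∀ i : Fin p, 1 + (σ ^ (i : ℕ)) z = (Units.map ((σ ^ (i : ℕ) : L ≃ₐ[K] L) : L →* L) y : L) := fun i => by
      rw [hz, map_sub, map_one]; simp
    simp only [e]
    simpa using this
  · have hp1 : 1 ≤ t * (p - 1) := Nat.mul_pos ht (by have := hp.two_le; omega)
    have hplt : vl W (p : L) < 1 := by
      rw [lt_one_iff_le_exp]
      refine hpt.trans ?_
      rw [exp_le_exp]; omega
    have hc1 : (exp (-((p * (t + 1) : ℕ) : ℤ)) : ℤᵐ⁰) ≤ 1 := exp_neg_le_one _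
    refine (exists_esymm_le (vl W) (fun i : Fin p => (σ ^ (i : ℕ)) z) (exp (-((p * (t + 1) : ℕ) : ℤ))) hc1
      (vl_natCast_eq_one hp hplt) ?_ ?_).trans ?_
    · intro k hk
      have e : ∑ i : Fin p, (σ ^ (i : ℕ)) z ^ k = algebraMap K L (Algebra.trace K L (z ^ k)) := by
        rw [trace_eq_sum_automorphisms]
        simp only [← map_pow]
        have ho : orderOf σ = p := by rw [orderOf_gen hσ, hL]
        have hcard : Fintype.card (L ≃ₐ[K] L) = p := by
          rw [← Nat.card_eq_fintype_card, IsGalois.card_aut_eq_finrank, hL]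
        refine Fintype.sum_bijective (fun i : Fin p => σ ^ (i : ℕ)) ?_ _ _ fun i => rfl
        rw [Fintype.bijective_iff_injective_and_card]
        refine ⟨fun i j hij => ?_, by simp [hcard]⟩
        have := pow_inj_mod.1 hij
        rw [ho, Nat.mod_eq_of_lt i.2, Nat.mod_eq_of_lt j.2] at this
        exact Fin.ext this
      have h1 : vl W (algebraMap K L (Algebra.trace K L (z ^ k))) ≤ exp (-((t * p + 1 : ℕ) : ℤ)) := by
        rw [← e]
        simp only [← map_pow]
        rw [← Finset.sum_range (fun i => (σ ^ i) (z ^ k))]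
        refine (vl_trace_le hp hinv h hpt _).trans ?_
        have hzk : vl W (z ^ k) ≤ exp (-((t + 1 : ℕ) : ℤ)) := by
          rw [map_pow]
          exact (pow_le_of_le_one zero_le (hzle.trans (exp_neg_le_one _)) hk.ne').trans hzle
        calc _ ≤ exp (-((t + 1 : ℕ) : ℤ)) * exp (-((t * (p - 1) : ℕ) : ℤ)) := by gcongr
          _ = _ := by
            rw [← exp_add]; congr 1
            obtain ⟨q, rfl⟩ : ∃ q, p = q + 1 := ⟨p - 1, by have := hp.two_le; omega⟩
            simp; ring
      rw [e, vl_algebraMap, he]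
      calc _ ≤ (exp (-((t + 1 : ℕ) : ℤ))) ^ p := by gcongr; exact vl_le_of_vl_dn_lt he h1
        _ = _ := by rw [← exp_nsmul]; congr 1
    · rw [map_prod]
      calc _ ≤ ∏ i : Fin p, (exp (-((t + 1 : ℕ) : ℤ)) : ℤᵐ⁰) := Finset.prod_le_prod' fun i _ => hzi _
        _ = _ := by rw [Finset.prod_const, ← exp_nsmul]; congr 1; simp; ring
    · rw [exp_le_exp]
      have := hp.two_le
      have : t * p + 1 ≤ p * (t + 1) := by nlinarith
      omega

/-- At a place which does not split, not everything is locally a norm. -/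
lemma exists_NN_ne_top {ζ : Kˣ} (hζ : IsPrimitiveRoot ζ p) {β : L} (hβ : β ≠ 0)
    (hσβ : σ β = algebraMap K L ζ * β) (hinv : Inv σ W) :
    ∃ N₀, ∀ N ≥ N₀, NN L (dn K W) N ≠ ⊤ := by
  suffices ∃ N₀, NN L (dn K W) N₀ ≠ ⊤ by
    obtain ⟨N₀, h⟩ := this
    exact ⟨N₀, fun N hN h' => h (top_le_iff.1 (h'.symm.trans_le (NN_anti _ hN)))⟩
  have hef := hinv.ef hσ
  rw [hL] at hef
  have hvn := fun x => vl_norm hσ hinv x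
  rw [hL] at hvn
  rcases (Nat.dvd_prime hp).1 (Dvd.intro _ hef) with he | he
  · refine ⟨0, fun htop => ?_⟩
    obtain ⟨π, hπ⟩ := exists_unif (dn K W)
    have : π ∈ NN L (dn K W) 0 := htop ▸ Subgroup.mem_top π
    obtain ⟨_, ⟨y, rfl⟩, u, hu, hyu⟩ := Subgroup.mem_sup.1 this
    have h1 : vl (dn K W) (π : K) = vl W (y : L) ^ p := by
      rw [← hvn, he, pow_one, ← hyu, Units.val_mul, map_mul, mem_U_zero.1 hu, mul_one]; rfl
    obtain ⟨n, hn⟩ := exists_ord W (y : L) y.ne_zero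
    rw [hπ, hn, ← exp_nsmul, exp_inj] at h1
    have h2 : (p : ℤ) ∣ 1 := ⟨-n, by simp only [nsmul_eq_mul] at h1; linarith⟩
    have := Int.eq_one_of_dvd_one (by positivity) h2
    exact hp.one_lt.ne' (by exact_mod_cast this)
  · have hf : rD K W = 1 := by
      rw [he] at hef
      exact Nat.eq_of_mul_eq_mul_left hp.pos (by rw [hef, mul_one])
    have hne : ∃ x, σ x ≠ x := by
      by_contra! hall
      have : σ = 1 := AlgEquiv.ext hall
      have h1 := orderOf_gen hσ
      rw [this, orderOf_one, hL] at h1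
      exact hp.one_lt.ne h1
    obtain ⟨t, ht1, ht2⟩ := exists_ram_break hinv hf hne
    have hsub := vl_sub_le hinv ht1
    have hζ1 : vl W (algebraMap K L ζ - 1) ≤ exp (-(t : ℤ)) := by
      have := hsub β
      rw [hσβ, ← sub_one_mul, map_mul, mul_comm] at this
      exact le_of_mul_le_mul_left this (zero_lt_iff.2 ((vl W).ne_zero_iff.2 hβ))
    have hζ' : IsPrimitiveRoot (algebraMap K L ζ) p :=
      (IsPrimitiveRoot.coe_units_iff.2 hζ).map_of_injective (algebraMap K L).injective
    have hpt : vl W (p : L) ≤ exp (-((t * (p - 1) : ℕ) : ℤ)) := by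
      obtain ⟨q, hq⟩ : ∃ q, p = q + 1 := ⟨p - 1, by have := hp.two_le; omega⟩
      have hprod : (p : L) = ∏ k ∈ Finset.range q, (1 - algebraMap K L ζ ^ (k + 1)) := by
        have := (hq ▸ hζ' : IsPrimitiveRoot (algebraMap K L ζ) (q + 1)).prod_one_sub_pow_eq_order
        rw [this, hq]; push_cast; ring
      rw [hprod, map_prod]
      have hζu : vl W (algebraMap K L ζ) = 1 := vl_root hp.ne_zero hζ'.pow_eq_one W
      calc _ ≤ ∏ k ∈ Finset.range q, (exp (-(t : ℤ)) : ℤᵐ⁰) := by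
            refine Finset.prod_le_prod' fun k _ => ?_
            rw [← neg_sub, Valuation.map_neg, ← geom_sum_mul, map_mul]
            calc _ ≤ 1 * exp (-(t : ℤ)) := by
                  refine mul_le_mul' ((vl W).map_sum_le fun i _ => ?_) hζ1
                  rw [map_pow, hζu, one_pow]
              _ = _ := one_mul _
        _ = _ := by rw [Finset.prod_const, ← exp_nsmul]; congr 1; simp [hq]; ring
    refine ⟨t + 1, fun htop => ?_⟩
    have hNU : U W (t + 1) ≤ (U (dn K W) (t + 1)).comap (Nm K) := fun y hy =>
      norm_mem_U_of_ram hp hL hσ hinv he hsub hpt hy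
    have hle : U (dn K W) 0 ≤ (U W 0).map (Nm K) ⊔ U (dn K W) (t + 1) := by
      intro b hb
      have : b ∈ NN L (dn K W) (t + 1) := htop ▸ Subgroup.mem_top b
      obtain ⟨_, ⟨y, rfl⟩, u, hu, hyu⟩ := Subgroup.mem_sup.1 this
      refine Subgroup.mem_sup.2 ⟨_, ⟨y, ?_, rfl⟩, u, hu, hyu⟩
      have h1 : vl (dn K W) (Algebra.norm K (y : L)) = 1 := by
        rw [mem_U_zero, ← hyu, Units.val_mul, map_mul, hu.1, mul_one] at hb; exact hb
      have h2 := hvn y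
      rw [h1, one_pow] at h2
      exact mem_U_zero.2 ((pow_eq_one_iff_of_nonneg zero_le hp.ne_zero).1 h2.symm)
    set J := (U (dn K W) (t + 1)).comap (Nm K (L := L)) with hJ
    have h1 : (U (dn K W) (t + 1)).relIndex (U (dn K W) 0) ∣ J.relIndex (U W 0) := by
      rw [hJ, Subgroup.relIndex_comap, ← Subgroup.relIndex_sup_right ((U W 0).map (Nm K (L := L)))]
      exact ⟨_, (Subgroup.relIndex_mul_relIndex _ _ _ (U_anti (Nat.zero_le _)) hle).symm⟩
    have h2 : (U (dn K W) (t + 1)).relIndex (U (dn K W) 0) = (U W (t + 1)).relIndex (U W 0) := by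
      rw [relIndex_U_zero, relIndex_U_zero, resCard_eq (K := K) W, hf, pow_one]
    have h3 := Subgroup.relIndex_inf_mul_relIndex (U W (t + 1)) J (U W 0)
    rw [inf_eq_left.2 hNU] at h3
    have h0 := relIndex_U_ne_zero W (t + 1)
    have hJ0 : J.relIndex (U W 0) ≠ 0 := right_ne_zero_of_mul (h3.trans_ne h0)
    rw [h2, ← h3] at h1
    have h4 : (U W (t + 1)).relIndex (J ⊓ U W 0) = 1 := by
      have := Nat.le_of_dvd (Nat.pos_of_ne_zero hJ0) h1
      refine le_antisymm ?_ (Nat.one_le_iff_ne_zero.2 (left_ne_zero_of_mul (h3.trans_ne h0)))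
      exact Nat.le_of_mul_le_mul_right (by rwa [one_mul]) (Nat.pos_of_ne_zero hJ0)
    obtain ⟨π, hπ⟩ := exists_unif W
    have hmem : sg σ π / π ∈ J ⊓ U W 0 := by
      refine ⟨?_, ?_⟩
      · have : Nm K (sg σ π / π) = 1 := by
          rw [map_div, div_eq_one]
          exact Units.ext (Algebra.norm_eq_of_algEquiv σ (π : L))
        exact (this ▸ (U (dn K W) (t + 1)).one_mem : Nm K (sg σ π / π) ∈ _)
      · refine mem_U_zero.2 ?_
        have : ((sg σ π / π : Lˣ) : L) = σ π / π := by push_cast; rfl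
        rw [this, map_div₀, hinv, div_self ((vl W).ne_zero_iff.2 π.ne_zero)]
    have h5 := (Subgroup.relIndex_eq_one.1 h4 hmem).2
    apply ht2 π hπ
    have e : σ π - π = (((sg σ π / π : Lˣ) : L) - 1) * π := by
      push_cast
      rw [sub_mul, div_mul_cancel₀ _ π.ne_zero, one_mul]; rfl
    rw [e, map_mul, hπ]
    calc _ ≤ exp (-((t + 1 : ℕ) : ℤ)) * exp (-1) := by gcongr
      _ = _ := by rw [← exp_add]; congr 1

end

end CyclicSchur

namespace CyclicSchur
open NumberField IsDedekindDomain WithZero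
open scoped WithZero

section
variable {K : Type*} [Field K] [NumberField K]

/-- The group of `S`-units. -/
def SU (S : Set (Pl K)) : Subgroup Kˣ where
  carrier := {x | ∀ v ∉ S, vl v (x : K) = 1}
  one_mem' := fun v _ => by simp
  mul_mem' := fun hx hy v hv => by rw [Units.val_mul, map_mul, hx v hv, hy v hv, one_mul]
  inv_mem' := fun hx v hv => by rw [Units.val_inv_eq_inv_val, map_inv₀, hx v hv, inv_one]

lemma mem_SU {S : Set (Pl K)} {x : Kˣ} : x ∈ SU S ↔ ∀ v ∉ S, vl v (x : K) = 1 := Iff.rfl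

lemma SU_mono {S T : Set (Pl K)} (h : S ⊆ T) : SU S ≤ SU T := fun _ hx v hv => hx v fun h' => hv (h h')

lemma vl_ne_zero (v : Pl K) (x : Kˣ) : vl v (x : K) ≠ 0 := (vl v).ne_zero_iff.2 x.ne_zero

/-- The additive valuation (with the sign of the multiplicative one). -/
noncomputable def lg (v : Pl K) : Additive Kˣ →+ ℤ where
  toFun x := log (vl v (x.toMul : K))
  map_zero' := by simp
  map_add' x y := by rw [toMul_add, Units.val_mul, map_mul, log_mul (vl_ne_zero v _) (vl_ne_zero v _)]

lemma lg_apply (v : Pl K) (x : Kˣ) : lg v (Additive.ofMul x) = log (vl v (x : K)) := rfl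

lemma vl_eq_exp_lg (v : Pl K) (x : Kˣ) : vl v (x : K) = exp (lg v (Additive.ofMul x)) := by
  rw [lg_apply, exp_log (vl_ne_zero v x)]

lemma finite_support (x : Kˣ) : {v : Pl K | vl v (x : K) ≠ 1}.Finite := by
  have := IsDedekindDomain.HeightOneSpectrum.Support.finite (𝓞 K) (x : K)
  have h2 := IsDedekindDomain.HeightOneSpectrum.Support.finite (𝓞 K) ((x⁻¹ : Kˣ) : K)
  refine (this.union h2).subset fun v hv => ?_
  rcases lt_or_gt_of_ne hv with h | h
  · right
    change 1 < vl v ((x⁻¹ : Kˣ) : K)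
    rw [Units.val_inv_eq_inv_val, map_inv₀]
    exact (one_lt_inv₀ (zero_lt_iff.2 (vl_ne_zero v x))).2 h
  · left; exact h

lemma exists_prime_pow (v : Pl K) : ∃ h : ℕ, 0 < h ∧ ∃ x : Kˣ, vl v (x : K) = exp (-(h : ℤ)) ∧
    ∀ w ≠ v, vl w (x : K) = 1 := by
  classical
  let h := Fintype.card (ClassGroup (𝓞 K))
  have hv : v.asIdeal ∈ nonZeroDivisors (Ideal (𝓞 K)) := mem_nonZeroDivisors_of_ne_zero v.ne_bot
  have h1 : ClassGroup.mk0 ((⟨v.asIdeal, hv⟩ : nonZeroDivisors (Ideal (𝓞 K))) ^ h) = 1 := by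
    rw [map_pow]; exact pow_card_eq_one
  rw [ClassGroup.mk0_eq_one_iff] at h1
  obtain ⟨x, hx⟩ := h1.principal
  have hx' : v.asIdeal ^ h = Ideal.span {x} := hx
  have hx0 : x ≠ 0 := by
    rintro rfl
    rw [Ideal.span_singleton_zero] at hx'
    exact v.ne_bot (eq_zero_of_pow_eq_zero hx')
  have hxv : ∀ n, x ∈ v.asIdeal ^ n ↔ n ≤ h := by
    intro n
    rw [← Ideal.span_singleton_le_iff_mem, ← hx']
    refine ⟨fun hle => ?_, fun hle => Ideal.pow_le_pow_right hle⟩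
    by_contra! hlt
    have := Ideal.pow_right_strictAnti v.asIdeal v.ne_bot v.isPrime.ne_top hlt
    exact absurd hle this.not_ge
  refine ⟨h, Fintype.card_pos, Units.mk0 (x : K) (by simpa using hx0), ?_, fun w hw => ?_⟩
  · refine eq_of_le_iff (exists_ord_int v x hx0) ⟨h, rfl⟩ fun n => ?_
    rw [Units.val_mk0, vl_le_iff_of_int, hxv, exp_le_exp]; omega
  · refine le_antisymm (w.valuation_le_one x) ?_
    by_contra! hlt
    have h2 : x ∈ w.asIdeal := by
      have := (vl_le_iff_of_int w x 1).1 ((lt_one_iff_le_exp _).1 hlt)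
      rwa [pow_one] at this
    rw [← Ideal.span_singleton_le_iff_mem, ← hx'] at h2
    have h3 := w.isPrime.le_of_pow_le h2
    exact hw (HeightOneSpectrum.ext (v.isMaximal.eq_of_le w.isPrime.ne_top h3).symm)

/-- Every divisor supported outside of `S` is principal up to `S`. -/
def ClTriv (S : Set (Pl K)) : Prop :=
  ∀ v ∉ S, ∃ c : Kˣ, vl v (c : K) = exp (-1) ∧ ∀ w ∉ S, w ≠ v → vl w (c : K) = 1

lemma ClTriv.mono {S T : Set (Pl K)} (h : ClTriv S) (hST : S ⊆ T) : ClTriv T := fun v hv => by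
  obtain ⟨c, hc, hc'⟩ := h v fun h' => hv (hST h')
  exact ⟨c, hc, fun w hw => hc' w fun h' => hw (hST h')⟩

lemma vl_le_of_span_mul {x y : 𝓞 K} {v v' w : Pl K}
    (h : Ideal.span {x} * v.asIdeal = Ideal.span {y} * v'.asIdeal) (hw : w ≠ v) :
    vl w (x : K) ≤ vl w (y : K) := by
  obtain ⟨t, ht, htw⟩ : ∃ t ∈ v.asIdeal, t ∉ w.asIdeal := by
    by_contra! hle
    exact hw (HeightOneSpectrum.ext (v.isMaximal.eq_of_le w.isPrime.ne_top hle).symm)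
  have : x * t ∈ Ideal.span {y} * v'.asIdeal := h ▸ Ideal.mul_mem_mul (Ideal.mem_span_singleton_self x) ht
  obtain ⟨s, hs, hst⟩ := Ideal.mem_span_singleton_mul.1 this
  have h1 : vl w (t : K) = 1 := by
    refine le_antisymm (w.valuation_le_one t) ?_
    by_contra! hlt
    exact htw (by simpa using (vl_le_iff_of_int w t 1).1 ((lt_one_iff_le_exp _).1 hlt))
  have h2 : (y : K) * s = x * t := by exact_mod_cast congrArg (algebraMap (𝓞 K) K) hst
  have h3 := congrArg (vl w) h2
  rw [map_mul, map_mul, h1, mul_one] at h3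
  rw [← h3]
  exact mul_le_of_le_one_right' (w.valuation_le_one s)

lemma vl_eq_of_span_mul {x y : 𝓞 K} {v v' : Pl K}
    (h : Ideal.span {x} * v.asIdeal = Ideal.span {y} * v'.asIdeal) (hw : v ≠ v') :
    vl v (x : K) * exp (-1) = vl v (y : K) := by
  refine le_antisymm ?_ ?_
  · obtain ⟨t, ht, ht2⟩ : ∃ t ∈ v.asIdeal, t ∉ v.asIdeal ^ 2 := by
      have := Ideal.pow_right_strictAnti v.asIdeal v.ne_bot v.isPrime.ne_top (show 1 < 2 by norm_num)
      obtain ⟨t, h1, h2⟩ := SetLike.exists_of_lt this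
      exact ⟨t, by simpa using h1, h2⟩
    have ht1 : vl v (t : K) = exp (-1) := by
      refine le_antisymm (by simpa using (vl_le_iff_of_int v t 1).2 (by simpa using ht)) ?_
      by_contra! hlt
      exact ht2 ((vl_le_iff_of_int v t 2).1 ((lt_exp_neg_iff _ 1).1 hlt))
    have : x * t ∈ Ideal.span {y} * v'.asIdeal := h ▸ Ideal.mul_mem_mul (Ideal.mem_span_singleton_self x) ht
    obtain ⟨s, hs, hst⟩ := Ideal.mem_span_singleton_mul.1 this
    have h2 : (y : K) * s = x * t := by exact_mod_cast congrArg (algebraMap (𝓞 K) K) hst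
    rw [← ht1, ← map_mul, ← h2, map_mul]
    exact mul_le_of_le_one_right' (v.valuation_le_one s)
  · obtain ⟨s, hs, hsv⟩ : ∃ s ∈ v'.asIdeal, s ∉ v.asIdeal := by
      by_contra! hle
      exact hw (HeightOneSpectrum.ext (v'.isMaximal.eq_of_le v.isPrime.ne_top hle).symm)
    have : y * s ∈ Ideal.span {x} * v.asIdeal := h ▸ Ideal.mul_mem_mul (Ideal.mem_span_singleton_self y) hs
    obtain ⟨t, ht, hst⟩ := Ideal.mem_span_singleton_mul.1 this
    have h1 : vl v (s : K) = 1 := by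
      refine le_antisymm (v.valuation_le_one s) ?_
      by_contra! hlt
      exact hsv (by simpa using (vl_le_iff_of_int v s 1).1 ((lt_one_iff_le_exp _).1 hlt))
    have h2 : (x : K) * t = y * s := by exact_mod_cast congrArg (algebraMap (𝓞 K) K) hst
    have h3 := congrArg (vl v) h2
    rw [map_mul, map_mul, h1, mul_one] at h3
    rw [← h3]
    gcongr
    simpa using (vl_le_iff_of_int v t 1).2 (by simpa using ht)

variable (K) in
lemma exists_ClTriv : ∃ S : Finset (Pl K), ClTriv (S : Set (Pl K)) := by
  classical
  have hv : ∀ v : Pl K, v.asIdeal ∈ nonZeroDivisors (Ideal (𝓞 K)) := fun v => mem_nonZeroDivisors_of_ne_zero v.ne_bot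
  let cl : Pl K → ClassGroup (𝓞 K) := fun v => ClassGroup.mk0 ⟨v.asIdeal, hv v⟩
  choose r hr using fun c : Set.range cl => c.2
  refine ⟨Finset.univ.image r, fun v hvS => ?_⟩
  set v' := r ⟨cl v, v, rfl⟩
  have hv' : v' ∈ (Finset.univ.image r : Finset (Pl K)) := Finset.mem_image_of_mem _ (Finset.mem_univ _)
  have hne : v ≠ v' := fun h => hvS (h ▸ hv')
  have h1 : cl v = cl v' := (hr ⟨cl v, v, rfl⟩).symm
  obtain ⟨x, y, hx, hy, hxy⟩ := (ClassGroup.mk0_eq_mk0_iff).1 h1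
  have hx0 : (x : K) ≠ 0 := by simpa using hx
  have hy0 : (y : K) ≠ 0 := by simpa using hy
  refine ⟨Units.mk0 _ hy0 / Units.mk0 _ hx0, ?_, fun w hw hwv => ?_⟩
  · have := vl_eq_of_span_mul hxy hne
    rw [Units.val_div_eq_div_val, Units.val_mk0, Units.val_mk0, map_div₀, ← this,
      mul_div_cancel_left₀ _ ((vl v).ne_zero_iff.2 hx0)]
  · have hwv' : w ≠ v' := fun h => hw (h ▸ hv')
    have := le_antisymm (vl_le_of_span_mul hxy hwv) (vl_le_of_span_mul hxy.symm hwv')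
    rw [Units.val_div_eq_div_val, Units.val_mk0, Units.val_mk0, map_div₀, this,
      div_self ((vl w).ne_zero_iff.2 hy0)]

lemma ClTriv.exists_of_finite {S : Set (Pl K)} (h : ClTriv S) (T : Finset (Pl K)) (hT : ∀ v ∈ T, v ∉ S) (n : Pl K → ℤ) :
    ∃ c : Kˣ, (∀ v ∈ T, vl v (c : K) = exp (n v)) ∧ ∀ v ∉ S, v ∉ T → vl v (c : K) = 1 := by
  classical
  induction T using Finset.induction_on with
  | empty => exact ⟨1, by simp, by simp⟩
  | insert v T hv ih =>
    obtain ⟨c, hc, hc'⟩ := ih fun w hw => hT w (Finset.mem_insert_of_mem hw)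
    have hvS := hT v (Finset.mem_insert_self _ _)
    obtain ⟨d, hd, hd'⟩ := h v hvS
    refine ⟨c * d ^ (-(n v)), fun w hw => ?_, fun w hwS hw => ?_⟩
    · rw [Units.val_mul, map_mul, Units.val_zpow_eq_zpow_val, map_zpow₀]
      rcases Finset.mem_insert.1 hw with rfl | hwT
      · rw [hc' w hvS hv, hd, one_mul, ← exp_zsmul]; simp
      · have hne : w ≠ v := fun h => hv (h ▸ hwT)
        rw [hc w hwT, hd' w (hT w hw) hne, one_zpow, mul_one]
    · rw [Finset.mem_insert, not_or] at hw
      rw [Units.val_mul, map_mul, Units.val_zpow_eq_zpow_val, map_zpow₀, hc' w hwS hw.2, hd' w hwS hw.1,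
        one_zpow, one_mul]

/-- The valuations at the places of `S` of an `S`-unit. -/
noncomputable def ordS (S : Finset (Pl K)) : Additive (SU (S : Set (Pl K))) →ₗ[ℤ] (S → ℤ) :=
  (AddMonoidHom.mk' (fun x v => lg v.1 (Additive.ofMul (x.toMul : Kˣ))) fun x y => by
    funext v; exact map_add (lg v.1) _ _).toIntLinearMap

lemma exists_unit_of_vl {x : Kˣ} (h : ∀ v, vl v (x : K) = 1) : ∃ u : (𝓞 K)ˣ, ((u : 𝓞 K) : K) = x := by
  have h1 : ∀ x : Kˣ, (∀ v, vl v (x : K) = 1) → ∃ r : 𝓞 K, (r : K) = x := fun x h =>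
    (HeightOneSpectrum.mem_integers_of_valuation_le_one K (x : K) fun v => (h v).le)
  obtain ⟨r, hr⟩ := h1 x h
  obtain ⟨s, hs⟩ := h1 x⁻¹ fun v => by rw [Units.val_inv_eq_inv_val, map_inv₀, h, inv_one]
  have hrs : r * s = 1 := by
    apply RingOfIntegers.coe_injective
    refine (map_mul (algebraMap (𝓞 K) K) r s).trans ?_
    change (r : K) * (s : K) = _
    rw [hr, hs]; simp
  exact ⟨⟨r, s, hrs, by rw [mul_comm, hrs]⟩, hr⟩

lemma vl_unit (u : (𝓞 K)ˣ) (v : Pl K) : vl v ((u : 𝓞 K) : K) = 1 := by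
  refine le_antisymm (v.valuation_le_one _) ?_
  have h := v.valuation_le_one (K := K) ((u⁻¹ : (𝓞 K)ˣ) : 𝓞 K)
  have h2 : vl v ((u : 𝓞 K) : K) * vl v (((u⁻¹ : (𝓞 K)ˣ) : 𝓞 K) : K) = 1 := by
    rw [← map_mul, ← map_mul]; simp
  rw [← h2]
  exact mul_le_of_le_one_right' h

noncomputable def unitsEquivKer (S : Finset (Pl K)) : Additive (𝓞 K)ˣ ≃ₗ[ℤ] LinearMap.ker (ordS S) := by
  let f : Additive (𝓞 K)ˣ →+ Additive (SU (S : Set (Pl K))) := MonoidHom.toAdditive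
    (MonoidHom.codRestrict (Units.map (algebraMap (𝓞 K) K : 𝓞 K →* K)) _ fun u v _ => vl_unit u v)
  have hf : Function.Injective f := by
    intro x y h
    have h1 := congrArg (fun z : Additive (SU (S : Set (Pl K))) => ((z.toMul : Kˣ) : K)) h
    apply Additive.toMul.injective
    exact Units.ext (RingOfIntegers.coe_injective h1)
  refine LinearEquiv.ofBijective (LinearMap.codRestrict (LinearMap.ker (ordS S)) f.toIntLinearMap ?_) ⟨?_, ?_⟩
  · intro u
    rw [LinearMap.mem_ker]
    funext v
    change log (vl v.1 _) = 0
    exact (congrArg log (vl_unit u.toMul v.1)).trans log_one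
  · intro x y h
    exact hf (congrArg Subtype.val h)
  · rintro ⟨x, hx⟩
    obtain ⟨u, hu⟩ := exists_unit_of_vl (x := (x.toMul : Kˣ)) fun v => by
      by_cases hv : v ∈ S
      · have := congrFun (LinearMap.mem_ker.1 hx) ⟨v, hv⟩
        rw [vl_eq_exp_lg]
        exact (congrArg exp this).trans exp_zero
      · exact x.toMul.2 v hv
    refine ⟨Additive.ofMul u, Subtype.ext ?_⟩
    apply Additive.toMul.injective
    exact Subtype.ext (Units.ext hu)

instance (S : Finset (Pl K)) : Module.Finite ℤ (LinearMap.ker (ordS S)) := Module.Finite.equiv (unitsEquivKer S)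

instance (S : Finset (Pl K)) : Module.Finite ℤ (Additive (SU (S : Set (Pl K)))) :=
  have := Module.Finite.equiv (ordS S).quotKerEquivRange.symm
  Module.Finite.of_submodule_quotient (LinearMap.ker (ordS S))

lemma finrank_range_ordS (S : Finset (Pl K)) : Module.finrank ℤ (LinearMap.range (ordS S)) = S.card := by
  classical
  refine le_antisymm ?_ ?_
  · exact (LinearMap.range (ordS S)).finrank_le.trans_eq (by simp)
  · choose h hh x hx hx' using exists_prime_pow (K := K)
    have hmem : ∀ v : S, x v ∈ SU (S : Set (Pl K)) := fun v w hw => hx' _ _ fun e => hw (e ▸ v.2)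
    let f : S → LinearMap.range (ordS S) := fun v => ⟨ordS S (Additive.ofMul ⟨x v, hmem v⟩), LinearMap.mem_range_self _ _⟩
    have hf : ∀ v w : S, (f v : S → ℤ) w = if w = v then -(h v : ℤ) else 0 := by
      intro v w
      change log (vl w.1 (x v : K)) = _
      split_ifs with e
      · subst e; rw [hx, log_exp]
      · rw [hx' _ _ fun e' => e (Subtype.ext e'), log_one]
    have hli : LinearIndependent ℤ f := by
      rw [Fintype.linearIndependent_iff]
      intro g hg v
      have h1 := congrFun (congrArg Subtype.val hg) v
      simp only [Submodule.coe_sum, Submodule.coe_smul, Finset.sum_apply, Pi.smul_apply, hf, smul_eq_mul,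
        mul_ite, mul_zero, Finset.sum_ite_eq, Finset.mem_univ, if_true] at h1
      have h2 : -(h v : ℤ) ≠ 0 := by have := hh v; omega
      exact (mul_eq_zero.1 h1).resolve_right h2
    simpa using hli.fintype_card_le_finrank

lemma finrank_SU (S : Finset (Pl K)) :
    Module.finrank ℤ (Additive (SU (S : Set (Pl K)))) + 1 = S.card + Fintype.card (InfinitePlace K) := by
  rw [← Submodule.finrank_quotient_add_finrank (LinearMap.ker (ordS S)),
    (ordS S).quotKerEquivRange.finrank_eq, finrank_range_ordS, ← (unitsEquivKer S).finrank_eq,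
    Units.finrank_eq, Units.rank]
  have := Fintype.card_pos (α := InfinitePlace K)
  omega

end

end CyclicSchur

namespace CyclicSchur
open NumberField IsDedekindDomain WithZero
open scoped WithZero

section
variable {K L : Type} [Field K] [NumberField K] [Field L] [NumberField L] [Algebra K L]

/-- The place `v` does not split: there is an invariant place above it. -/
def NS (σ : L ≃ₐ[K] L) (v : Pl K) : Prop := ∃ W : Pl L, dn K W = v ∧ Inv σ W

variable (L) in
/-- The places above `S`. -/
noncomputable def up (S : Finset (Pl K)) : Finset (Pl L) :=
  (Set.Finite.biUnion S.finite_toSet fun v _ => finite_up (L := L) v).toFinset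

lemma mem_up {S : Finset (Pl K)} {W : Pl L} : W ∈ up L S ↔ dn K W ∈ S := by
  simp [up]

lemma sg_apply (σ : L ≃ₐ[K] L) (x : Lˣ) : ((sg σ x : Lˣ) : L) = σ x := rfl

lemma vl_sg (σ : L ≃ₐ[K] L) (W : Pl L) (x : L) : vl (tr (σ : L ≃+* L) W) (σ x) = vl W x :=
  vl_tr (σ : L ≃+* L) W x

lemma tr_pow_zero (σ : L ≃ₐ[K] L) (W : Pl L) : tr ((σ ^ 0 : L ≃ₐ[K] L) : L ≃+* L) W = W :=
  Pl_ext fun x => vl_sg (1 : L ≃ₐ[K] L) W x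

lemma exists_tr_inv (σ : L ≃ₐ[K] L) (W : Pl L) : ∃ W', tr (σ : L ≃+* L) W' = W ∧ dn K W' = dn K W := by
  refine ⟨tr ((σ⁻¹ : L ≃ₐ[K] L) : L ≃+* L) W, ?_, dn_tr σ⁻¹ W⟩
  refine Pl_ext fun x => ?_
  obtain ⟨x, rfl⟩ := σ.surjective x
  rw [vl_sg]
  have := vl_sg σ⁻¹ W (σ x)
  rwa [AlgEquiv.aut_inv, AlgEquiv.symm_apply_apply] at this

/-- An automorphism acting on the units above `S`. -/
noncomputable def phi (σ : L ≃ₐ[K] L) (S : Finset (Pl K)) :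
    SU (up L S : Set (Pl L)) →* SU (up L S : Set (Pl L)) :=
  MonoidHom.codRestrict ((sg σ).comp (Subgroup.subtype _)) _ fun x W hW => by
    obtain ⟨W', rfl, hd⟩ := exists_tr_inv σ W
    change vl _ (σ (x : Lˣ)) = 1
    rw [vl_sg]
    refine x.2 _ fun h => hW ?_
    rw [SetLike.mem_coe, mem_up] at h ⊢
    rwa [← hd]

/-- The endomorphism of `S`-units induced by an automorphism, written additively. -/
noncomputable def phiE (σ : L ≃ₐ[K] L) (S : Finset (Pl K)) : Module.End ℤ (Additive (SU (up L S : Set (Pl L)))) :=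
  (MonoidHom.toAdditive (phi σ S)).toIntLinearMap

/-- Underlying field element of an additive `S`-unit. -/
def cf {S : Set (Pl L)} (x : Additive (SU S)) : Lˣ := (x.toMul : Lˣ)

lemma cf_inj {S : Set (Pl L)} {x y : Additive (SU S)} (h : cf x = cf y) : x = y :=
  Additive.toMul.injective (Subtype.ext h)

lemma cf_add {S : Set (Pl L)} (x y : Additive (SU S)) : cf (x + y) = cf x * cf y := rfl
lemma cf_zero {S : Set (Pl L)} : cf (0 : Additive (SU S)) = 1 := rfl

lemma cf_sum {S : Set (Pl L)} {ι : Type*} (s : Finset ι) (f : ι → Additive (SU S)) :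
    cf (∑ i ∈ s, f i) = ∏ i ∈ s, cf (f i) := by
  classical
  induction s using Finset.induction_on with
  | empty => simp [cf_zero]
  | insert a s ha ih => rw [Finset.sum_insert ha, Finset.prod_insert ha, cf_add, ih]

lemma cf_phiE (σ : L ≃ₐ[K] L) (S : Finset (Pl K)) (x) : cf (phiE σ S x) = sg σ (cf x) := rfl

lemma cf_phiE_pow (σ : L ≃ₐ[K] L) (S : Finset (Pl K)) (i : ℕ) (x) :
    (cf ((phiE σ S ^ i) x) : L) = (σ ^ i) (cf x : L) := by
  induction i with
  | zero => rfl
  | succ i ih => rw [pow_succ', pow_succ', Module.End.mul_apply, cf_phiE, sg_apply, ih]; rfl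

variable [IsGalois K L] {p : ℕ} (hp : p.Prime) (hL : Module.finrank K L = p) {σ : L ≃ₐ[K] L}
  (hσ : ∀ τ, τ ∈ Subgroup.zpowers σ) 

include hσ in
lemma exists_div_of_norm_eq_one_SU {S : Finset (Pl K)} (hcl : ClTriv (S : Set (Pl K)))
    (hur : ∀ W : Pl L, dn K W ∉ S → rI K W = 1) {x : Lˣ} (hx : x ∈ SU (up L S : Set (Pl L)))
    (hN : Algebra.norm K (x : L) = 1) : ∃ y ∈ SU (up L S : Set (Pl L)), sg σ y / y = x := by
  classical
  have : IsCyclic (L ≃ₐ[K] L) := ⟨σ, hσ⟩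
  obtain ⟨y, hy⟩ := groupCohomology.exists_div_of_norm_eq_one hσ hN
  set z := y⁻¹ with hz
  have hzx : sg σ z / z = x := by
    rw [← Units.val_inj, ← hy, hz]
    simp [div_eq_mul_inv, mul_comm]
  have h1 : ∀ W : Pl L, dn K W ∉ S → vl (tr (σ : L ≃+* L) W) (z : L) = vl W (z : L) := by
    intro W hW
    have h2 : vl (tr (σ : L ≃+* L) W) (x : L) = 1 := hx _ (by
      rw [SetLike.mem_coe, mem_up, dn_tr]; exact hW)
    rw [← hzx, Units.val_div_eq_div_val, map_div₀, sg_apply, vl_sg] at h2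
    exact ((div_eq_one_iff_eq (vl_ne_zero _ z)).1 h2).symm
  have h2 : ∀ (i : ℕ) (W : Pl L), dn K W ∉ S → vl (tr ((σ ^ i : L ≃ₐ[K] L) : L ≃+* L) W) (z : L) = vl W (z : L) := by
    intro i W hW
    induction i with
    | zero => exact congrArg (fun V => vl V (z : L)) (tr_pow_zero σ W)
    | succ i ih => rw [tr_pow_succ, h1 _ (by rwa [dn_tr]), ih]
  have h3 : ∀ W W' : Pl L, dn K W = dn K W' → dn K W ∉ S → vl W' (z : L) = vl W (z : L) := by
    intro W W' hWW hW
    obtain ⟨τ, rfl⟩ := exists_tr_eq hWW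
    obtain ⟨i, rfl⟩ := mem_powers_iff_mem_zpowers.2 (hσ τ)
    exact h2 i W hW
  choose w hw using exists_up (K := K) L
  let T : Finset (Pl K) := ((finite_support z).toFinset.image (dn K)) \ S
  obtain ⟨c, hc, hc'⟩ := hcl.exists_of_finite T (fun v hv => by simpa using (Finset.mem_sdiff.1 hv).2)
    fun v => lg (w v) (Additive.ofMul z)
  have hcz : ∀ W : Pl L, dn K W ∉ S → vl W (algebraMap K L c) = vl W (z : L) := by
    intro W hW
    rw [vl_algebraMap, hur W hW, pow_one]
    have h4 := h3 W (w (dn K W)) (hw _).symm hW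
    by_cases hT : dn K W ∈ T
    · rw [hc _ hT, ← vl_eq_exp_lg, h4]
    · rw [hc' _ (by simpa using hW) hT]
      by_contra hne
      exact hT (Finset.mem_sdiff.2 ⟨Finset.mem_image_of_mem _ (by simpa using fun h => hne h.symm), hW⟩)
  refine ⟨z / Units.map (algebraMap K L : K →* L) c, fun W hW => ?_, ?_⟩
  · rw [SetLike.mem_coe, mem_up] at hW
    rw [Units.val_div_eq_div_val, map_div₀]
    change _ / vl W (algebraMap K L c) = 1
    rw [hcz W hW, div_self (vl_ne_zero W z)]
  · have : sg σ (Units.map (algebraMap K L : K →* L) c) = Units.map (algebraMap K L : K →* L) c :=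
      Units.ext (σ.commutes _)
    rw [map_div, this, div_div_div_cancel_right, hzx]

open Classical in
include hp hL hσ in
lemma card_up (S : Finset (Pl K)) : (up L S).card + (p - 1) * (S.filter (NS σ)).card = p * S.card := by
  have h1 : (up L S).card = ∑ v ∈ S, if NS σ v then 1 else p := by
    rw [Finset.card_eq_sum_card_fiberwise (f := dn K) (t := S) fun W hW => mem_up.1 hW]
    refine Finset.sum_congr rfl fun v hv => ?_
    have h2 : ((up L S).filter fun W => dn K W = v).card = {W : Pl L | dn K W = v}.ncard := by
      rw [← Set.ncard_coe_finset]
      congr 1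
      ext W
      simp only [Finset.coe_filter, mem_up, Set.mem_ofPred_eq]
      exact ⟨fun h => h.2, fun h => ⟨h ▸ hv, h⟩⟩
    rw [h2]
    split_ifs with h
    · obtain ⟨W, rfl, hW⟩ := h
      rw [Set.ncard_eq_one]
      exact ⟨W, Set.eq_singleton_iff_unique_mem.2 ⟨rfl, fun W' h' => hW.unique hσ h'.symm⟩⟩
    · obtain ⟨W, rfl⟩ := exists_up L v
      exact (split_of_not_inv hp hL fun h' => h ⟨W, rfl, h'⟩).1
  have h3 := Finset.card_filter_add_card_filter_not (s := S) (NS σ)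
  rw [h1, Finset.sum_ite, Finset.sum_const, Finset.sum_const, ← h3]
  obtain ⟨q, hq⟩ : ∃ q, p = q + 1 := ⟨p - 1, by have := hp.two_le; omega⟩
  rw [hq]
  simp only [smul_eq_mul, Nat.add_sub_cancel]
  ring

/-- The inclusion of the units above `S`. -/
noncomputable def inclSU (L : Type) [Field L] [NumberField L] [Algebra K L] (S : Finset (Pl K)) :
    Additive (SU (S : Set (Pl K))) →+ Additive (SU (up L S : Set (Pl L))) :=
  MonoidHom.toAdditive (MonoidHom.codRestrict ((Units.map (algebraMap K L : K →* L)).comp (Subgroup.subtype _)) _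
    fun x W hW => by
      change vl W (algebraMap K L (x : Kˣ)) = 1
      rw [vl_algebraMap, x.2 _ (by rwa [SetLike.mem_coe, mem_up] at hW), one_pow])

lemma cf_inclSU (S : Finset (Pl K)) (x) : (cf (inclSU L S x) : L) = algebraMap K L (cf x) := rfl

include hp hL hσ in
lemma relIndex_norm_range_SU_mul_le [DecidablePred (NS σ)] {S : Finset (Pl K)} (hcl : ClTriv (S : Set (Pl K)))
    (hur : ∀ W : Pl L, dn K W ∉ S → rI K W = 1)
    (hinf : Fintype.card (InfinitePlace L) = p * Fintype.card (InfinitePlace K)) :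
    (Nm K (L := L)).range.relIndex (SU (S : Set (Pl K))) * p ≤ p ^ (S.filter (NS σ)).card ∧
      (Nm K (L := L)).range.relIndex (SU (S : Set (Pl K))) ≠ 0 := by
  set φ := phiE σ S with hφ
  have hord : orderOf σ = p := (orderOf_gen hσ).trans hL
  have hpow : φ ^ p = 1 := by
    refine LinearMap.ext fun x => cf_inj (Units.ext ?_)
    change ((cf ((φ ^ p) x) : Lˣ) : L) = (cf x : Lˣ)
    rw [cf_phiE_pow, ← hord, pow_orderOf_eq_one]
    rfl
  have hnorm : ∀ x, (cf ((∑ i ∈ Finset.range p, φ ^ i) x) : L) = algebraMap K L (Algebra.norm K (cf x : L)) := by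
    intro x
    rw [norm_eq_prod_pow hσ, hL, LinearMap.sum_apply, cf_sum, Units.coe_prod]
    exact Finset.prod_congr rfl fun i _ => cf_phiE_pow σ S i x
  have hker : ∀ x, (∑ i ∈ Finset.range p, φ ^ i) x = 0 → ∃ y, (φ - 1) y = x := by
    intro x hx
    have h1 : Algebra.norm K (cf x : L) = 1 := by
      apply (algebraMap K L).injective
      rw [← hnorm, hx, cf_zero, map_one]; rfl
    obtain ⟨y, hy, hyx⟩ := exists_div_of_norm_eq_one_SU hσ hcl hur (x := cf x) x.toMul.2 h1
    refine ⟨Additive.ofMul ⟨y, hy⟩, cf_inj ?_⟩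
    rw [← hyx]
    rfl
  set j := (inclSU L S).toIntLinearMap with hj
  have hjinj : Function.Injective j := fun x y hxy => by
    refine cf_inj (Units.ext ((algebraMap K L).injective ?_))
    rw [← cf_inclSU, ← cf_inclSU]
    exact congrArg (fun t => ((cf t : Lˣ) : L)) hxy
  have hrange : LinearMap.range j = LinearMap.ker (φ - 1) := by
    ext x
    rw [LinearMap.mem_range, LinearMap.mem_ker, LinearMap.sub_apply, sub_eq_zero]
    constructor
    · rintro ⟨y, rfl⟩
      refine cf_inj (Units.ext ?_)
      rw [cf_phiE, sg_apply]
      exact σ.commutes _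
    · intro hx
      have hx' : σ (cf x : L) = (cf x : L) := by
        rw [← sg_apply, ← cf_phiE]
        exact congrArg (fun t => ((cf t : Lˣ) : L)) hx
      obtain ⟨c, hc⟩ : (cf x : L) ∈ Set.range (algebraMap K L) := by
        rw [IsGalois.mem_range_algebraMap_iff_fixed]
        intro τ
        have : ∀ i : ℕ, (σ ^ i) (cf x : L) = (cf x : L) := by
          intro i
          induction i with
          | zero => rfl
          | succ i ih => rw [pow_succ, AlgEquiv.mul_apply, hx', ih]
        obtain ⟨i, rfl⟩ := mem_powers_iff_mem_zpowers.2 (hσ τ)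
        exact this i
      have hc0 : c ≠ 0 := by rintro rfl; exact (cf x).ne_zero (by rw [← hc, map_zero])
      refine ⟨Additive.ofMul ⟨Units.mk0 c hc0, fun v hv => ?_⟩, cf_inj (Units.ext hc)⟩
      obtain ⟨W, rfl⟩ := exists_up L v
      have h2 : vl W (cf x : L) = 1 := x.toMul.2 W (by rwa [SetLike.mem_coe, mem_up])
      rw [← hc, vl_algebraMap] at h2
      simpa [(rI_pos W).ne'] using h2
  have H := herbrand_aux p hp φ hpow hker
  set I := (LinearMap.range (∑ i ∈ Finset.range p, φ ^ i)).toAddSubgroup.relIndex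
      (LinearMap.ker (φ - 1)).toAddSubgroup with hI
  have hp1 := hp.one_lt
  have hf1 := finrank_SU (K := L) (up L S)
  have hf2 := finrank_SU (K := K) S
  have hf3 : Module.finrank ℤ (LinearMap.ker (φ - 1)) = Module.finrank ℤ (Additive (SU (S : Set (Pl K)))) := by
    rw [← hrange]; exact LinearMap.finrank_range_of_inj hjinj
  have hcard := card_up hp hL hσ S
  have hcc : {v ∈ S | NS σ v}.card = (@Finset.filter _ (NS σ) (fun _ => Classical.propDecidable _) S).card := by
    congr!
  rw [← hcc] at hcard
  set s' := {v ∈ S | NS σ v}.card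
  have hIp : I * p = p ^ s' := by
    have h1 : (I * p) ^ (p - 1) = (p ^ s') ^ (p - 1) := by
      have hpp : 0 < p ^ (Module.finrank ℤ (Additive (SU (up L S : Set (Pl L))))) := pow_pos hp.pos _
      apply Nat.eq_of_mul_eq_mul_right hpp
      rw [mul_pow, mul_right_comm, H, hf3, ← pow_mul, ← pow_add, ← pow_add]
      congr 1
      obtain ⟨q, rfl⟩ : ∃ q, p = q + 1 := ⟨p - 1, by omega⟩
      simp only [Nat.add_sub_cancel] at *
      rw [hinf] at hf1
      zify at *
      linear_combination (-1 : ℤ) * hf1 + (q + 1) * hf2 - hcard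
    exact Nat.pow_left_injective (n := p - 1) (by omega) h1
  have hI0 : I ≠ 0 := fun h => by
    rw [h, zero_mul] at hIp
    exact (pow_pos hp.pos s').ne hIp
  have hle : AddSubgroup.comap j.toAddMonoidHom (LinearMap.range (∑ i ∈ Finset.range p, φ ^ i)).toAddSubgroup ≤
      Subgroup.toAddSubgroup ((Nm K (L := L)).range.subgroupOf (SU (S : Set (Pl K)))) := by
    rintro x ⟨y, hy⟩
    change (cf x) ∈ (Nm K (L := L)).range
    refine ⟨cf y, Units.ext ((algebraMap K L).injective ?_)⟩
    rw [← cf_inclSU]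
    exact (hnorm y).symm.trans (congrArg (fun t => ((cf t : Lˣ) : L)) hy)
  have hIc : (AddSubgroup.comap j.toAddMonoidHom
      (LinearMap.range (∑ i ∈ Finset.range p, φ ^ i)).toAddSubgroup).index = I := by
    rw [hI, ← hrange, ← AddSubgroup.relIndex_top_right, AddSubgroup.relIndex_comap]
    congr 1
    ext x
    simp
  have h4 : (Nm K (L := L)).range.relIndex (SU (S : Set (Pl K))) =
      (Subgroup.toAddSubgroup ((Nm K (L := L)).range.subgroupOf (SU (S : Set (Pl K))))).index := by
    rw [Subgroup.index_toAddSubgroup]; rfl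
  have h5 := AddSubgroup.index_dvd_of_le hle
  rw [hIc, ← h4] at h5
  refine ⟨?_, fun h => hI0 (by rw [h] at h5; exact zero_dvd_iff.1 h5)⟩
  rw [← hIp]
  exact Nat.mul_le_mul_right _ (Nat.le_of_dvd (Nat.pos_of_ne_zero hI0) h5)

end

end CyclicSchur

namespace CyclicSchur
open NumberField IsDedekindDomain WithZero
open scoped WithZero

section groups
variable {G : Type*} [CommGroup G] {p : ℕ}

lemma prime_dvd_index (hp : p.Prime) {H : Subgroup G} (h0 : H.index ≠ 0) (h : H ≠ ⊤)
    (hH : ∀ x : G, x ^ p ∈ H) : p ∣ H.index := by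
  have : H.FiniteIndex := ⟨h0⟩
  have hP : IsPGroup p (G ⧸ H) := fun x => by
    obtain ⟨x, rfl⟩ := QuotientGroup.mk_surjective x
    exact ⟨1, by rw [pow_one, ← QuotientGroup.mk_pow, QuotientGroup.eq_one_iff]; exact hH x⟩
  have := Fact.mk hp
  obtain ⟨n, hn⟩ := IsPGroup.iff_card.1 hP
  rw [Subgroup.index_eq_card, hn]
  refine dvd_pow_self p fun h' => h ?_
  rw [← Subgroup.index_eq_one, Subgroup.index_eq_card, hn, h', pow_zero]

lemma le_relIndex_of_not_mem (hp : p.Prime) {H J : Subgroup G} (h0 : H.relIndex J ≠ 0) (h : ¬ J ≤ H)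
    (hH : ∀ x ∈ J, x ^ p ∈ H) : p ∣ H.relIndex J :=
  prime_dvd_index hp h0 (fun h' => h (Subgroup.subgroupOf_eq_top.1 h')) fun x => hH x.1 x.2

lemma inf_le_of_relIndex_eq {A B J : Subgroup G} (hAB : A ≤ B) (h : A.relIndex J = B.relIndex J)
    (h0 : B.relIndex J ≠ 0) : B ⊓ J ≤ A := by
  have h1 := Subgroup.relIndex_inf_mul_relIndex A B J
  rw [inf_eq_left.2 hAB, h] at h1
  exact Subgroup.relIndex_eq_one.1 (Nat.eq_of_mul_eq_mul_right (Nat.pos_of_ne_zero h0) (by rw [h1, one_mul]))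

lemma relIndex_eq_index {H N : Subgroup G} (h : H ⊔ N = ⊤) : N.relIndex H = N.index := by
  rw [← Subgroup.relIndex_sup_right H N, h, Subgroup.relIndex_top_right]

lemma exists_finset_reps {H : Subgroup G} (h0 : H.index ≠ 0) :
    ∃ F : Finset G, ∀ x, ∃ y ∈ F, y⁻¹ * x ∈ H := by
  classical
  have : H.FiniteIndex := ⟨h0⟩
  have := Fintype.ofFinite (G ⧸ H)
  refine ⟨Finset.univ.image fun q : G ⧸ H => q.out, fun x =>
    ⟨_, Finset.mem_image_of_mem _ (Finset.mem_univ (x : G ⧸ H)), ?_⟩⟩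
  rw [← QuotientGroup.eq, QuotientGroup.out_eq']

end groups

section
variable {K M : Type} [Field K] [NumberField K] [Field M] [NumberField M] [Algebra K M]

/-- A Kummer extension of prime degree: `M = K(β)`, `β ^ p = α`, `σ β = ζ β`. -/
structure Kum (p : ℕ) (ζ α : Kˣ) (σ : M ≃ₐ[K] M) (β : Mˣ) : Prop where
  prime : p.Prime
  hζ : IsPrimitiveRoot ζ p
  hα : algebraMap K M α = (β : M) ^ p
  hσ : σ β = algebraMap K M ζ * β
  deg : Module.finrank K M = p

variable {p : ℕ} {ζ α : Kˣ} {σ : M ≃ₐ[K] M} {β : Mˣ}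

namespace Kum

lemma pow_apply (h : Kum p ζ α σ β) (i : ℕ) : (σ ^ i) β = algebraMap K M ζ ^ i * β := by
  induction i with
  | zero => simp
  | succ i ih =>
    rw [pow_succ', AlgEquiv.mul_apply, ih, map_mul, map_pow, AlgEquiv.commutes, h.hσ]; ring

lemma orderOf_eq (h : Kum p ζ α σ β) : orderOf σ = p ∧ Nat.card (M ≃ₐ[K] M) = p := by
  have h1 : Nat.card (M ≃ₐ[K] M) ≤ p := by rw [← h.deg, Nat.card_eq_fintype_card]; exact AlgEquiv.card_le
  have h2 : p ∣ orderOf σ := by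
    have h3 := h.pow_apply (orderOf σ)
    rw [pow_orderOf_eq_one, AlgEquiv.one_apply, eq_comm, mul_eq_right₀ β.ne_zero, ← map_pow,
      map_eq_one_iff _ (algebraMap K M).injective] at h3
    exact h.hζ.dvd_of_pow_eq_one _ (Units.ext (by simpa using h3))
  have h3 := orderOf_dvd_natCard σ
  have h4 := Nat.le_of_dvd Nat.card_pos h3
  have h5 := Nat.le_of_dvd (orderOf_pos σ) h2
  exact ⟨by omega, by omega⟩

lemma gen (h : Kum p ζ α σ β) (τ : M ≃ₐ[K] M) : τ ∈ Subgroup.zpowers σ := by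
  have : Subgroup.zpowers σ = ⊤ := by
    rw [← Subgroup.card_eq_iff_eq_top, Nat.card_zpowers, h.orderOf_eq.1, h.orderOf_eq.2]
  rw [this]
  trivial

lemma isGalois (h : Kum p ζ α σ β) : IsGalois K M :=
  IsGalois.of_card_aut_eq_finrank K M (by rw [h.orderOf_eq.2, h.deg])

lemma hζM (h : Kum p ζ α σ β) : IsPrimitiveRoot (algebraMap K M ζ) p :=
  (IsPrimitiveRoot.coe_units_iff.2 h.hζ).map_of_injective (algebraMap K M).injective

lemma mem_range (h : Kum p ζ α σ β) {x : M} (hx : σ x = x) : x ∈ Set.range (algebraMap K M) := by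
  have := h.isGalois
  rw [IsGalois.mem_range_algebraMap_iff_fixed]
  intro τ
  have h1 : ∀ i : ℕ, (σ ^ i) x = x := by
    intro i
    induction i with
    | zero => rfl
    | succ i ih => rw [pow_succ, AlgEquiv.mul_apply, hx, ih]
  obtain ⟨i, rfl⟩ := mem_powers_iff_mem_zpowers.2 (h.gen τ)
  exact h1 i

lemma mem_of_pow (h : Kum p ζ α σ β) {b : Kˣ} {y : M} (hy : algebraMap K M b = y ^ p) :
    b ∈ Subgroup.zpowers α ⊔ Pw K p := by
  have hy0 : y ≠ 0 := by
    rintro rfl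
    rw [zero_pow h.prime.ne_zero, map_eq_zero] at hy
    exact b.ne_zero hy
  have := NeZero.mk h.prime.ne_zero
  obtain ⟨i, -, hi⟩ := h.hζM.eq_pow_of_pow_eq_one (ξ := σ y / y) (by
    rw [div_pow, ← map_pow, ← hy, AlgEquiv.commutes, div_self]
    simp)
  have h1 : σ y = algebraMap K M ζ ^ i * y := by rw [hi, div_mul_cancel₀ _ hy0]
  have hζ0 : algebraMap K M ζ ≠ 0 := by simp
  obtain ⟨c, hc⟩ := h.mem_range (x := y / (β : M) ^ i) (by
    rw [map_div₀, map_pow, h.hσ, h1, mul_pow, mul_div_mul_left _ _ (pow_ne_zero _ hζ0)])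
  have hc0 : c ≠ 0 := by
    rintro rfl
    rw [map_zero, eq_comm, div_eq_zero_iff] at hc
    exact hc.elim hy0 (pow_ne_zero _ β.ne_zero)
  have : b = α ^ i * (Units.mk0 c hc0) ^ p := by
    refine Units.ext ((algebraMap K M).injective ?_)
    rw [Units.val_mul, Units.val_pow_eq_pow_val, Units.val_pow_eq_pow_val, hy, map_mul, map_pow, map_pow, Units.val_mk0, hc, h.hα, div_pow, ← pow_mul, ← pow_mul, mul_comm p i,
      mul_div_cancel₀ _ (pow_ne_zero _ β.ne_zero)]
  rw [this]
  exact mul_mem (Subgroup.mem_sup_left (Subgroup.npow_mem_zpowers α i)) (Subgroup.mem_sup_right ⟨_, rfl⟩)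

lemma not_mem_Pw (h : Kum p ζ α σ β) : α ∉ Pw K p := by
  rintro ⟨c, rfl⟩
  have := NeZero.mk h.prime.ne_zero
  have hc0 : algebraMap K M c ≠ 0 := by simp
  obtain ⟨i, -, hi⟩ := h.hζM.eq_pow_of_pow_eq_one (ξ := (β : M) / algebraMap K M c) (by
    rw [div_pow, ← h.hα, ← map_pow]
    simp)
  rw [eq_div_iff hc0] at hi
  have h1 := h.hσ
  rw [← hi, map_mul, map_pow, AlgEquiv.commutes, AlgEquiv.commutes, eq_comm, mul_eq_right₀ (hi ▸ β.ne_zero),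
    map_eq_one_iff _ (algebraMap K M).injective] at h1
  exact h.hζ.ne_one h.prime.one_lt (Units.ext h1)

lemma exists_of_not_mem (hp : p.Prime) (hζ : IsPrimitiveRoot ζ p) (hα : α ∉ Pw K p) :
    ∃ (M : Type) (_ : Field M) (_ : NumberField M) (_ : Algebra K M) (σ : M ≃ₐ[K] M) (β : Mˣ), Kum p ζ α σ β := by
  have hirr : Irreducible (Polynomial.X ^ p - Polynomial.C (α : K)) :=
    X_pow_sub_C_irreducible_of_prime hp fun b hb => hα ⟨Units.mk0 b (by
      rintro rfl; rw [zero_pow hp.ne_zero] at hb; exact α.ne_zero hb.symm), Units.ext (by simpa using hb)⟩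
  have := Fact.mk hirr
  set f := Polynomial.X ^ p - Polynomial.C (α : K) with hf
  have hmonic : f.Monic := Polynomial.monic_X_pow_sub_C _ hp.ne_zero
  have : CharZero (AdjoinRoot f) := charZero_of_injective_algebraMap (algebraMap K (AdjoinRoot f)).injective
  have hfin : FiniteDimensional K (AdjoinRoot f) := hmonic.finite_adjoinRoot
  have : FiniteDimensional ℚ (AdjoinRoot f) := FiniteDimensional.trans ℚ K (AdjoinRoot f)
  have hroot : algebraMap K (AdjoinRoot f) α = AdjoinRoot.root f ^ p := by
    have h1 := AdjoinRoot.eval₂_root f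
    rw [hf, Polynomial.eval₂_sub, Polynomial.eval₂_C, Polynomial.eval₂_pow, Polynomial.eval₂_X, sub_eq_zero] at h1
    exact h1.symm
  have hr0 : AdjoinRoot.root f ≠ 0 := fun h => by
    rw [h, zero_pow hp.ne_zero, map_eq_zero] at hroot
    exact α.ne_zero hroot
  have hζp : (ζ : K) ^ p = 1 := by rw [← Units.val_pow_eq_pow_val, hζ.pow_eq_one, Units.val_one]
  have hev : Polynomial.eval₂ (Algebra.ofId K (AdjoinRoot f) : K →+* AdjoinRoot f)
      (algebraMap K (AdjoinRoot f) ζ * AdjoinRoot.root f) f = 0 := by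
    refine (Polynomial.eval₂_sub _).trans ?_
    rw [Polynomial.eval₂_C, Polynomial.eval₂_pow, Polynomial.eval₂_X, mul_pow, ← hroot,
      ← map_pow, hζp, map_one, one_mul]
    exact sub_self _
  let φ : AdjoinRoot f →ₐ[K] AdjoinRoot f := AdjoinRoot.liftAlgHom f (Algebra.ofId K (AdjoinRoot f)) _ hev
  refine ⟨AdjoinRoot f, inferInstance, ⟨⟩, inferInstance, AlgEquiv.ofBijective φ φ.bijective,
    Units.mk0 _ hr0, hp, hζ, hroot, ?_, ?_⟩
  · exact AdjoinRoot.liftAlgHom_root f (Algebra.ofId K (AdjoinRoot f)) _ hev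
  · rw [(AdjoinRoot.powerBasis hmonic.ne_zero).finrank, AdjoinRoot.powerBasis_dim, hf, Polynomial.natDegree_X_pow_sub_C]

end Kum

/-- The elements that are `p`-th powers locally at `v`. -/
def Pv (p : ℕ) (v : Pl K) : Subgroup Kˣ := ⨅ N, PP p v N

variable (M) in
/-- The elements that are norms from `M` locally at `v`. -/
noncomputable def NV (v : Pl K) : Subgroup Kˣ := ⨅ N, NN M v N

lemma mem_Pv {v : Pl K} {x : Kˣ} : x ∈ Pv p v ↔ ∀ N, x ∈ PP p v N := Subgroup.mem_iInf

lemma mem_NV {v : Pl K} {x : Kˣ} : x ∈ NV M v ↔ ∀ N, x ∈ NN M v N := Subgroup.mem_iInf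

lemma Pw_le_Pv (v : Pl K) : Pw K p ≤ Pv p v := le_iInf fun _ => le_sup_left

lemma Nm_le_NV (v : Pl K) : (Nm K (L := M)).range ≤ NV M v := le_iInf fun _ => le_sup_left

lemma algebraMap_mem_U_iff {W : Pl M} (he : rI K W = 1) {N : ℕ} {x : Kˣ} :
    Units.map (algebraMap K M : K →* M) x ∈ U W N ↔ x ∈ U (dn K W) N := by
  have h1 : ∀ y : K, vl W (algebraMap K M y) = vl (dn K W) y := fun y => by rw [vl_algebraMap, he, pow_one]
  rw [mem_U, mem_U, ← h1, ← h1, map_sub (algebraMap K M), map_one]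
  rfl

lemma algebraMap_mem_U {W : Pl M} {N : ℕ} {x : Kˣ} (hx : x ∈ U (dn K W) N) :
    Units.map (algebraMap K M : K →* M) x ∈ U W N := by
  refine mem_U.2 ⟨?_, ?_⟩
  · change vl W (algebraMap K M x) = 1
    rw [vl_algebraMap, hx.1, one_pow]
  · change vl W (algebraMap K M x - 1) ≤ _
    rw [← map_one (algebraMap K M), ← map_sub, vl_algebraMap]
    have h1 : vl (dn K W) ((x : K) - 1) ≤ 1 := hx.2.trans (exp_neg_le_one _)
    calc _ ≤ vl (dn K W) ((x : K) - 1) ^ 1 := pow_le_pow_of_le_one zero_le h1 (rI_pos W)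
      _ ≤ _ := by rw [pow_one]; exact hx.2

lemma vl_natCast_le_sub_one (hp : 0 < p) {z : K} (hz : IsPrimitiveRoot z p) (hp1 : 1 < p) (v : Pl K) :
    vl v (p : K) ≤ vl v (z - 1) := by
  have hz1 : vl v z = 1 := vl_root hp.ne' hz.pow_eq_one v
  have h1 : (p : K) = ∑ i ∈ Finset.range p, (1 - z ^ i) := by
    rw [Finset.sum_sub_distrib, hz.geom_sum_eq_zero hp1]; simp
  rw [h1]
  refine (vl v).map_sum_le fun i _ => ?_
  rw [Valuation.map_sub_swap, ← mul_geom_sum, map_mul]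
  refine mul_le_of_le_one_right' ((vl v).map_sum_le fun j _ => ?_)
  rw [map_pow, hz1, one_pow]

namespace Kum

lemma not_NS_of_mem_PP (h : Kum p ζ α σ β) {v : Pl K} {N : ℕ} (hN : exp (-(N : ℤ)) < vl v (p : K) ^ p)
    (hα : α ∈ PP p v N) : ¬ NS σ v := by
  rintro ⟨W, rfl, hW⟩
  obtain ⟨_, ⟨c, rfl⟩, u, hu, hcu⟩ := Subgroup.mem_sup.1 hα
  have hp0 := h.prime.ne_zero
  have hc0 : algebraMap K M c ≠ 0 := by simp
  set θ : M := β / algebraMap K M c with hθ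
  have hθp : θ ^ p = algebraMap K M u := by
    rw [hθ, div_pow, ← h.hα, ← hcu, Units.val_mul, map_mul, mul_div_assoc, mul_comm, div_mul_eq_mul_div, mul_div_assoc]
    simp
  have hσθ : ∀ i : ℕ, (σ ^ i) θ = algebraMap K M ζ ^ i * θ := fun i => by
    rw [hθ, map_div₀, h.pow_apply, AlgEquiv.commutes, mul_div_assoc]
  set z := algebraMap K M ζ with hz
  have hz0 : z ≠ 0 := by simp [hz]
  have hz1 : vl W z = 1 := vl_root hp0 h.hζM.pow_eq_one W
  have hi : ∀ i : ℕ, vl W (θ - z⁻¹ ^ i) = vl W (θ - 1) := fun i => by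
    rw [← hW.pow i (θ - 1), map_sub (σ ^ i), map_one, hσθ]
    have : z ^ i * θ - 1 = z ^ i * (θ - z⁻¹ ^ i) := by
      rw [mul_sub, ← mul_pow, mul_inv_cancel₀ hz0, one_pow]
    rw [this, map_mul, map_pow, hz1, one_pow, one_mul]
  have h1 : vl W (θ - 1) ^ p = vl W (algebraMap K M (u - 1)) := by
    rw [map_sub (algebraMap K M), map_one, ← hθp, pow_sub_one_eq_prod h.prime.pos h.hζM.inv, map_prod,
      Finset.prod_congr rfl fun i _ => hi i, Finset.prod_const, Finset.card_range]
  have hθ1 : vl W θ = 1 := by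
    have : vl W θ ^ p = 1 := by rw [← map_pow, hθp, vl_algebraMap, hu.1, one_pow]
    exact (pow_eq_one_iff_of_nonneg zero_le hp0).1 this
  have h2 : vl W (p : M) ≤ vl W (θ - 1) := by
    refine (vl_natCast_le_sub_one h.prime.pos h.hζM h.prime.one_lt W).trans ?_
    have h3 : (z - 1) * θ = σ (θ - 1) - (θ - 1) := by
      have := hσθ 1
      rw [pow_one, pow_one] at this
      rw [map_sub, map_one, this]; ring
    calc vl W (z - 1) = vl W ((z - 1) * θ) := by rw [map_mul, hθ1, mul_one]
      _ ≤ vl W (θ - 1) := by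
        rw [h3]
        refine ((vl W).map_sub _ _).trans ?_
        rw [hW, max_self]
  have h4 : vl W (p : M) ^ p ≤ vl W (algebraMap K M (u - 1)) := h1 ▸ pow_le_pow_left' h2 p
  rw [← map_natCast (algebraMap K M), vl_algebraMap, vl_algebraMap, ← pow_mul, mul_comm, pow_mul] at h4
  exact absurd h4 (not_le.2 (pow_lt_pow_left₀ (hu.2.trans_lt hN) zero_le (rI_pos W).ne'))

lemma mem_Pv_of_not_NS (h : Kum p ζ α σ β) {v : Pl K} (hv : ¬ NS σ v) : α ∈ Pv p v := by
  have := h.isGalois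
  obtain ⟨W, rfl⟩ := exists_up M v
  obtain ⟨-, he, hf⟩ := split_of_not_inv h.prime h.deg fun h' => hv ⟨W, rfl, h'⟩
  rw [mem_Pv]
  suffices H : ∀ N : ℕ, N ≠ 0 → α ∈ PP p (dn K W) N from fun N => PP_anti _ _ (Nat.le_succ N) (H _ (Nat.succ_ne_zero N))
  intro N hN
  obtain ⟨n, hn⟩ := exists_ord W (β : M) β.ne_zero
  obtain ⟨c, hc⟩ := exists_approx he hf (β : M) (N + n.natAbs)
  have h1 : vl W (algebraMap K M c / β - 1) ≤ exp (-(N : ℤ)) := by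
    have : algebraMap K M c / β - 1 = -((β - algebraMap K M c) / β) := by
      field_simp; ring
    rw [this, Valuation.map_neg, map_div₀, hn, div_le_iff₀ (by simp)]
    refine hc.trans ?_
    rw [← exp_add, exp_le_exp]
    omega
  have hc0 : c ≠ 0 := by
    rintro rfl
    rw [map_zero, zero_div, zero_sub, Valuation.map_neg, map_one, ← exp_zero, exp_le_exp] at h1
    omega
  set c' := Units.mk0 c hc0
  have h2 : Units.map (algebraMap K M : K →* M) c' / β ∈ U W N := by
    refine mem_U_of_sub hN ?_
    rw [Units.val_div_eq_div_val]
    exact h1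
  have h3 : Units.map (algebraMap K M : K →* M) (c' ^ p / α) ∈ U W N := by
    have : Units.map (algebraMap K M : K →* M) α = β ^ p := Units.ext h.hα
    rw [map_div, map_pow, this, ← div_pow]
    exact (U W N).pow_mem h2 p
  rw [algebraMap_mem_U_iff he] at h3
  have h4 : α = c' ^ p * (c' ^ p / α)⁻¹ := by rw [inv_div, mul_div_cancel]
  rw [h4]
  exact mul_mem (Subgroup.mem_sup_left ⟨_, rfl⟩) (Subgroup.mem_sup_right (inv_mem h3))

lemma rI_eq_one (h : Kum p ζ α σ β) {W : Pl M} (hvp : vl (dn K W) (p : K) = 1) (hvα : vl (dn K W) (α : K) = 1) :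
    rI K W = 1 := by
  have := h.isGalois
  by_cases hW : Inv σ W
  · by_contra hne
    have hef := hW.ef h.gen
    rw [h.deg] at hef
    have he : rI K W = p := (h.prime.eq_one_or_self_of_dvd _ (Dvd.intro _ hef)).resolve_left hne
    have hf : rD K W = 1 := by
      rw [he] at hef
      exact Nat.eq_of_mul_eq_mul_left h.prime.pos (hef.trans (mul_one p).symm)
    have hβ : vl W (β : M) = 1 := by
      have : vl W (β : M) ^ p = 1 := by rw [← map_pow, ← h.hα, vl_algebraMap, hvα, one_pow]
      exact (pow_eq_one_iff_of_nonneg zero_le h.prime.ne_zero).1 this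
    obtain ⟨r, hr⟩ := exists_int_sub_lt_of_rD hf hβ.le
    have hr' := hr
    rw [← hW, map_sub σ, AlgEquiv.commutes] at hr'
    have h1 : vl W ((algebraMap K M ζ - 1) * β) < 1 := by
      have : (algebraMap K M ζ - 1) * β = (σ β - algebraMap K M r) - (β - algebraMap K M r) := by rw [h.hσ]; ring
      rw [this]
      exact (vl W).map_sub_lt hr' hr
    rw [map_mul, hβ, mul_one] at h1
    have h2 := (vl_natCast_le_sub_one h.prime.pos h.hζM h.prime.one_lt W).trans_lt h1
    rw [← map_natCast (algebraMap K M), vl_algebraMap, hvp, one_pow] at h2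
    exact h2.false
  · exact (split_of_not_inv h.prime h.deg hW).2.1

end Kum

end
end CyclicSchur

namespace CyclicSchur
open NumberField IsDedekindDomain WithZero
open scoped WithZero

section
variable {K : Type} [Field K] [NumberField K] {p : ℕ} {ζ : Kˣ}

lemma exists_exp_lt_natCast_pow (hp : p.Prime) (v : Pl K) :
    ∃ N₀ : ℕ, ∀ N ≥ N₀, exp (-(N : ℤ)) < vl v (p : K) ^ p := by
  obtain ⟨d, hd⟩ := exists_ord_int v (p : 𝓞 K) (by exact_mod_cast hp.ne_zero)
  rw [show ((p : 𝓞 K) : K) = p from map_natCast (algebraMap (𝓞 K) K) p] at hd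
  refine ⟨d * p + 1, fun N hN => ?_⟩
  rw [hd, ← exp_nsmul, exp_lt_exp, smul_neg, neg_lt_neg_iff, nsmul_eq_mul]
  have : p * d < N := by rw [mul_comm]; omega
  exact_mod_cast this

lemma Pv_eq (hp : p.Prime) (hζ : IsPrimitiveRoot ζ p) {v : Pl K} {N : ℕ} (hN : exp (-(N : ℤ)) < vl v (p : K) ^ p) :
    Pv p v = PP p v N := by
  refine le_antisymm (iInf_le _ N) fun b hb => ?_
  by_cases h : b ∈ Pw K p
  · exact Pw_le_Pv v h
  · obtain ⟨M, _, _, _, σ, β, hM⟩ := Kum.exists_of_not_mem hp hζ h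
    exact hM.mem_Pv_of_not_NS (hM.not_NS_of_mem_PP hN hb)

lemma exists_Pv_eq (hp : p.Prime) (hζ : IsPrimitiveRoot ζ p) (S : Finset (Pl K)) :
    ∃ N₀ : ℕ, ∀ N ≥ N₀, ∀ v ∈ S, Pv p v = PP p v N := by
  choose n hn using exists_exp_lt_natCast_pow (K := K) hp
  exact ⟨S.sup n, fun N hN v hv => Pv_eq hp hζ (hn v N ((Finset.le_sup hv).trans hN))⟩

lemma index_iInf_Pv_le (hp : p.Prime) (hζ : IsPrimitiveRoot ζ p) (S : Finset (Pl K)) :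
    (⨅ v : S, Pv p v.1).index ≤ p ^ (2 * S.card + Module.finrank ℚ K) ∧ (⨅ v : S, Pv p v.1).index ≠ 0 := by
  obtain ⟨N₁, h₁⟩ := exists_Pv_eq hp hζ S
  obtain ⟨N₂, h₂⟩ := index_iInf_PP_le hp hζ S
  have := h₂ (max N₁ N₂) (le_max_right _ _)
  rwa [iInf_congr fun v : S => h₁ (max N₁ N₂) (le_max_left _ _) v.1 v.2]

lemma exists_U_le_Pv (hp : p.Prime) (hζ : IsPrimitiveRoot ζ p) (S : Finset (Pl K)) :
    ∃ N : ℕ, ∀ v ∈ S, U v N ≤ Pv p v := by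
  obtain ⟨N₁, h₁⟩ := exists_Pv_eq hp hζ S
  exact ⟨N₁, fun v hv => by rw [h₁ N₁ le_rfl v hv]; exact le_sup_right⟩

lemma index_Pv_ne_zero (hp : p.Prime) (hζ : IsPrimitiveRoot ζ p) (v : Pl K) : (Pv p v).index ≠ 0 := by
  have := (index_iInf_Pv_le hp hζ {v}).2
  exact fun h => this (by simpa using h)

lemma index_Pv_le (hp : p.Prime) (hζ : IsPrimitiveRoot ζ p) {v : Pl K} (hv : vl v (p : K) = 1) :
    (Pv p v).index ≤ p ^ 2 := by
  have h1 : exp (-((1 : ℕ) : ℤ)) < vl v (p : K) ^ p := by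
    rw [hv, one_pow, ← exp_zero, exp_lt_exp]; norm_num
  rw [Pv_eq hp hζ h1]
  simpa using (index_PP_le hp hζ v (d := 0) (N := 1) (by simpa using hv) one_pos).1

/-- The class group is generated outside `p` and primes in `S`. -/
structure Good (p : ℕ) (S : Finset (Pl K)) : Prop where
  cl : ClTriv (S : Set (Pl K))
  hp : ∀ v ∉ S, vl v (p : K) = 1

lemma Good.mono {S T : Finset (Pl K)} (h : Good p S) (hST : S ⊆ T) : Good p T :=
  ⟨h.cl.mono (by exact_mod_cast hST), fun v hv => h.hp v fun h' => hv (hST h')⟩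

lemma exists_good (hp : p ≠ 0) (S₀ : Finset (Pl K)) (F : Finset Kˣ) :
    ∃ S : Finset (Pl K), S₀ ⊆ S ∧ Good p S ∧ ∀ x ∈ F, x ∈ SU (S : Set (Pl K)) := by
  classical
  obtain ⟨S₁, h₁⟩ := exists_ClTriv K
  let pu : Kˣ := Units.mk0 (p : K) (by exact_mod_cast hp)
  let G := (insert pu F).biUnion fun x => (finite_support x).toFinset
  have hG : ∀ x ∈ insert pu F, ∀ v ∉ S₀ ∪ S₁ ∪ G, vl v (x : K) = 1 := fun x hx v hv => by
    by_contra h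
    exact hv (Finset.mem_union_right _ (Finset.mem_biUnion.2 ⟨x, hx, by simpa using h⟩))
  refine ⟨S₀ ∪ S₁ ∪ G, fun v hv => by simp [hv], ⟨h₁.mono fun v hv => ?_, fun v hv => ?_⟩, fun x hx => ?_⟩
  · have : v ∈ S₁ := hv
    simp [this]
  · exact hG pu (Finset.mem_insert_self _ _) v hv
  · exact mem_SU.2 fun v hv => hG x (Finset.mem_insert_of_mem hx) v (by simpa using hv)

lemma mem_SU_of_pow {S : Set (Pl K)} {c : Kˣ} (hp : p ≠ 0) (h : c ^ p ∈ SU S) : c ∈ SU S := by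
  rw [mem_SU] at h ⊢
  intro v hv
  have := h v hv
  rw [Units.val_pow_eq_pow_val, map_pow] at this
  exact (pow_eq_one_iff_of_nonneg zero_le hp).1 this

section
variable {M : Type} [Field M] [NumberField M] [Algebra K M] {α : Kˣ} {σ : M ≃ₐ[K] M} {β : Mˣ}

lemma Pw_le_Nm (hM : Module.finrank K M = p) : Pw K p ≤ (Nm K (L := M)).range := by
  rintro _ ⟨c, rfl⟩
  refine ⟨Units.map (algebraMap K M : K →* M) c, Units.ext ?_⟩
  change Algebra.norm K (algebraMap K M c) = _
  rw [Algebra.norm_algebraMap, hM]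
  rfl

lemma Pv_le_NV (hM : Module.finrank K M = p) (v : Pl K) : Pv p v ≤ NV M v :=
  iInf_mono fun _ => sup_le_sup_right (Pw_le_Nm hM) _

namespace Kum

lemma not_NS_iff (h : Kum p ζ α σ β) {v : Pl K} : ¬ NS σ v ↔ α ∈ Pv p v := by
  refine ⟨h.mem_Pv_of_not_NS, fun hα => ?_⟩
  obtain ⟨N, hN⟩ := exists_exp_lt_natCast_pow (K := K) h.prime v
  exact h.not_NS_of_mem_PP (hN N le_rfl) (mem_Pv.1 hα N)

lemma index_NV_ne_zero (h : Kum p ζ α σ β) (v : Pl K) : (NV M v).index ≠ 0 := fun h0 =>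
  index_Pv_ne_zero h.prime h.hζ v (zero_dvd_iff.1 (h0 ▸ Subgroup.index_dvd_of_le (Pv_le_NV h.deg v)))

lemma dvd_index_NV (h : Kum p ζ α σ β) {v : Pl K} (hv : NS σ v) : p ∣ (NV M v).index := by
  have := h.isGalois
  refine prime_dvd_index h.prime (h.index_NV_ne_zero v) ?_ fun x => Pv_le_NV h.deg v (Pw_le_Pv v ⟨x, rfl⟩)
  obtain ⟨W, rfl, hW⟩ := hv
  obtain ⟨N, hN⟩ := exists_NN_ne_top h.prime h.deg h.gen h.hζ β.ne_zero h.hσ hW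
  exact fun ht => hN N le_rfl (top_le_iff.1 (ht.symm.trans_le (iInf_le _ N)))

lemma index_iInf_NV (h : Kum p ζ α σ β) (T : Finset (Pl K)) :
    (⨅ v : T, NV M v.1).index = ∏ v ∈ T, (NV M v).index := by
  obtain ⟨N, hN⟩ := exists_U_le_Pv h.prime h.hζ T
  exact index_iInf_eq_prod T N _ fun v hv => (hN v hv).trans (Pv_le_NV h.deg v)

lemma pow_card_le_index (h : Kum p ζ α σ β) {T : Finset (Pl K)} (hT : ∀ v ∈ T, NS σ v) :
    p ^ T.card ≤ (⨅ v : T, NV M v.1).index ∧ (⨅ v : T, NV M v.1).index ≠ 0 := by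
  rw [h.index_iInf_NV]
  refine ⟨?_, Finset.prod_ne_zero_iff.2 fun v _ => h.index_NV_ne_zero v⟩
  rw [← Finset.prod_const]
  exact Finset.prod_le_prod' fun v hv =>
    Nat.le_of_dvd (Nat.pos_of_ne_zero (h.index_NV_ne_zero v)) (h.dvd_index_NV (hT v hv))

open Classical in
lemma relIndex_SU_mul_le [IsTotallyComplex K] (h : Kum p ζ α σ β) {S : Finset (Pl K)} (hS : Good p S)
    (hα : α ∈ SU (S : Set (Pl K))) :
    (Nm K (L := M)).range.relIndex (SU (S : Set (Pl K))) * p ≤ p ^ (S.filter (NS σ)).card ∧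
      (Nm K (L := M)).range.relIndex (SU (S : Set (Pl K))) ≠ 0 := by
  have := h.isGalois
  have := isTotallyComplex_of_algebra K M
  refine relIndex_norm_range_SU_mul_le h.prime h.deg h.gen hS.cl
    (fun W hW => h.rI_eq_one (hS.hp _ hW) (mem_SU.1 hα _ hW)) ?_
  have h1 : ∀ (F : Type) [Field F] [NumberField F] [IsTotallyComplex F],
      Module.finrank ℚ F = 2 * Fintype.card (InfinitePlace F) := fun F _ _ _ => by
    rw [IsTotallyComplex.finrank, InfinitePlace.card_eq_nrRealPlaces_add_nrComplexPlaces,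
      IsTotallyComplex.nrRealPlaces_eq_zero, zero_add]
  have h2 := Module.finrank_mul_finrank ℚ K M
  rw [h1 K, h1 M, h.deg] at h2
  linarith

/-- There are infinitely many nonsplit places. -/
lemma exists_NS [IsTotallyComplex K] (h : Kum p ζ α σ β) (S₀ : Finset (Pl K)) : ∃ v ∉ S₀, NS σ v := by
  classical
  by_contra! hcon
  let T := S₀.filter (NS σ)
  have hT := h.pow_card_le_index (T := T) fun v hv => (Finset.mem_filter.1 hv).2
  obtain ⟨F, hF⟩ := exists_finset_reps hT.2
  obtain ⟨S, hS₀, hS, hFS⟩ := exists_good h.prime.ne_zero S₀ (insert α F)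
  have h1 := h.relIndex_SU_mul_le hS (hFS α (Finset.mem_insert_self _ _))
  have hTS : S.filter (NS σ) = T := by
    ext v
    simp only [T, Finset.mem_filter]
    refine ⟨fun hv => ⟨?_, hv.2⟩, fun hv => ⟨hS₀ hv.1, hv.2⟩⟩
    by_contra h'
    exact hcon v h' hv.2
  have h2 : SU (S : Set (Pl K)) ⊔ ⨅ v : T, NV M v.1 = ⊤ := by
    rw [eq_top_iff]
    intro x _
    obtain ⟨y, hy, hyx⟩ := hF x
    rw [← mul_inv_cancel_left y x]
    exact mul_mem (Subgroup.mem_sup_left (hFS y (Finset.mem_insert_of_mem hy))) (Subgroup.mem_sup_right hyx)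
  have h3 : (Nm K (L := M)).range ≤ ⨅ v : T, NV M v.1 := le_iInf fun v => Nm_le_NV v.1
  have h4 := Subgroup.relIndex_le_of_le_left h3 h1.2
  rw [relIndex_eq_index h2] at h4
  rw [hTS] at h1
  have h5 := hT.1.trans h4
  have h6 := Nat.mul_le_mul_right p h5
  have h7 := pow_pos h.prime.pos T.card
  have := h.prime.two_le
  nlinarith [h1.1]

end Kum
end
end
end CyclicSchur

namespace CyclicSchur
open NumberField IsDedekindDomain WithZero
open scoped WithZero

lemma relIndex_zpowers_sup_inf {G : Type*} [CommGroup G] {p : ℕ} (hp : p.Prime) {H J : Subgroup G} {a : G}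
    (ha : a ∉ H) (hap : a ^ p ∈ H) (haJ : a ∈ J) : H.relIndex ((Subgroup.zpowers a ⊔ H) ⊓ J) = p := by
  have h1 : H.relIndex (Subgroup.zpowers a ⊔ H) ∣ p := by
    rw [Subgroup.relIndex_sup_right]
    have h2 := Subgroup.relIndex_ker (Subgroup.zpowers a) (QuotientGroup.mk' H)
    rw [QuotientGroup.ker_mk', MonoidHom.map_zpowers, Nat.card_zpowers] at h2
    rw [h2]
    exact orderOf_dvd_of_pow_eq_one (by
      rw [← map_pow]; exact (QuotientGroup.eq_one_iff _).2 hap)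
  have h0 : H.relIndex (Subgroup.zpowers a ⊔ H) ≠ 0 := fun h => hp.ne_zero (zero_dvd_iff.1 (h ▸ h1))
  have h2 := Subgroup.relIndex_le_of_le_right (H := H) (inf_le_left : (Subgroup.zpowers a ⊔ H) ⊓ J ≤ _) h0
  have h3 : H.relIndex ((Subgroup.zpowers a ⊔ H) ⊓ J) ≠ 0 := fun h =>
    h0 (Subgroup.relIndex_eq_zero_of_le_right inf_le_left h)
  have h4 := le_relIndex_of_not_mem hp h3 (fun h => ha (h ⟨Subgroup.mem_sup_left (Subgroup.mem_zpowers a), haJ⟩))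
    (fun x hx => by
      obtain ⟨y, hy, z, hz, rfl⟩ := Subgroup.mem_sup.1 hx.1
      obtain ⟨i, rfl⟩ := Subgroup.mem_zpowers_iff.1 hy
      rw [mul_pow, ← zpow_natCast, ← zpow_mul, mul_comm i, zpow_mul, zpow_natCast]
      exact mul_mem (zpow_mem hap i) (pow_mem hz p))
  have h5 := Nat.le_of_dvd (Nat.pos_of_ne_zero h3) h4
  have h6 := Nat.le_of_dvd hp.pos h1
  omega

section
variable {K : Type} [Field K] [NumberField K] {p : ℕ} {ζ : Kˣ}

lemma index_Pw_sup_U_zero_ge (hp : p.Prime) (v : Pl K) : p ≤ (Pw K p ⊔ U v 0).index := by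
  have := NeZero.mk hp.ne_zero
  have h0 := (index_Pw_sup_U_zero p v).2
  refine Nat.le_of_dvd (Nat.pos_of_ne_zero h0) (prime_dvd_index hp h0 (fun ht => ?_)
    fun x => Subgroup.mem_sup_left ⟨x, rfl⟩)
  obtain ⟨π, hπ⟩ := exists_unif v
  obtain ⟨_, ⟨c, rfl⟩, u, hu, hcu⟩ := Subgroup.mem_sup.1 (ht.symm ▸ Subgroup.mem_top π : π ∈ Pw K p ⊔ U v 0)
  have h1 : vl v (c : K) ^ p = exp (-1) := by
    rw [← hπ, ← hcu, Units.val_mul, map_mul, hu.1, mul_one, ← map_pow]; rfl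
  rw [vl_eq_exp_lg, ← exp_nsmul, exp_inj, nsmul_eq_mul] at h1
  have h2 : (p : ℤ) ∣ 1 := by rw [← dvd_neg]; exact ⟨_, h1.symm⟩
  exact hp.one_lt.ne' (by exact_mod_cast Int.natAbs_dvd_natAbs.2 h2 |> Nat.dvd_one.1)

lemma relIndex_Pv_le (hp : p.Prime) (hζ : IsPrimitiveRoot ζ p) {v : Pl K} (hv : vl v (p : K) = 1)
    {J : Subgroup Kˣ} (hJ : J ≤ Pw K p ⊔ U v 0) : (Pv p v).relIndex J ≤ p ∧ (Pv p v).relIndex J ≠ 0 := by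
  have h1 : Pv p v ≤ Pw K p ⊔ U v 0 := iInf_le (fun N => PP p v N) 0
  have h2 := Subgroup.relIndex_mul_index h1
  have h3 := index_Pv_le hp hζ hv
  have h4 := index_Pw_sup_U_zero_ge hp v
  have h5 := index_Pv_ne_zero hp hζ v
  have h6 : (Pv p v).relIndex (Pw K p ⊔ U v 0) ≠ 0 := fun h => h5 (Subgroup.index_eq_zero_of_relIndex_eq_zero h)
  refine ⟨(Subgroup.relIndex_le_of_le_right hJ h6).trans ?_, fun h => h5 (Subgroup.index_eq_zero_of_relIndex_eq_zero h)⟩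
  have h7 := hp.pos
  nlinarith

lemma SU_le_U_zero {S : Set (Pl K)} {v : Pl K} (hv : v ∉ S) : SU S ≤ U v 0 := fun _ hx => mem_U_zero.2 (hx v hv)

lemma mem_zpowers_sup_Pv (hp : p.Prime) (hζ : IsPrimitiveRoot ζ p) {v : Pl K} (hv : vl v (p : K) = 1)
    {a b : Kˣ} (ha : a ∈ U v 0) (hb : b ∈ U v 0) (hav : a ∉ Pv p v) : b ∈ Subgroup.zpowers a ⊔ Pv p v := by
  set J := Pw K p ⊔ U v 0
  have haJ : a ∈ J := Subgroup.mem_sup_right ha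
  have h1 := relIndex_Pv_le hp hζ hv (J := J) le_rfl
  have h2 := relIndex_zpowers_sup_inf hp hav (Pw_le_Pv v ⟨a, rfl⟩) haJ
  have h3 := Subgroup.relIndex_mul_relIndex (Pv p v) ((Subgroup.zpowers a ⊔ Pv p v) ⊓ J) J
    (le_inf le_sup_right (iInf_le (fun N => PP p v N) 0)) inf_le_right
  rw [h2] at h3
  have h4 : ((Subgroup.zpowers a ⊔ Pv p v) ⊓ J).relIndex J = 1 := by
    have := hp.pos
    have : ((Subgroup.zpowers a ⊔ Pv p v) ⊓ J).relIndex J ≠ 0 := fun h => h1.2 (by rw [← h3, h, mul_zero])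
    have h5 : p * ((Subgroup.zpowers a ⊔ Pv p v) ⊓ J).relIndex J ≤ p * 1 := by rw [h3, mul_one]; exact h1.1
    have := Nat.le_of_mul_le_mul_left h5 hp.pos
    omega
  exact (Subgroup.relIndex_eq_one.1 h4 (Subgroup.mem_sup_right hb)).1

lemma relIndex_Pw_SU (hp : p.Prime) (hζ : IsPrimitiveRoot ζ p) (S : Finset (Pl K)) :
    (Pw K p).relIndex (SU (S : Set (Pl K))) = p ^ (S.card + Fintype.card (InfinitePlace K)) := by
  set A := Additive (SU (S : Set (Pl K)))
  have := NeZero.mk hp.ne_zero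
  have h1 := (rangeIndex_smul_of_fg (A := A) p hp.ne_zero).1
  have hker : Nat.card (LinearMap.ker ((p : ℤ) • (1 : Module.End ℤ A))) = p := by
    have e1 : ∀ x : LinearMap.ker ((p : ℤ) • (1 : Module.End ℤ A)), cf x.1 ∈ rootsOfUnity p K := fun x => by
      have h2 := x.2
      rw [LinearMap.mem_ker] at h2
      have h3 : (p : ℤ) • x.1 = 0 := h2
      rw [natCast_zsmul] at h3
      exact congrArg cf h3
    refine (Nat.card_eq_of_bijective (fun x => (⟨cf x.1, e1 x⟩ : rootsOfUnity p K)) ⟨fun x y hxy => ?_, fun x => ?_⟩).trans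
      hζ.card_rootsOfUnity'
    · exact Subtype.ext (cf_inj (Subtype.mk.inj hxy))
    · refine ⟨⟨Additive.ofMul ⟨x.1, mem_SU_of_pow hp.ne_zero ?_⟩, ?_⟩, rfl⟩
      · rw [(mem_rootsOfUnity _ _).1 x.2]
        exact one_mem _
      · rw [LinearMap.mem_ker]
        change (p : ℤ) • _ = (0 : A)
        rw [natCast_zsmul]
        exact cf_inj ((mem_rootsOfUnity _ _).1 x.2)
  have h2 := finrank_SU (K := K) S
  rw [hker, ← pow_succ, h2] at h1
  rw [← h1, rangeIndex, Subgroup.relIndex, ← Subgroup.index_toAddSubgroup]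
  congr 1
  ext x
  constructor
  · rintro ⟨c, hc⟩
    have hc' : c ^ p = cf x := hc
    refine ⟨Additive.ofMul ⟨c, mem_SU_of_pow hp.ne_zero (hc' ▸ x.toMul.2)⟩, ?_⟩
    change (p : ℤ) • _ = x
    rw [natCast_zsmul]
    exact cf_inj hc'
  · rintro ⟨c, hc⟩
    have hc' : (p : ℤ) • c = x := hc
    rw [natCast_zsmul] at hc'
    exact ⟨cf c, congrArg cf hc'⟩

end
end CyclicSchur

namespace CyclicSchur
open NumberField IsDedekindDomain WithZero
open scoped WithZero

section
variable {K : Type} [Field K] [NumberField K] {p : ℕ} {ζ : Kˣ}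
variable {M : Type} [Field M] [NumberField M] [Algebra K M] {α : Kˣ} {σ : M ≃ₐ[K] M} {β : Mˣ}

lemma map_mem_Pv {W : Pl M} {x : Kˣ} (hx : x ∈ Pv p (dn K W)) :
    Units.map (algebraMap K M : K →* M) x ∈ Pv p W := by
  rw [mem_Pv] at hx ⊢
  intro N
  obtain ⟨_, ⟨c, rfl⟩, u, hu, rfl⟩ := Subgroup.mem_sup.1 (hx N)
  rw [map_mul, powMonoidHom_apply, map_pow]
  exact mul_mem (Subgroup.mem_sup_left ⟨_, rfl⟩) (Subgroup.mem_sup_right (algebraMap_mem_U hu))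

variable (p) in
/-- The elements that are `p`-th powers locally at all places of `T`. -/
def LP (T : Finset (Pl K)) : Subgroup Kˣ := ⨅ v ∈ T, Pv p v

lemma LP_eq (T : Finset (Pl K)) : LP p T = ⨅ v : T, Pv p v.1 := iInf_subtype'

lemma mem_LP {T : Finset (Pl K)} {x : Kˣ} : x ∈ LP p T ↔ ∀ v ∈ T, x ∈ Pv p v := by
  simp [LP, Subgroup.mem_iInf]

lemma index_LP_le (hp : p.Prime) (hζ : IsPrimitiveRoot ζ p) {T : Finset (Pl K)}
    (hT : ∀ v ∈ T, vl v (p : K) = 1) : (LP p T).index ≤ p ^ (2 * T.card) ∧ (LP p T).index ≠ 0 := by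
  obtain ⟨N, hN⟩ := exists_U_le_Pv hp hζ T
  rw [LP_eq, index_iInf_eq_prod T N (Pv p) hN]
  refine ⟨?_, Finset.prod_ne_zero_iff.2 fun v _ => index_Pv_ne_zero hp hζ v⟩
  rw [mul_comm, pow_mul']
  exact Finset.prod_le_pow_card _ _ _ fun v hv => index_Pv_le hp hζ (hT v hv)

namespace Kum

lemma exists_split_not_mem [IsTotallyComplex K] (h : Kum p ζ α σ β) {b : Kˣ}
    (hb : b ∉ Subgroup.zpowers α ⊔ Pw K p) (S₀ : Finset (Pl K)) :
    ∃ w ∉ S₀, vl w (p : K) = 1 ∧ α ∈ Pv p w ∧ b ∉ Pv p w := by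
  classical
  have := isTotallyComplex_of_algebra K M
  have hζM : IsPrimitiveRoot (Units.map (algebraMap K M : K →* M) ζ) p :=
    IsPrimitiveRoot.coe_units_iff.1 h.hζM
  have hbM : Units.map (algebraMap K M : K →* M) b ∉ Pw M p := by
    rintro ⟨y, hy⟩
    exact hb (h.mem_of_pow (y := y) (congrArg Units.val hy).symm)
  obtain ⟨M', _, _, _, σ', β', h'⟩ := exists_of_not_mem h.prime hζM hbM
  obtain ⟨S, hS₀, hS, hF⟩ := exists_good h.prime.ne_zero S₀ {α, b}
  obtain ⟨W, hW, hNS⟩ := h'.exists_NS (up M S)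
  rw [mem_up] at hW
  have hbW : Units.map (algebraMap K M : K →* M) b ∉ Pv p W := fun h1 => h'.not_NS_iff.2 h1 hNS
  refine ⟨dn K W, fun h1 => hW (hS₀ h1), hS.hp _ hW, ?_, fun h1 => hbW (map_mem_Pv h1)⟩
  by_contra hα
  have h1 := mem_zpowers_sup_Pv h.prime h.hζ (hS.hp _ hW) (mem_U_zero.2 (mem_SU.1 (hF α (by simp)) _ hW))
    (mem_U_zero.2 (mem_SU.1 (hF b (by simp)) _ hW)) hα
  obtain ⟨_, ⟨i, rfl⟩, c, hc, hbc⟩ := Subgroup.mem_sup.1 h1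
  apply hbW
  have h2 : Units.map (algebraMap K M : K →* M) α = β ^ p := Units.ext h.hα
  have h3 : Units.map (algebraMap K M : K →* M) b = (β ^ i) ^ p * Units.map (algebraMap K M : K →* M) c := by
    rw [← hbc, map_mul, map_zpow, h2, ← zpow_natCast, ← zpow_natCast, ← zpow_mul, ← zpow_mul, mul_comm i]
  rw [h3]
  exact mul_mem (Pw_le_Pv W ⟨β ^ i, rfl⟩) (map_mem_Pv hc)

lemma relIndex_B (h : Kum p ζ α σ β) {S : Finset (Pl K)} (hα : α ∈ SU (S : Set (Pl K))) :
    p * (Subgroup.zpowers α ⊔ Pw K p).relIndex (SU (S : Set (Pl K))) =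
      p ^ (S.card + Fintype.card (InfinitePlace K)) := by
  rw [← relIndex_Pw_SU h.prime h.hζ S]
  have h1 := relIndex_zpowers_sup_inf h.prime h.not_mem_Pw ⟨α, rfl⟩ hα
  have h2 := Subgroup.relIndex_inf_mul_relIndex (Pw K p) (Subgroup.zpowers α ⊔ Pw K p) (SU (S : Set (Pl K)))
  rw [h1, inf_eq_left.2 le_sup_right] at h2
  exact h2

lemma B_le_LP {T : Finset (Pl K)} (hT : ∀ w ∈ T, α ∈ Pv p w) : Subgroup.zpowers α ⊔ Pw K p ≤ LP p T :=
  sup_le (by rw [Subgroup.zpowers_le]; exact mem_LP.2 hT)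
    fun x hx => mem_LP.2 fun v _ => Pw_le_Pv v hx

lemma exists_T [IsTotallyComplex K] (h : Kum p ζ α σ β) {S : Finset (Pl K)}
    (hα : α ∈ SU (S : Set (Pl K))) (k : ℕ) (hk : k + 1 ≤ S.card + Fintype.card (InfinitePlace K)) :
    ∃ T : Finset (Pl K), T.card = k ∧ (∀ w ∈ T, w ∉ S) ∧ (∀ w ∈ T, α ∈ Pv p w) ∧
      (LP p T).relIndex (SU (S : Set (Pl K))) = p ^ k := by
  classical
  induction k with
  | zero =>
    refine ⟨∅, rfl, by simp, by simp, ?_⟩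
    have : LP p (∅ : Finset (Pl K)) = ⊤ := by simp [LP]
    rw [this, Subgroup.relIndex_top_left, pow_zero]
  | succ k ih =>
    obtain ⟨T, hTk, hTS, hTα, hTi⟩ := ih (by omega)
    have h1 : ¬ LP p T ⊓ SU (S : Set (Pl K)) ≤ Subgroup.zpowers α ⊔ Pw K p := fun hle => by
      have h2 := Subgroup.relIndex_le_of_le_left (L := SU (S : Set (Pl K))) hle (by
        rw [Subgroup.inf_relIndex_right, hTi]; exact pow_ne_zero _ h.prime.ne_zero)
      rw [Subgroup.inf_relIndex_right, hTi] at h2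
      have h3 := Nat.mul_le_mul_left p h2
      rw [h.relIndex_B hα, ← pow_succ'] at h3
      have h4 := (Nat.pow_le_pow_iff_right h.prime.one_lt).1 h3
      omega
    obtain ⟨b, hb, hbB⟩ := SetLike.not_le_iff_exists.1 h1
    obtain ⟨w, hw, hwp, hwα, hwb⟩ := h.exists_split_not_mem hbB (S ∪ T)
    rw [Finset.mem_union, not_or] at hw
    refine ⟨insert w T, by rw [Finset.card_insert_of_notMem hw.2, hTk], ?_, ?_, ?_⟩
    · intro v hv
      rcases Finset.mem_insert.1 hv with rfl | hv
      exacts [hw.1, hTS v hv]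
    · intro v hv
      rcases Finset.mem_insert.1 hv with rfl | hv
      exacts [hwα, hTα v hv]
    · have h2 : LP p (insert w T) = Pv p w ⊓ LP p T := Finset.iInf_insert w T _
      rw [h2, ← Subgroup.relIndex_inf_mul_relIndex, hTi, pow_succ']
      congr 1
      have h3 := relIndex_Pv_le h.prime h.hζ hwp (J := LP p T ⊓ SU (S : Set (Pl K)))
        (inf_le_right.trans ((SU_le_U_zero hw.1).trans le_sup_right))
      have h4 := le_relIndex_of_not_mem h.prime h3.2 (fun hle => hwb (hle hb)) fun x _ => Pw_le_Pv w ⟨x, rfl⟩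
      exact le_antisymm h3.1 (Nat.le_of_dvd (Nat.pos_of_ne_zero h3.2) h4)

lemma exists_T_mem_Pw [IsTotallyComplex K] (h : Kum p ζ α σ β) {S : Finset (Pl K)} (hS : Good p S)
    (hα : α ∈ SU (S : Set (Pl K))) [DecidableEq (Pl K)] :
    ∃ T : Finset (Pl K), T.card + 1 = S.card + Fintype.card (InfinitePlace K) ∧ Disjoint S T ∧
      (∀ w ∈ T, α ∈ Pv p w) ∧
      ∀ b ∈ SU ((S ∪ T : Finset (Pl K)) : Set (Pl K)), (∀ v ∈ S, b ∈ Pv p v) → b ∈ Pw K p := by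
  classical
  have hpos : 0 < Fintype.card (InfinitePlace K) := Fintype.card_pos
  obtain ⟨T, hTk, hTS, hTα, hTi⟩ := h.exists_T (S := S) hα (S.card + Fintype.card (InfinitePlace K) - 1) (by omega)
  have hTk' : T.card + 1 = S.card + Fintype.card (InfinitePlace K) := by omega
  have hdisj : Disjoint S T := Finset.disjoint_left.2 fun v hv hv' => hTS v hv' hv
  refine ⟨T, hTk', hdisj, hTα, ?_⟩
  have hB := B_le_LP hTα
  have hαH : α ∈ SU ((S ∪ T : Finset (Pl K)) : Set (Pl K)) :=
    SU_mono (Finset.coe_subset.2 Finset.subset_union_left) hα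
  have h1 : LP p T ⊓ SU (S : Set (Pl K)) ≤ Subgroup.zpowers α ⊔ Pw K p := by
    refine inf_le_of_relIndex_eq hB ?_ (by rw [hTi]; exact pow_ne_zero _ h.prime.ne_zero)
    refine Nat.eq_of_mul_eq_mul_left h.prime.pos ?_
    rw [h.relIndex_B hα, hTi, ← pow_succ']
    congr 1; omega
  have h2 : LP p T ⊓ SU ((S ∪ T : Finset (Pl K)) : Set (Pl K)) ≤ Subgroup.zpowers α ⊔ Pw K p := by
    rintro x ⟨hx1, hx2⟩
    have h3 : ∀ v : Pl K, ∃ n : ℤ, v ∈ T → vl v (x : K) = exp n ^ p := fun v => by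
      by_cases hv : v ∈ T
      · obtain ⟨_, ⟨c, rfl⟩, u, hu, rfl⟩ := Subgroup.mem_sup.1 (mem_Pv.1 (mem_LP.1 hx1 v hv) 0)
        refine ⟨lg v (Additive.ofMul c), fun _ => ?_⟩
        rw [Units.val_mul, map_mul, mem_U_zero.1 hu, mul_one, ← vl_eq_exp_lg, ← map_pow]
        rfl
      · exact ⟨0, fun h => absurd h hv⟩
    choose n hn using h3
    obtain ⟨c, hc, hc'⟩ := hS.cl.exists_of_finite T (fun v hv => by simpa using hTS v hv) n
    have h4 : x * (c ^ p)⁻¹ ∈ Subgroup.zpowers α ⊔ Pw K p := by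
      refine h1 (Subgroup.mem_inf.2 ⟨mul_mem hx1 (inv_mem (hB (Subgroup.mem_sup_right ⟨c, rfl⟩))), mem_SU.2 fun v hv => ?_⟩)
      rw [Units.val_mul, map_mul, Units.val_inv_eq_inv_val, map_inv₀, Units.val_pow_eq_pow_val, map_pow]
      by_cases hvT : v ∈ T
      · rw [hn v hvT, hc v hvT]
        exact mul_inv_cancel₀ (pow_ne_zero _ exp_ne_zero)
      · rw [hc' v hv hvT, one_pow, inv_one, mul_one]
        exact mem_SU.1 hx2 v (by simpa using ⟨by simpa using hv, hvT⟩)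
    have := mul_mem h4 (Subgroup.mem_sup_right (S := Subgroup.zpowers α) ⟨c, rfl⟩ : c ^ p ∈ Subgroup.zpowers α ⊔ Pw K p)
    rwa [inv_mul_cancel_right] at this
  have hTp : ∀ v ∈ T, vl v (p : K) = 1 := fun v hv => hS.hp v (hTS v hv)
  have h3 : SU ((S ∪ T : Finset (Pl K)) : Set (Pl K)) ⊔ LP p T = ⊤ := by
    have h4 := index_LP_le h.prime h.hζ hTp
    have h5 := Subgroup.relIndex_mul_index (le_sup_right : LP p T ≤ SU ((S ∪ T : Finset (Pl K)) : Set (Pl K)) ⊔ LP p T)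
    rw [Subgroup.relIndex_sup_right] at h5
    have h6 : (LP p T).relIndex (SU ((S ∪ T : Finset (Pl K)) : Set (Pl K))) = p ^ (2 * T.card) := by
      have h7 : (LP p T).relIndex (SU ((S ∪ T : Finset (Pl K)) : Set (Pl K))) =
          (Subgroup.zpowers α ⊔ Pw K p).relIndex (SU ((S ∪ T : Finset (Pl K)) : Set (Pl K))) := by
        rw [← Subgroup.inf_relIndex_right, ← Subgroup.inf_relIndex_right (Subgroup.zpowers α ⊔ Pw K p)]
        congr 1
        exact le_antisymm (le_inf h2 inf_le_right) (inf_le_inf_right _ hB)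
      refine Nat.eq_of_mul_eq_mul_left h.prime.pos ?_
      rw [h7, h.relIndex_B hαH, Finset.card_union_of_disjoint hdisj, ← pow_succ']
      congr 1; omega
    rw [h6] at h5
    rw [← h5] at h4
    have h8 : (SU ((S ∪ T : Finset (Pl K)) : Set (Pl K)) ⊔ LP p T).index ≤ 1 :=
      Nat.le_of_mul_le_mul_left (by rw [mul_one]; exact h4.1) (pow_pos h.prime.pos (2 * T.card))
    have h9 := right_ne_zero_of_mul h4.2
    rw [← Subgroup.index_eq_one]
    omega
  intro b hb hbS
  by_contra hbP
  obtain ⟨M', _, _, _, σ', β', h'⟩ := exists_of_not_mem h.prime h.hζ hbP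
  have h4 := h'.relIndex_SU_mul_le (hS.mono Finset.subset_union_left) hb
  set T' := (S ∪ T).filter (NS σ') with hT'
  have h5 : T' ⊆ T := fun v hv => by
    obtain ⟨hv1, hv2⟩ := Finset.mem_filter.1 hv
    rcases Finset.mem_union.1 hv1 with hv1 | hv1
    · exact absurd hv2 (h'.not_NS_iff.2 (hbS v hv1))
    · exact hv1
  have h6 := h'.pow_card_le_index (T := T') fun v hv => (Finset.mem_filter.1 hv).2
  have h7 : LP p T ≤ ⨅ v : T', NV M' v.1 := le_iInf fun v x hx =>
    Pv_le_NV h'.deg v.1 (mem_LP.1 hx v.1 (h5 v.2))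
  have h8 : SU ((S ∪ T : Finset (Pl K)) : Set (Pl K)) ⊔ ⨅ v : T', NV M' v.1 = ⊤ := by
    rw [eq_top_iff, ← h3]
    exact sup_le_sup_left h7 _
  have h9 : (Nm K (L := M')).range ≤ ⨅ v : T', NV M' v.1 := le_iInf fun v => Nm_le_NV v.1
  have h10 := Subgroup.relIndex_le_of_le_left h9 h4.2
  rw [relIndex_eq_index h8] at h10
  have h11 := Nat.mul_le_mul_right p (h6.1.trans h10)
  have h12 := h11.trans h4.1
  rw [← pow_succ] at h12
  have := (Nat.pow_le_pow_iff_right h.prime.one_lt).1 h12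
  omega

lemma main_index [IsTotallyComplex K] (h : Kum p ζ α σ β) {S : Finset (Pl K)} (hS : Good p S)
    (hα : α ∈ SU (S : Set (Pl K))) [DecidablePred (NS σ)] :
    (⨅ v : S.filter (NS σ), NV M v.1) ⊓ SU (S : Set (Pl K)) ≤ (Nm K (L := M)).range ∧
      (⨅ v : S.filter (NS σ), NV M v.1).index = p ^ (S.filter (NS σ)).card := by
  classical
  obtain ⟨T, hTk, hdisj, hTα, hT⟩ := h.exists_T_mem_Pw hS hα
  set H := SU ((S ∪ T : Finset (Pl K)) : Set (Pl K)) with hH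
  have hSH : SU (S : Set (Pl K)) ≤ H := SU_mono (Finset.coe_subset.2 Finset.subset_union_left)
  have h1 := h.relIndex_SU_mul_le (hS.mono Finset.subset_union_left) (hSH hα)
  have h2 : (S ∪ T).filter (fun v => NS σ v) = S.filter (NS σ) := by
    ext v
    simp only [Finset.mem_filter, Finset.mem_union]
    refine ⟨fun hv => ⟨hv.1.resolve_right fun hvT => ?_, hv.2⟩, fun hv => ⟨Or.inl hv.1, hv.2⟩⟩
    exact h.not_NS_iff.2 (hTα v hvT) hv.2
  set 𝒩 := ⨅ v : S.filter (NS σ), NV M v.1 with hNN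
  have h1' : (Nm K (L := M)).range.relIndex H * p ≤ p ^ (S.filter (NS σ)).card := by
    rw [← h2]; convert h1.1
  have h3 : LP p S ≤ 𝒩 := le_iInf fun v x hx =>
    Pv_le_NV h.deg v.1 (mem_LP.1 hx v.1 (Finset.mem_filter.1 v.2).1)
  have h4 := index_iInf_Pv_le h.prime h.hζ S
  rw [← LP_eq] at h4
  have h5 : (LP p S).relIndex H = p ^ (S.card + T.card + Fintype.card (InfinitePlace K)) := by
    rw [← Finset.card_union_of_disjoint hdisj, ← relIndex_Pw_SU h.prime h.hζ (S ∪ T), ← hH,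
      ← Subgroup.inf_relIndex_right, ← Subgroup.inf_relIndex_right (Pw K p)]
    congr 1
    exact le_antisymm (le_inf (fun x hx => hT x hx.2 (mem_LP.1 hx.1)) inf_le_right)
      (inf_le_inf_right _ fun x hx => mem_LP.2 fun v _ => Pw_le_Pv v hx)
  have hfin : Module.finrank ℚ K = 2 * Fintype.card (InfinitePlace K) := by
    rw [IsTotallyComplex.finrank, InfinitePlace.card_eq_nrRealPlaces_add_nrComplexPlaces,
      IsTotallyComplex.nrRealPlaces_eq_zero, zero_add]
  have h6 : (H ⊔ LP p S).index ≤ p ∧ (H ⊔ LP p S).index ≠ 0 := by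
    have h7 := Subgroup.relIndex_mul_index (le_sup_right : LP p S ≤ H ⊔ LP p S)
    rw [Subgroup.relIndex_sup_right, h5] at h7
    rw [← h7] at h4
    refine ⟨Nat.le_of_mul_le_mul_left (h4.1.trans_eq ?_) (pow_pos h.prime.pos (S.card + T.card + Fintype.card (InfinitePlace K))),
      right_ne_zero_of_mul h4.2⟩
    rw [← pow_succ, hfin]
    congr 1; omega
  have h7 : (H ⊔ 𝒩).index ≤ p := (Nat.le_of_dvd (Nat.pos_of_ne_zero h6.2)
    (Subgroup.index_dvd_of_le (sup_le_sup_left h3 H))).trans h6.1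
  have h8 := Subgroup.relIndex_mul_index (le_sup_right : 𝒩 ≤ H ⊔ 𝒩)
  rw [Subgroup.relIndex_sup_right] at h8
  have h9 : (Nm K (L := M)).range ≤ 𝒩 := le_iInf fun v => Nm_le_NV v.1
  have h10 := Subgroup.relIndex_le_of_le_left h9 h1.2
  have h11 := h.pow_card_le_index (T := S.filter (NS σ)) fun v hv => (Finset.mem_filter.1 hv).2
  have h12 := Nat.mul_le_mul_right p h10
  have h13 := Nat.mul_le_mul_left (𝒩.relIndex H) h7
  rw [h8] at h13
  have h14 : 𝒩.relIndex H = (Nm K (L := M)).range.relIndex H :=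
    le_antisymm h10 (Nat.le_of_mul_le_mul_right (h1'.trans (h11.1.trans h13)) h.prime.pos)
  refine ⟨fun x hx => inf_le_of_relIndex_eq h9 h14.symm (by rw [h14]; exact h1.2) ⟨hx.1, hSH hx.2⟩, ?_⟩
  exact le_antisymm (h13.trans (h12.trans h1')) h11.1

/-- The Hasse norm theorem for a Kummer extension of prime degree of a totally complex field. -/
theorem mem_Nm_range [IsTotallyComplex K] (h : Kum p ζ α σ β) {x : Kˣ} (hx : ∀ v, NS σ v → x ∈ NV M v) :
    x ∈ (Nm K (L := M)).range := by
  classical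
  obtain ⟨S, -, hS, hF⟩ := exists_good h.prime.ne_zero ∅ {α, x}
  refine (h.main_index hS (hF α (by simp))).1 ⟨?_, hF x (by simp)⟩
  exact Subgroup.mem_iInf.2 fun v => hx v.1 (Finset.mem_filter.1 v.2).2

/-- The local norm index of a nonsplit place is the degree. -/
theorem index_NV [IsTotallyComplex K] (h : Kum p ζ α σ β) {v : Pl K} (hv : NS σ v) : (NV M v).index = p := by
  classical
  obtain ⟨S, hvS, hS, hF⟩ := exists_good h.prime.ne_zero {v} {α}
  have h1 := (h.main_index hS (hF α (by simp))).2
  rw [h.index_iInf_NV] at h1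
  have h2 : ∀ w ∈ S.filter (NS σ), p ≤ (NV M w).index := fun w hw =>
    Nat.le_of_dvd (Nat.pos_of_ne_zero (h.index_NV_ne_zero w)) (h.dvd_index_NV (Finset.mem_filter.1 hw).2)
  rw [← Finset.prod_const] at h1
  have hvm : v ∈ S.filter (NS σ) := Finset.mem_filter.2 ⟨hvS (by simp), hv⟩
  by_contra hne
  refine (Finset.prod_lt_prod (fun w _ => h.prime.pos) h2 ⟨v, hvm, lt_of_le_of_ne (h2 v hvm) (Ne.symm hne)⟩).ne h1.symm

end Kum
end
end CyclicSchur

namespace CyclicSchur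
open NumberField IsDedekindDomain WithZero
open scoped WithZero

section
variable {G : Type*} [CommGroup G]

/-- The partial norm `x ↦ ∏_{i < m} sⁱ(x)`. -/
def pn (s : G →* G) (m : ℕ) : G →* G where
  toFun x := ∏ i ∈ Finset.range m, s^[i] x
  map_one' := by simp
  map_mul' x y := by simp [Finset.prod_mul_distrib, iterate_map_mul]

lemma pn_apply (s : G →* G) (m : ℕ) (x : G) : pn s m x = ∏ i ∈ Finset.range m, s^[i] x := rfl

lemma pn_succ (s : G →* G) (m : ℕ) (x : G) : pn s (m + 1) x = pn s m x * s^[m] x := Finset.prod_range_succ _ _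

lemma pn_zero (s : G →* G) (x : G) : pn s 0 x = 1 := rfl

lemma pn_succ' (s : G →* G) (m : ℕ) (x : G) : pn s (m + 1) x = x * s (pn s m x) := by
  rw [pn_apply, Finset.prod_range_succ', pn_apply, map_prod, mul_comm]
  simp [Function.iterate_succ_apply']

lemma map_pn (s : G →* G) (m : ℕ) (x : G) : s (pn s m x) = pn s m x * s^[m] x / x := by
  rw [← pn_succ, pn_succ', mul_div_cancel_left]

lemma pn_comm {H : Type*} [CommGroup H] {s : G →* G} {s' : H →* H} {g : G →* H} (h : ∀ x, g (s x) = s' (g x))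
    (m : ℕ) (x : G) : g (pn s m x) = pn s' m (g x) := by
  induction m with
  | zero => simp [pn_zero]
  | succ m ih => rw [pn_succ', pn_succ', map_mul, h, ih]

lemma pn_add (s : G →* G) (m k : ℕ) (x : G) : pn s (m + k) x = pn s m x * s^[m] (pn s k x) := by
  induction k with
  | zero => simp [pn_zero, iterate_map_one]
  | succ k ih => rw [← add_assoc, pn_succ, ih, pn_succ, iterate_map_mul, ← mul_assoc, Function.iterate_add_apply]

lemma pn_mul {s t : G →* G} {q : ℕ} (h : ∀ x, t x = s^[q] x) (m : ℕ) (x : G) :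
    pn s (q * m) x = pn s q (pn t m x) := by
  induction m with
  | zero => simp [pn_zero]
  | succ m ih =>
    have h1 : t^[m] x = s^[q * m] x := by
      rw [Function.iterate_mul]
      congr 1
      exact funext h
    have h2 : ∀ i, s^[i] (pn s q x) = pn s q (s^[i] x) := fun i => by
      induction i with
      | zero => rfl
      | succ i ih => rw [Function.iterate_succ_apply', Function.iterate_succ_apply', ih, pn_comm fun _ => rfl]
    rw [mul_add, mul_one, pn_add, ih, pn_succ, map_mul, h1, h2]

lemma iterate_eq_mul_pn {s : G →* G} {c w : G} (h : s c = c * w) (i : ℕ) : s^[i] c = c * pn s i w := by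
  induction i with
  | zero => simp [pn_zero]
  | succ i ih => rw [Function.iterate_succ_apply, h, iterate_map_mul, ih, pn_succ, mul_assoc]

lemma pn_mem {s : G →* G} {H : Subgroup G} (h : ∀ x ∈ H, s x ∈ H) {x : G} (hx : x ∈ H) (m : ℕ) : pn s m x ∈ H := by
  induction m with
  | zero => exact one_mem _
  | succ m ih => rw [pn_succ']; exact mul_mem hx (h _ ih)

end

section
variable {K L : Type} [Field K] [NumberField K] [Field L] [NumberField L] [Algebra K L]

lemma coe_sg_iterate (σ : L ≃ₐ[K] L) (i : ℕ) (x : Lˣ) : (((sg σ)^[i] x : Lˣ) : L) = (σ ^ i) x := by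
  induction i generalizing x with
  | zero => rfl
  | succ i ih => rw [Function.iterate_succ_apply, ih, pow_succ]; rfl

lemma sg_pow (σ : L ≃ₐ[K] L) (q : ℕ) (x : Lˣ) : sg (σ ^ q) x = (sg σ)^[q] x :=
  Units.ext (coe_sg_iterate σ q x).symm

lemma coe_pn_sg (σ : L ≃ₐ[K] L) (m : ℕ) (x : Lˣ) : ((pn (sg σ) m x : Lˣ) : L) = ∏ i ∈ Finset.range m, (σ ^ i) x := by
  rw [pn_apply, Units.coe_prod]
  exact Finset.prod_congr rfl fun i _ => coe_sg_iterate σ i x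

lemma pn_sg_eq_norm [IsGalois K L] {σ : L ≃ₐ[K] L} (hσ : ∀ τ, τ ∈ Subgroup.zpowers σ) (x : Lˣ) :
    pn (sg σ) (Module.finrank K L) x = Units.map (algebraMap K L : K →* L) (Nm K x) :=
  Units.ext ((coe_pn_sg _ _ _).trans (norm_eq_prod_pow hσ (x : L)).symm)

lemma sg_mem_U {σ : L ≃ₐ[K] L} {W : Pl L} (h : Inv σ W) {N : ℕ} {x : Lˣ} (hx : x ∈ U W N) : sg σ x ∈ U W N := by
  rw [mem_U] at hx ⊢
  rw [sg_apply, h, ← map_one σ, ← map_sub σ, h]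
  exact hx

lemma mem_U_of_algebraMap {W : Pl L} {N : ℕ} {x : Kˣ}
    (hx : Units.map (algebraMap K L : K →* L) x ∈ U W (rI K W * N)) : x ∈ U (dn K W) N := by
  obtain ⟨h1, h2⟩ := mem_U.1 hx
  change vl W (algebraMap K L x) = 1 at h1
  change vl W (algebraMap K L x - 1) ≤ _ at h2
  have he := (rI_pos (K := K) W).ne'
  rw [← map_one (algebraMap K L), ← map_sub (algebraMap K L), vl_algebraMap] at h2
  rw [vl_algebraMap] at h1
  refine mem_U.2 ⟨(pow_eq_one_iff_of_nonneg zero_le he).1 h1, ?_⟩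
  refine (pow_le_pow_iff_left₀ zero_le zero_le he).1 (h2.trans_eq ?_)
  rw [← exp_nsmul]
  congr 1
  simp

lemma exists_mul_exp_le (c : ℤᵐ⁰) (M : ℕ) : ∃ N : ℕ, c * exp (-(N : ℤ)) ≤ exp (-(M : ℤ)) := by
  by_cases hc : c = 0
  · exact ⟨0, by simp [hc]⟩
  refine ⟨(log c).toNat + M, ?_⟩
  rw [← exp_log hc, ← exp_add, exp_le_exp]
  have := Int.self_le_toNat (log c)
  push_cast
  rw [exp_log hc]
  omega

/-- An approximate version of Hilbert 90 for an automorphism admitting a Kummer generator. -/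
lemma exists_approx_div {τ : L ≃ₐ[K] L} {p : ℕ} (hp : p ≠ 0) {ζ : K} (hζ : IsPrimitiveRoot ζ p) {β : L} (hβ : β ≠ 0)
    (hτ : τ β = algebraMap K L ζ * β) (W : Pl L) (y : Lˣ) :
    ∃ z : Lˣ, vl W ((y * sg τ z * z⁻¹ : Lˣ) - 1 : L) ≤ (vl W (p : L))⁻¹ * vl W ((pn (sg τ) p y : Lˣ) - 1 : L) := by
  set c : ℕ → L := fun i => ((pn (sg τ) i y : Lˣ) : L) with hc
  set ω := algebraMap K L ζ with hω
  have hωp : IsPrimitiveRoot ω p := hζ.map_of_injective (algebraMap K L).injective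
  have hτβ : ∀ i : ℕ, (τ ^ i) β = ω ^ i * β := fun i => by
    induction i with
    | zero => simp
    | succ i ih =>
      rw [pow_succ', AlgEquiv.mul_apply, ih, map_mul, map_pow, hω, AlgEquiv.commutes, hτ, ← hω, pow_succ]; ring
  set Z : ℕ → L := fun j => ∑ i ∈ Finset.range p, c i * (τ ^ i) (β ^ j) with hZ
  have h1 : ∀ j, y * τ (Z j) = Z j + (c p - 1) * β ^ j := fun j => by
    have h2 : ∀ i, y * τ (c i * (τ ^ i) (β ^ j)) = c (i + 1) * (τ ^ (i + 1)) (β ^ j) := fun i => by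
      rw [map_mul, ← mul_assoc, pow_succ' τ, AlgEquiv.mul_apply]
      congr 1
      simp only [hc, pn_succ', Units.val_mul, sg_apply]
    rw [hZ]
    simp only [map_sum, Finset.mul_sum, h2]
    have h3 := Finset.sum_range_succ (fun i => c i * (τ ^ i) (β ^ j)) p
    rw [Finset.sum_range_succ'] at h3
    have h4 : (τ ^ p) (β ^ j) = β ^ j := by rw [map_pow, hτβ, hωp.pow_eq_one, one_mul]
    have h5 : c 0 = 1 := by simp [hc, pn_zero]
    rw [h4, h5, pow_zero, AlgEquiv.one_apply, one_mul] at h3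
    rw [sub_mul, one_mul]
    linear_combination h3
  have h2 : ∑ j ∈ Finset.range p, β⁻¹ ^ j * Z j = p := by
    simp only [hZ, Finset.mul_sum]
    rw [Finset.sum_comm]
    have h3 : ∀ i ∈ Finset.range p, ∑ j ∈ Finset.range p, β⁻¹ ^ j * (c i * (τ ^ i) (β ^ j)) = if i = 0 then (p : L) else 0 := by
      intro i hi
      have h4 : ∀ j ∈ Finset.range p, β⁻¹ ^ j * (c i * (τ ^ i) (β ^ j)) = c i * (ω ^ i) ^ j := fun j _ => by
        rw [map_pow, hτβ, mul_pow, inv_pow]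
        field_simp
      rw [Finset.sum_congr rfl h4, ← Finset.mul_sum]
      split_ifs with h0
      · subst h0
        simp [hc, pn_zero]
      · have h5 : ω ^ i ≠ 1 := hωp.pow_ne_one_of_pos_of_lt h0 (Finset.mem_range.1 hi)
        have h6 := mul_geom_sum (ω ^ i) p
        rw [← pow_mul, mul_comm i p, pow_mul, hωp.pow_eq_one, one_pow, sub_self] at h6
        rw [(mul_eq_zero.1 h6).resolve_left (sub_ne_zero.2 h5), mul_zero]
    rw [Finset.sum_congr rfl h3, Finset.sum_ite_eq' (Finset.range p), if_pos (Finset.mem_range.2 (Nat.pos_of_ne_zero hp))]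
  have hp0 : vl W (p : L) ≠ 0 := (vl W).ne_zero_iff.2 (Nat.cast_ne_zero.2 hp)
  obtain ⟨j, -, hj⟩ : ∃ j ∈ Finset.range p, vl W (p : L) ≤ vl W (β⁻¹ ^ j * Z j) := by
    by_contra! hcon
    have := (vl W).map_sum_lt hp0 hcon
    rw [h2] at this
    exact this.false
  have hZ0 : Z j ≠ 0 := fun h => by
    rw [h, mul_zero, map_zero] at hj
    exact hp0 (le_antisymm hj zero_le)
  refine ⟨Units.mk0 _ hZ0, ?_⟩
  have h3 : ((y * sg τ (Units.mk0 _ hZ0) * (Units.mk0 _ hZ0)⁻¹ : Lˣ) - 1 : L) = (c p - 1) * (β ^ j / Z j) := by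
    rw [Units.val_mul, Units.val_mul, sg_apply, Units.val_mk0, h1, Units.val_inv_eq_inv_val, Units.val_mk0]
    field_simp
    ring
  have h4 : vl W (β ^ j / Z j) ≤ (vl W (p : L))⁻¹ := by
    have h5 : β ^ j / Z j = (β⁻¹ ^ j * Z j)⁻¹ := by simp [div_eq_mul_inv, mul_comm]
    rw [h5, map_inv₀]
    exact inv_anti₀ (zero_lt_iff.2 hp0) hj
  rw [h3, map_mul, mul_comm]
  gcongr

end

section
variable {K M L : Type} [Field K] [NumberField K] [Field M] [NumberField M] [Field L] [NumberField L] [Algebra K L]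
  [Algebra K M] [Algebra M L] [IsScalarTower K M L]

lemma dn_dn (W : Pl L) : dn K (dn M W) = dn K W := by
  refine dn_eq_iff.2 fun x => ?_
  rw [dn_eq_iff.1 (rfl : dn K W = dn K W), IsScalarTower.algebraMap_apply K M L, ← dn_eq_iff.1 (rfl : dn M W = dn M W)]

lemma Inv.dn {σ : L ≃ₐ[K] L} {ρ : M ≃ₐ[K] M} (hρ : ∀ x, σ (algebraMap M L x) = algebraMap M L (ρ x)) {W : Pl L}
    (h : Inv σ W) : Inv ρ (CyclicSchur.dn M W) := fun x => by
  refine (pow_left_inj₀ zero_le zero_le (rI_pos (K := M) W).ne').1 ?_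
  rw [← vl_algebraMap, ← vl_algebraMap, ← hρ, h]

lemma exists_eigenvector [IsGalois K M] {ρ : M ≃ₐ[K] M} (hρ : ∀ τ, τ ∈ Subgroup.zpowers ρ) {ζ : K}
    (hζ : ζ ^ Module.finrank K M = 1) : ∃ β : Mˣ, ρ β = algebraMap K M ζ * β := by
  have : IsCyclic (M ≃ₐ[K] M) := ⟨ρ, hρ⟩
  have h1 : Algebra.norm K (algebraMap K M ζ⁻¹) = 1 := by
    rw [Algebra.norm_algebraMap, inv_pow, hζ, inv_one]
  obtain ⟨y, hy⟩ := groupCohomology.exists_div_of_norm_eq_one hρ h1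
  have h0 : ρ (y : M) ≠ 0 := (map_ne_zero ρ).2 y.ne_zero
  have hz : algebraMap K M ζ ≠ 0 := (map_ne_zero _).2 fun h => by
    rw [h, zero_pow Module.finrank_pos.ne'] at hζ
    exact zero_ne_one hζ
  refine ⟨y, ?_⟩
  rw [div_eq_iff h0, map_inv₀] at hy
  exact ((eq_inv_mul_iff_mul_eq₀ hz).1 hy).symm

lemma nonnorm_inv [IsGalois K L] [IsGalois K M] {p q : ℕ} (hp : p.Prime) {σ : L ≃ₐ[K] L}
    (hσ : ∀ τ, τ ∈ Subgroup.zpowers σ) (hL : Module.finrank K L = q * p) {ρ : M ≃ₐ[K] M} (hρ : ∀ τ, τ ∈ Subgroup.zpowers ρ)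
    (hM : Module.finrank K M = p) (hρσ : ∀ x, σ (algebraMap M L x) = algebraMap M L (ρ x))
    {ζ : Kˣ} (hζ : IsPrimitiveRoot ζ p) {β : L} (hβ : β ≠ 0) (hτ : (σ ^ q) β = algebraMap K L ζ * β)
    {W : Pl L} (hW : Inv σ W) :
    ∃ (b : Kˣ) (N : ℕ), ∀ x : Lˣ, (Units.map (algebraMap K L : K →* L) b)⁻¹ * pn (sg (σ ^ q)) p x ∉ U W N := by
  set τ := σ ^ q with hτdef
  set mp : Kˣ →* Lˣ := Units.map (algebraMap K L : K →* L) with hmp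
  have hζ' := IsPrimitiveRoot.coe_units_iff.2 hζ
  obtain ⟨β₁, hβ₁⟩ := exists_eigenvector hρ (ζ := (ζ : K)) (by rw [hM, hζ'.pow_eq_one])
  obtain ⟨N₀, hN₀⟩ := exists_NN_ne_top hp hM hρ hζ β₁.ne_zero hβ₁ (hW.dn hρσ)
  set v := dn K W with hv
  set N' := N₀ + 1 with hN'
  have hb := hN₀ N' (by omega)
  rw [dn_dn] at hb
  obtain ⟨b, -, hb⟩ := SetLike.exists_of_lt (lt_top_iff_ne_top.2 hb)
  set m := rI K W * N' with hm
  have hm0 : m ≠ 0 := mul_ne_zero (rI_pos W).ne' (by omega)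
  have hn0 : ((Module.finrank K L : ℕ) : L) ≠ 0 := Nat.cast_ne_zero.2 Module.finrank_pos.ne'
  obtain ⟨m', hm'⟩ := exists_mul_exp_le (vl W ((Module.finrank K L : ℕ) : L))⁻¹ m
  obtain ⟨N₁, hN₁⟩ := exists_mul_exp_le (vl W (p : L))⁻¹ (m' + 1)
  refine ⟨b, N₁ + m, fun x hx => hb ?_⟩
  have hsb : ∀ c : Kˣ, sg σ (mp c) = mp c := fun c => Units.ext (σ.commutes _)
  have htb : ∀ c : Kˣ, sg τ (mp c) = mp c := fun c => Units.ext (τ.commutes _)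
  have hst : ∀ y, sg τ y = (sg σ)^[q] y := sg_pow σ q
  have hcom : ∀ y, sg σ (sg τ y) = sg τ (sg σ y) := fun y => by
    rw [hst, hst, ← Function.iterate_succ_apply' (sg σ), Function.iterate_succ_apply]
  obtain ⟨u, hu⟩ : ∃ u, (mp b)⁻¹ * pn (sg τ) p x = u := ⟨_, rfl⟩
  rw [hu] at hx
  have hpx : pn (sg τ) p x = mp b * u := by rw [← hu, mul_inv_cancel_left]
  obtain ⟨y, hy⟩ : ∃ y, y = sg σ x * x⁻¹ := ⟨_, rfl⟩
  have hpy : pn (sg τ) p y = sg σ u * u⁻¹ := by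
    rw [hy, map_mul, map_inv, ← pn_comm hcom, hpx, map_mul, hsb, mul_inv]
    rw [mul_mul_mul_comm, mul_inv_cancel, one_mul]
  have hyU : pn (sg τ) p y ∈ U W (N₁ + m) := hpy ▸ mul_mem (sg_mem_U hW hx) (inv_mem hx)
  obtain ⟨z, hz⟩ := exists_approx_div hp.ne_zero hζ' hβ hτ W y
  obtain ⟨w, hw⟩ : ∃ w, y * sg τ z * z⁻¹ = w := ⟨_, rfl⟩
  rw [hw] at hz
  have hwU : w ∈ U W (m' + 1) := by
    refine mem_U_of_sub (by omega) (hz.trans (le_trans ?_ hN₁))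
    gcongr
    refine (mem_U.1 hyU).2.trans ?_
    rw [exp_le_exp]
    push_cast
    omega
  obtain ⟨c', hc'⟩ : ∃ c', c' = x * pn (sg σ) q z := ⟨_, rfl⟩
  have hsc : sg σ c' = c' * w := by
    rw [hc', map_mul, map_pn, ← hst, ← hw, hy, div_eq_mul_inv]
    have : x * pn (sg σ) q z * (sg σ x * x⁻¹ * sg τ z * z⁻¹) = x * x⁻¹ * (sg σ x * (pn (sg σ) q z * sg τ z * z⁻¹)) := by
      simp only [mul_comm, mul_left_comm, mul_assoc]
    rw [this, mul_inv_cancel, one_mul]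
  have hg : ∀ g : L ≃ₐ[K] L, vl W (g c' / c' - 1) ≤ exp (-(m' : ℤ)) := fun g => by
    obtain ⟨i, rfl⟩ := mem_powers_iff_mem_zpowers.2 (hσ g)
    have h1 : (σ ^ i) (c' : L) / c' = (pn (sg σ) i w : Lˣ) := by
      rw [← coe_sg_iterate, iterate_eq_mul_pn hsc, Units.val_mul, mul_div_cancel_left₀ _ c'.ne_zero]
    change vl W ((σ ^ i) (c' : L) / c' - 1) ≤ _
    rw [h1]
    exact (mem_U.1 (U_anti (Nat.le_succ m') (pn_mem (fun _ => sg_mem_U hW) hwU i))).2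
  obtain ⟨c, hc⟩ : ∃ c : K, vl W (algebraMap K L c / c' - 1) ≤ exp (-(m : ℤ)) := by
    refine ⟨Algebra.trace K L c' / (Module.finrank K L : ℕ), ?_⟩
    have h1 : algebraMap K L (Algebra.trace K L c' / (Module.finrank K L : ℕ)) / c' - 1
        = ((Module.finrank K L : ℕ) : L)⁻¹ * ∑ g : L ≃ₐ[K] L, (g c' / c' - 1) := by
      have hc0 := c'.ne_zero
      rw [Finset.sum_sub_distrib, ← Finset.sum_div, ← trace_eq_sum_automorphisms, Finset.sum_const, Finset.card_univ,
        ← Nat.card_eq_fintype_card, IsGalois.card_aut_eq_finrank, map_div₀, map_natCast, nsmul_one]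
      field_simp
    rw [h1, map_mul, map_inv₀]
    refine le_trans ?_ hm'
    gcongr
    exact (vl W).map_sum_le fun g _ => hg g
  have hc0 : algebraMap K L c ≠ 0 := fun h => by
    rw [h, zero_div, zero_sub, (vl W).map_neg, map_one] at hc
    exact absurd hc (not_le.2 (by rw [← exp_zero, exp_lt_exp]; omega))
  obtain ⟨cu, hcu⟩ : ∃ cu : Kˣ, (cu : K) = c := ⟨Units.mk0 c fun h => hc0 (by rw [h, map_zero]), rfl⟩
  obtain ⟨e, he⟩ : ∃ e, c'⁻¹ * mp cu = e := ⟨_, rfl⟩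
  have heU : e ∈ U W m := by
    refine mem_U_of_sub hm0 (le_of_eq_of_le ?_ hc)
    rw [← he, ← hcu, Units.val_mul, Units.val_inv_eq_inv_val, div_eq_inv_mul]
    rfl
  have h1 : pn (sg τ) p c' = mp b * u * mp (Nm K z) := by
    rw [hc', map_mul, hpx, ← pn_comm (g := pn (sg σ) q) (s := sg τ) (s' := sg τ)
      (fun a => (pn_comm (g := sg τ) (fun y => (hcom y).symm) q a).symm), ← pn_mul hst, ← hL, pn_sg_eq_norm hσ]
  have h2 : pn (sg τ) p c' * pn (sg τ) p e = mp cu ^ p := by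
    rw [← map_mul, ← he, mul_inv_cancel_left, pn_apply, Finset.prod_congr rfl fun i _ => Function.iterate_fixed (htb cu) i,
      Finset.prod_const, Finset.card_range]
  have h3 : mp (b * (Nm K z * (cu ^ p)⁻¹)) = (pn (sg τ) p e * u)⁻¹ := by
    have h4 : mp b * u * mp (Nm K z) * pn (sg τ) p e = mp b * mp (Nm K z) * (pn (sg τ) p e * u) := by ac_rfl
    rw [map_mul, map_mul, map_inv, map_pow, ← h2, h1, h4, mul_inv, ← mul_assoc, mul_inv_cancel_left]
  have hτW : Inv τ W := hW.pow q
  have h4 : b * (Nm K z * (cu ^ p)⁻¹) ∈ U v N' := by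
    refine mem_U_of_algebraMap (L := L) (h3 ▸ inv_mem (mul_mem (pn_mem (fun _ => sg_mem_U hτW) heU p) (U_anti ?_ hx)))
    omega
  have h5 : Nm K z * (cu ^ p)⁻¹ ∈ (Nm K (L := M)).range := by
    refine mul_mem ⟨Nm M z, Units.ext Algebra.norm_norm⟩ (inv_mem ⟨Units.map (algebraMap K M : K →* M) cu, ?_⟩)
    refine Units.ext ((Algebra.norm_algebraMap (cu : K)).trans ?_)
    rw [hM, Units.val_pow_eq_pow_val]
  have h6 : b = (Nm K z * (cu ^ p)⁻¹)⁻¹ * (b * (Nm K z * (cu ^ p)⁻¹)) := by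
    rw [mul_comm b, inv_mul_cancel_left]
  rw [h6]
  exact Subgroup.mul_mem_sup (inv_mem h5) h4

end
end CyclicSchur

namespace CyclicSchur
open NumberField IsDedekindDomain WithZero
open scoped WithZero

section
variable {K L : Type} [Field K] [NumberField K] [Field L] [NumberField L] [Algebra K L]

lemma fixedField_aux (τ : L ≃ₐ[K] L) :
    IsGalois (IntermediateField.fixedField (Subgroup.zpowers τ)) L ∧
    Module.finrank (IntermediateField.fixedField (Subgroup.zpowers τ)) L = orderOf τ ∧
    (∀ x : L, τ x = x → x ∈ IntermediateField.fixedField (Subgroup.zpowers τ)) ∧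
    ∃ τ' : L ≃ₐ[IntermediateField.fixedField (Subgroup.zpowers τ)] L, (∀ x, τ' x = τ x) ∧
      ∀ g, g ∈ Subgroup.zpowers τ' := by
  set D := IntermediateField.fixedField (Subgroup.zpowers τ) with hD
  have hcard : Module.finrank D L = orderOf τ := by
    rw [IntermediateField.finrank_fixedField_eq_card, Nat.card_zpowers]
  have hfix : IntermediateField.fixingSubgroup D = Subgroup.zpowers τ := IntermediateField.fixingSubgroup_fixedField _
  have hmem : ∀ x : L, τ x = x → x ∈ D := fun x hx => by
    rintro ⟨g, i, rfl⟩
    have h1 : τ ∈ MulAction.stabilizer (L ≃ₐ[K] L) x := hx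
    exact zpow_mem h1 i
  have hτ : τ ∈ IntermediateField.fixingSubgroup D := hfix ▸ Subgroup.mem_zpowers τ
  refine ⟨?_, hcard, hmem, IntermediateField.fixingSubgroupEquiv D ⟨τ, hτ⟩, fun x => rfl, fun g => ?_⟩
  · refine IsGalois.of_card_aut_eq_finrank D L ?_
    rw [← Nat.card_congr (IntermediateField.fixingSubgroupEquiv D).toEquiv, hcard, hfix, Nat.card_zpowers]
  · obtain ⟨⟨g, hg⟩, rfl⟩ := (IntermediateField.fixingSubgroupEquiv D).surjective g
    rw [hfix] at hg
    obtain ⟨i, rfl⟩ := hg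
    exact ⟨i, by simp only; rw [← map_zpow]; congr 1⟩

lemma exists_fixed (τ : L ≃ₐ[K] L) : ∃ (D : Type) (_ : Field D) (_ : NumberField D) (_ : Algebra K D) (_ : Algebra D L)
    (_ : IsScalarTower K D L) (τ' : L ≃ₐ[D] L), IsGalois D L ∧ Module.finrank D L = orderOf τ ∧
      (∀ x : L, τ x = x → x ∈ Set.range (algebraMap D L)) ∧ (∀ x, τ' x = τ x) ∧ ∀ g, g ∈ Subgroup.zpowers τ' := by
  obtain ⟨h1, h2, h3, τ', h4, h5⟩ := fixedField_aux τ
  have : NumberField (IntermediateField.fixedField (Subgroup.zpowers τ)) := NumberField.of_module_finite K _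
  exact ⟨IntermediateField.fixedField (Subgroup.zpowers τ), inferInstance, inferInstance, inferInstance, inferInstance,
    inferInstance, τ', h1, h2, fun x hx => ⟨⟨x, h3 x hx⟩, rfl⟩, h4, h5⟩

lemma exists_mid [IsGalois K L] {σ : L ≃ₐ[K] L} (hσ : ∀ τ, τ ∈ Subgroup.zpowers σ) {p m : ℕ} (hm : m ≠ 0)
    (hL : Module.finrank K L = p * m) :
    ∃ (M : Type) (_ : Field M) (_ : NumberField M) (_ : Algebra K M) (_ : Algebra M L)
    (_ : IsScalarTower K M L) (σ' : L ≃ₐ[M] L) (ρ : M ≃ₐ[K] M), IsGalois M L ∧ IsGalois K M ∧ Module.finrank M L = m ∧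
      Module.finrank K M = p ∧ (∀ x, σ' x = (σ ^ p) x) ∧ (∀ g, g ∈ Subgroup.zpowers σ') ∧
      (∀ x, σ (algebraMap M L x) = algebraMap M L (ρ x)) ∧ ∀ g, g ∈ Subgroup.zpowers ρ := by
  set M := IntermediateField.fixedField (Subgroup.zpowers (σ ^ p)) with hM
  obtain ⟨h1, h2, h3, σ', h4, h5⟩ := fixedField_aux (σ ^ p)
  have : NumberField M := NumberField.of_module_finite K _
  have hn : (Subgroup.zpowers (σ ^ p)).Normal := ⟨by
    rintro _ ⟨i, rfl⟩ g
    obtain ⟨j, rfl⟩ := hσ g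
    refine ⟨i, ?_⟩
    simp only
    rw [← zpow_natCast, ← zpow_mul, ← zpow_add, ← zpow_neg, ← zpow_add]
    congr 1
    ring⟩
  have hg : IsGalois K M := IsGalois.of_fixedField_normal_subgroup _
  have hfin : Module.finrank M L = m := by
    have hp : p ≠ 0 := fun h => by
      rw [h, zero_mul] at hL
      exact Module.finrank_pos.ne' hL
    rw [h2, orderOf_pow' _ hp, orderOf_gen hσ, hL, Nat.gcd_mul_right_left, Nat.mul_div_cancel_left _ (Nat.pos_of_ne_zero hp)]
  have hfin' : Module.finrank K M = p := by
    have := Module.finrank_mul_finrank K M L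
    rw [hfin, hL] at this
    exact Nat.eq_of_mul_eq_mul_right (Nat.pos_of_ne_zero hm) this
  refine ⟨M, inferInstance, inferInstance, inferInstance, inferInstance, inferInstance, σ', AlgEquiv.restrictNormal σ M, h1, hg,
    hfin, hfin', h4, h5, fun x => (AlgEquiv.restrictNormal_commutes σ M x).symm, fun g => ?_⟩
  obtain ⟨g, rfl⟩ := AlgEquiv.restrictNormalHom_surjective (F := K) (K₁ := M) L g
  obtain ⟨i, rfl⟩ := hσ g
  refine ⟨i, ?_⟩
  simp only
  rw [map_zpow]
  rfl

lemma exists_eigenvector_pow [IsGalois K L] {σ : L ≃ₐ[K] L} (hσ : ∀ τ, τ ∈ Subgroup.zpowers σ) {p q : ℕ} (hp : p ≠ 0)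
    (hL : Module.finrank K L = q * p) {ζ : K} (hζ : ζ ^ p = 1) :
    ∃ β : Lˣ, (σ ^ q) β = algebraMap K L ζ * β := by
  obtain ⟨M, _, _, _, _, _, σ', ρ, h1, h2, h3, h4, h5, h6, h7, h8⟩ := exists_mid hσ hp hL
  obtain ⟨β, hβ⟩ := exists_eigenvector h6 (ζ := algebraMap K M ζ) (by rw [h3, ← map_pow, hζ, map_one])
  exact ⟨β, by rw [← h5, hβ, ← IsScalarTower.algebraMap_apply]⟩

/-- If an automorphism in the decomposition group generates the minimal subgroup of order `p` of a cyclic Galois group of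
`p`-power order, then some element of the base field is not locally a norm. -/
lemma exists_not_near_norm {p : ℕ} (hp : p.Prime) (k : ℕ) : ∀ {K L : Type} [Field K] [NumberField K] [Field L] [NumberField L]
    [Algebra K L] [IsGalois K L] {σ : L ≃ₐ[K] L} (_ : ∀ τ, τ ∈ Subgroup.zpowers σ)
    (_ : Module.finrank K L = p ^ (k + 1)) {ζ : Kˣ} (_ : IsPrimitiveRoot ζ p) {W : Pl L} (_ : Inv (σ ^ p ^ k) W),
    ∃ (b : Kˣ) (N : ℕ), ∀ x : Lˣ,
      (Units.map (algebraMap K L : K →* L) b)⁻¹ * pn (sg (σ ^ p ^ k)) p x ∉ U W N := by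
  induction k with
  | zero =>
    intro K L _ _ _ _ _ _ σ hσ hL ζ hζ W hW
    have hζ' := IsPrimitiveRoot.coe_units_iff.2 hζ
    obtain ⟨β, hβ⟩ := exists_eigenvector_pow hσ (p := p) (q := p ^ 0) hp.ne_zero (by rw [hL]; ring) hζ'.pow_eq_one
    obtain ⟨M, _, _, _, _, _, σ', ρ, h1, h2, h3, h4, h5, h6, h7, h8⟩ := exists_mid (p := p) (m := p ^ 0) hσ (by simp) (by rw [hL]; ring)
    rw [pow_zero, pow_one] at hW
    exact nonnorm_inv hp hσ (by rw [hL]; ring) h8 h4 h7 hζ β.ne_zero hβ hW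
  | succ k ih =>
    intro K L _ _ _ _ _ _ σ hσ hL ζ hζ W hW
    have hζ' := IsPrimitiveRoot.coe_units_iff.2 hζ
    obtain ⟨M, _, _, _, _, _, σ', ρ, h1, h2, h3, h4, h5, h6, h7, h8⟩ := exists_mid (p := p) (m := p ^ (k + 1)) hσ
      (pow_ne_zero _ hp.ne_zero) (by rw [hL]; ring)
    by_cases hI : Inv σ W
    · obtain ⟨β, hβ⟩ := exists_eigenvector_pow hσ (p := p) (q := p ^ (k + 1)) hp.ne_zero (by rw [hL]; ring) hζ'.pow_eq_one
      exact nonnorm_inv hp hσ (by rw [hL]; ring) h8 h4 h7 hζ β.ne_zero hβ hI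
    have hσ'pow : ∀ i x, (σ' ^ i) x = (σ ^ (p * i)) x := fun i x => by
      induction i generalizing x with
      | zero => rfl
      | succ i ih => rw [pow_succ, AlgEquiv.mul_apply, ih, h5, mul_add, mul_one, pow_add, AlgEquiv.mul_apply]
    have hnot : ¬ Inv ρ (dn M W) := fun hρ => hI <| by
      have e1 : dn M W = dn M (tr (σ : L ≃+* L) W) := by
        refine (dn_eq_iff.2 fun x => ?_).symm
        have e2 : algebraMap M L x = σ (algebraMap M L (ρ⁻¹ x)) := by
          rw [h7]; exact congrArg _ (ρ.apply_symm_apply x).symm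
        rw [e2]
        have e3 := vl_tr (σ : L ≃+* L) W (algebraMap M L (ρ⁻¹ x))
        change vl _ (σ (algebraMap M L (ρ⁻¹ x))) = _ at e3
        rw [e3, ← dn_eq_iff.1 (rfl : dn M W = dn M W), hρ.symm]
      obtain ⟨g, hg⟩ := exists_tr_eq e1
      obtain ⟨i, rfl⟩ := mem_powers_iff_mem_zpowers.2 (h6 g)
      set m : ℤ := ((p * i : ℕ) : ℤ) with hm
      have hh : Inv (σ ^ (m - 1)) W := fun x => by
        have e3 := vl_sg σ W ((σ ^ (m - 1)) x)
        have e4 := vl_sg (σ' ^ i) W x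
        simp only at hg
        rw [hg, hσ'pow] at e4
        rw [← e3, ← e4, ← AlgEquiv.mul_apply, ← zpow_one_add, add_sub_cancel, hm, zpow_natCast]
      refine hh.of_mem ?_
      obtain ⟨c, hc⟩ := sub_dvd_pow_sub_pow m 1 (k + 1 + 1)
      refine ⟨-c, ?_⟩
      simp only
      rw [one_pow] at hc
      have e5 : σ ^ (m ^ (k + 1 + 1)) = 1 := by
        rw [hm, ← Nat.cast_pow, zpow_natCast, mul_pow, ← hL, pow_mul, ← orderOf_gen hσ, pow_orderOf_eq_one, one_pow]
      rw [← zpow_mul, mul_neg, ← hc, neg_sub, sub_eq_add_neg, zpow_add, zpow_neg, e5, inv_one, mul_one, zpow_one]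
    obtain ⟨-, he, hf⟩ := split_of_not_inv hp h4 hnot
    have hpow : ∀ x, (σ' ^ p ^ k) x = (σ ^ p ^ (k + 1)) x := fun x => by rw [hσ'pow, pow_succ']
    obtain ⟨b, N, hb⟩ := ih h6 h3 (ζ := Units.map (algebraMap K M : K →* M) ζ)
      (hζ.map_of_injective (Units.map_injective (algebraMap K M).injective)) (W := W) fun x => by rw [hpow, hW]
    obtain ⟨N', hN'⟩ := exists_mul_exp_le (vl (dn M W) (b : M))⁻¹ (N + 1)
    obtain ⟨c, hc⟩ := exists_approx he hf (b : M) N'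
    have hc' : vl (dn M W) ((b : M)⁻¹ * algebraMap K M c - 1) ≤ exp (-((N + 1 : ℕ) : ℤ)) := by
      refine le_trans ?_ hN'
      have : (b : M)⁻¹ * algebraMap K M c - 1 = (b : M)⁻¹ * (algebraMap K M c - b) := by
        rw [mul_sub, inv_mul_cancel₀ b.ne_zero]
      rw [this, map_mul, map_inv₀, Valuation.map_sub_swap]
      gcongr
    have hc0 : c ≠ 0 := fun h => by
      rw [h, map_zero, mul_zero, zero_sub, Valuation.map_neg, map_one] at hc'
      exact absurd hc' (not_le.2 (by rw [← exp_zero, exp_lt_exp]; omega))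
    have hsg : sg (σ' ^ p ^ k) = sg (σ ^ p ^ (k + 1)) := MonoidHom.ext fun x => Units.ext (hpow x)
    refine ⟨Units.mk0 c hc0, N, fun x hx => hb x ?_⟩
    have h9 : b⁻¹ * Units.map (algebraMap K M : K →* M) (Units.mk0 c hc0) ∈ U (dn M W) N :=
      U_anti (Nat.le_succ N) (mem_U_of_sub (by omega) (by simpa using hc'))
    have h10 := mul_mem (algebraMap_mem_U (M := L) h9) hx
    rw [hsg]
    convert h10 using 1
    have h11 : Units.map (algebraMap M L : M →* L) (Units.map (algebraMap K M : K →* M) (Units.mk0 c hc0)) =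
        Units.map (algebraMap K L : K →* L) (Units.mk0 c hc0) :=
      Units.ext (IsScalarTower.algebraMap_apply K M L c).symm
    rw [map_mul, map_inv, h11, mul_assoc, mul_inv_cancel_left]

end
end CyclicSchur

namespace CyclicSchur
open NumberField IsDedekindDomain WithZero
open scoped WithZero

section
variable {K : Type} [Field K] [NumberField K]

lemma isTotallyComplex_of_forall (h : ∀ _ : K →+* ℝ, False) : IsTotallyComplex K :=
  ⟨fun v => by
    by_contra hv
    exact h (InfinitePlace.embedding_of_isReal (InfinitePlace.not_isComplex_iff_isReal.1 hv))⟩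

lemma isTotallyComplex_of_root {p : ℕ} (hp : p.Prime) (hp2 : p ≠ 2) {ζ : Kˣ} (hζ : IsPrimitiveRoot ζ p) :
    IsTotallyComplex K := by
  refine isTotallyComplex_of_forall fun φ => ?_
  have h1 : φ ζ ^ p = 1 := by
    rw [← map_pow, (IsPrimitiveRoot.coe_units_iff.2 hζ).pow_eq_one, map_one]
  have h2 : φ ζ = 1 := (Odd.strictMono_pow (hp.odd_of_ne_two hp2)).injective (h1.trans (one_pow p).symm)
  have h3 : (ζ : K) = 1 := φ.injective (h2.trans (map_one φ).symm)
  exact (IsPrimitiveRoot.coe_units_iff.2 hζ).ne_one hp.one_lt h3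

lemma vl_natCast_le_one (v : Pl K) (n : ℕ) : vl v (n : K) ≤ 1 := by
  simpa using vl_int_le_one v n

lemma exists_natCast_lt_one (v : Pl K) : ∃ l : ℕ, 1 < l ∧ vl v (l : K) < 1 := by
  refine ⟨resCard v, one_lt_resCard v, ?_⟩
  have h1 : Ideal.Quotient.mk v.asIdeal ((resCard v : ℕ) : 𝓞 K) = Ideal.Quotient.mk v.asIdeal 0 := by
    rw [map_natCast, map_zero]
    have := Fintype.ofFinite (𝓞 K ⧸ v.asIdeal)
    have := Nat.cast_card_eq_zero (𝓞 K ⧸ v.asIdeal)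
    rwa [← Nat.card_eq_fintype_card] at this
  have h2 := (vl_int_lt_iff _ _).1 h1
  rw [show (((resCard v : ℕ) : 𝓞 K) : K) = (resCard v : ℕ) from map_natCast (algebraMap (𝓞 K) K) _,
    show ((0 : 𝓞 K) : K) = 0 from map_zero (algebraMap (𝓞 K) K), sub_zero] at h2
  exact h2

lemma pow_le_exp_neg {c : ℤᵐ⁰} (hc : c < 1) (n : ℕ) : c ^ n ≤ exp (-(n : ℤ)) := by
  refine (pow_le_pow_left₀ zero_le ((lt_one_iff_le_exp c).1 hc) n).trans_eq ?_
  rw [← exp_nsmul]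
  congr 1
  simp

end

section
variable {K M : Type} [Field K] [NumberField K] [Field M] [NumberField M] [Algebra K M]
  {ζ α : Kˣ} {σ : M ≃ₐ[K] M} {β : Mˣ}

lemma Kum.algebraMap_norm (h : Kum 2 ζ α σ β) (s t : K) :
    Algebra.norm K (algebraMap K M s + algebraMap K M t * β) = s ^ 2 - α * t ^ 2 := by
  have := h.isGalois
  have hζ : (ζ : K) = -1 := (IsPrimitiveRoot.coe_units_iff.2 h.hζ).eq_neg_one_of_two_right
  apply (algebraMap K M).injective
  rw [norm_eq_prod_pow h.gen, h.deg, Finset.prod_range_succ, Finset.prod_range_one, pow_zero, pow_one, AlgEquiv.one_apply,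
    map_add σ, map_mul σ, σ.commutes, σ.commutes, h.hσ, hζ]
  simp only [map_sub, map_mul, map_pow, map_neg, map_one, h.hα]
  ring

lemma Kum.exists_eq_add (h : Kum 2 ζ α σ β) (z : M) : ∃ s t : K, z = algebraMap K M s + algebraMap K M t * β := by
  have hζ : (ζ : K) = -1 := (IsPrimitiveRoot.coe_units_iff.2 h.hζ).eq_neg_one_of_two_right
  have hβ : σ (β : M) = -β := by rw [h.hσ, hζ, map_neg, map_one, neg_one_mul]
  have h2 : σ (σ z) = z := by
    have h3 := h.orderOf_eq.1
    have : σ ^ 2 = 1 := by rw [← h3, pow_orderOf_eq_one]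
    rw [pow_two] at this
    exact DFunLike.congr_fun this z
  have hb := β.ne_zero
  obtain ⟨s, hs⟩ := h.mem_range (x := (z + σ z) / 2) (by rw [map_div₀, map_add, h2, map_ofNat, add_comm])
  obtain ⟨t, ht⟩ := h.mem_range (x := (z - σ z) / (2 * β)) (by
    rw [map_div₀, map_sub, h2, map_mul, map_ofNat, hβ]
    field_simp
    ring)
  refine ⟨s, t, ?_⟩
  rw [hs, ht]
  field_simp
  ring

lemma mem_Pv_of_map {p : ℕ} {W : Pl M} (he : rI K W = 1) (hf : rD K W = 1) {x : Kˣ}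
    (hx : Units.map (algebraMap K M : K →* M) x ∈ Pv p W) : x ∈ Pv p (dn K W) := by
  refine mem_Pv.2 fun N => ?_
  obtain ⟨_, ⟨c, rfl⟩, u, hu, hcu⟩ := Subgroup.mem_sup.1 (mem_Pv.1 hx N)
  obtain ⟨N', hN'⟩ := exists_mul_exp_le (vl W (c : M))⁻¹ (N + 1)
  obtain ⟨d, hd⟩ := exists_approx he hf (c : M) N'
  have hd' : vl W ((c : M)⁻¹ * algebraMap K M d - 1) ≤ exp (-((N + 1 : ℕ) : ℤ)) := by
    refine le_trans ?_ hN'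
    have : (c : M)⁻¹ * algebraMap K M d - 1 = (c : M)⁻¹ * (algebraMap K M d - c) := by
      rw [mul_sub, inv_mul_cancel₀ c.ne_zero]
    rw [this, map_mul, map_inv₀, Valuation.map_sub_swap]
    gcongr
  have hd0 : d ≠ 0 := fun h => by
    rw [h, map_zero, mul_zero, zero_sub, Valuation.map_neg, map_one] at hd'
    exact absurd hd' (not_le.2 (by rw [← exp_zero, exp_lt_exp]; omega))
  obtain ⟨d', hdd⟩ : ∃ d' : Kˣ, d' = Units.mk0 d hd0 := ⟨_, rfl⟩
  have h1 : c⁻¹ * Units.map (algebraMap K M : K →* M) d' ∈ U W N :=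
    U_anti (Nat.le_succ N) (mem_U_of_sub (by omega) (by simpa [hdd] using hd'))
  have h2 : Units.map (algebraMap K M : K →* M) ((d' ^ p)⁻¹ * x) ∈ U W N := by
    have h3 := mul_mem (inv_mem (pow_mem h1 p)) hu
    convert h3 using 1
    rw [map_mul, ← hcu, map_inv, map_pow, mul_pow, mul_inv, inv_pow, inv_inv, powMonoidHom_apply]
    ac_rfl
  rw [algebraMap_mem_U_iff he] at h2
  rw [← mul_inv_cancel_left (d' ^ p) x]
  exact mul_mem (Subgroup.mem_sup_left ⟨_, rfl⟩) (Subgroup.mem_sup_right h2)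

lemma Kum.mem_NV_of_map {E E₂ : Type} [Field E] [NumberField E] [Field E₂] [NumberField E₂] [Algebra K E] [Algebra E E₂]
    {ζ' : Eˣ} {σ₂ : E₂ ≃ₐ[E] E₂} {β₂ : E₂ˣ} (h : Kum 2 ζ α σ β)
    (h₂ : Kum 2 ζ' (Units.map (algebraMap K E : K →* E) α) σ₂ β₂) {W : Pl E} (he : rI K W = 1) (hf : rD K W = 1) {x : Kˣ}
    (hx : Units.map (algebraMap K E : K →* E) x ∈ NV E₂ W) : x ∈ NV M (dn K W) := by
  refine mem_NV.2 fun N => ?_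
  obtain ⟨_, ⟨z, rfl⟩, u, hu, hzu⟩ := Subgroup.mem_sup.1 (mem_NV.1 hx N)
  obtain ⟨s, t, hst⟩ := h₂.exists_eq_add (z : E₂)
  set a := algebraMap K E α with ha
  have hD : ((Nm E z : Eˣ) : E) = s ^ 2 - a * t ^ 2 := by
    change Algebra.norm E (z : E₂) = _
    rw [hst, h₂.algebraMap_norm]
    rfl
  set D := ((Nm E z : Eˣ) : E) with hDdef
  have hD0 : D ≠ 0 := Units.ne_zero _
  obtain ⟨n, hn⟩ := exists_mul_exp_le ((vl W D)⁻¹ * max (max (vl W (2 * s)) 1) (vl W a * max (vl W (2 * t)) 1)) (N + 1)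
  obtain ⟨s₀, hs₀⟩ := exists_approx he hf s n
  obtain ⟨t₀, ht₀⟩ := exists_approx he hf t n
  rw [Valuation.map_sub_swap] at hs₀ ht₀
  set δ := algebraMap K E s₀ - s with hδ
  set ε := algebraMap K E t₀ - t with hε
  set D₀ := s₀ ^ 2 - α * t₀ ^ 2 with hD₀
  have h1 : algebraMap K E D₀ - D = (2 * s + δ) * δ - (a * (2 * t + ε)) * ε := by
    rw [hD₀, map_sub, map_mul, map_pow, map_pow, hD, ← ha]
    ring
  have h2 : vl W (D⁻¹ * algebraMap K E D₀ - 1) ≤ exp (-((N + 1 : ℕ) : ℤ)) := by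
    refine le_trans ?_ hn
    have : D⁻¹ * algebraMap K E D₀ - 1 = D⁻¹ * (algebraMap K E D₀ - D) := by rw [mul_sub, inv_mul_cancel₀ hD0]
    rw [this, map_mul, map_inv₀, mul_assoc, h1]
    gcongr
    refine (vl W).map_sub_le ?_ ?_
    · rw [map_mul]
      gcongr
      exact le_max_of_le_left (((vl W).map_add _ _).trans (max_le_max_left _ (hs₀.trans (exp_neg_le_one n))))
    · rw [map_mul, map_mul]
      gcongr
      refine le_max_of_le_right ?_
      gcongr
      exact ((vl W).map_add _ _).trans (max_le_max_left _ (ht₀.trans (exp_neg_le_one n)))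
  have hz0 : algebraMap K M s₀ + algebraMap K M t₀ * β ≠ 0 := fun h0 => by
    have h3 := h.algebraMap_norm s₀ t₀
    rw [h0, Algebra.norm_zero, ← hD₀] at h3
    rw [← h3, map_zero, mul_zero, zero_sub, Valuation.map_neg, map_one] at h2
    exact absurd h2 (not_le.2 (by rw [← exp_zero, exp_lt_exp]; omega))
  obtain ⟨z₀, hz₀⟩ : ∃ z₀ : Mˣ, z₀ = Units.mk0 _ hz0 := ⟨_, rfl⟩
  have h3 : ((Nm K z₀ : Kˣ) : K) = D₀ := by
    rw [hz₀]
    exact h.algebraMap_norm s₀ t₀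
  have h4 : (Nm E z)⁻¹ * Units.map (algebraMap K E : K →* E) (Nm K z₀) ∈ U W N := by
    refine U_anti (Nat.le_succ N) (mem_U_of_sub (by omega) (le_of_eq_of_le ?_ h2))
    rw [← h3, Units.val_mul, Units.val_inv_eq_inv_val]
    rfl
  have h5 : Units.map (algebraMap K E : K →* E) ((Nm K z₀)⁻¹ * x) ∈ U W N := by
    have h6 := mul_mem (inv_mem h4) hu
    convert h6 using 1
    rw [map_mul, ← hzu, map_inv, mul_inv, inv_inv]
    ac_rfl
  rw [algebraMap_mem_U_iff he] at h5
  rw [← mul_inv_cancel_left (Nm K z₀) x]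
  exact mul_mem (Subgroup.mem_sup_left ⟨_, rfl⟩) (Subgroup.mem_sup_right h5)

lemma Kum.index_NV_two (h : Kum 2 ζ α σ β) {v : Pl K} (hv : NS σ v) : (NV M v).index = 2 := by
  obtain ⟨N, hN⟩ := exists_exp_lt_natCast_pow (K := K) Nat.prime_two v
  have hN := hN (N + 1) (by omega)
  obtain ⟨l, hl, hlv⟩ := exists_natCast_lt_one v
  have hneg : ∀ (F : Type) [Field F] [NumberField F] (c : F), c ^ 2 = 1 - (l : F) ^ (N + 1) → IsTotallyComplex F := by
    intro F _ _ c hc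
    refine isTotallyComplex_of_forall fun φ => ?_
    have h1 := congrArg φ hc
    rw [map_pow, map_sub, map_one, map_pow, map_natCast] at h1
    have h2 : (1 : ℝ) < (l : ℝ) ^ (N + 1) := one_lt_pow₀ (by exact_mod_cast hl) (by omega)
    nlinarith [sq_nonneg (φ c)]
  have hd0 : (1 : K) - (l : K) ^ (N + 1) ≠ 0 := by
    rw [sub_ne_zero, ← Nat.cast_pow, ← Nat.cast_one, Ne, Nat.cast_inj]
    exact (Nat.one_lt_pow (by omega) hl).ne
  obtain ⟨d, hd⟩ : ∃ d : Kˣ, (d : K) = 1 - (l : K) ^ (N + 1) := ⟨Units.mk0 _ hd0, rfl⟩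
  by_cases hdP : d ∈ Pw K 2
  · obtain ⟨c, hc⟩ := hdP
    have := hneg K c (by rw [← hd, ← hc]; rfl)
    exact h.index_NV hv
  obtain ⟨E, _, _, _, σE, βE, hE⟩ := exists_of_not_mem Nat.prime_two h.hζ hdP
  have hEt : IsTotallyComplex E := hneg E βE (by rw [← hE.hα, hd, map_sub, map_one, map_pow, map_natCast])
  have hdv : d ∈ Pv 2 v := by
    rw [Pv_eq Nat.prime_two h.hζ hN]
    refine Subgroup.mem_sup_right (mem_U_of_sub (by omega) ?_)
    rw [hd, sub_sub_cancel_left, Valuation.map_neg, map_pow]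
    exact pow_le_exp_neg hlv _
  obtain ⟨W, rfl⟩ := exists_up E v
  have := hE.isGalois
  have hnW : ¬ Inv σE W := fun hW => hE.not_NS_iff.2 hdv ⟨W, rfl, hW⟩
  obtain ⟨-, he, hf⟩ := split_of_not_inv Nat.prime_two hE.deg hnW
  have hα : Units.map (algebraMap K E : K →* E) α ∉ Pv 2 W := fun hα => h.not_NS_iff.2 (mem_Pv_of_map he hf hα) hv
  obtain ⟨M₂, _, _, _, σ₂, β₂, h₂⟩ := exists_of_not_mem Nat.prime_two
    (hE.hζ.map_of_injective (Units.map_injective (algebraMap K E).injective)) fun hP => hα (Pw_le_Pv W hP)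
  have h₃ : (NV M₂ W).index = 2 := h₂.index_NV (not_not.1 fun hns => hα (h₂.not_NS_iff.1 hns))
  have h₄ : (NV M₂ W).comap (Units.map (algebraMap K E : K →* E)) ≤ NV M (dn K W) := fun x hx =>
    h.mem_NV_of_map h₂ he hf hx
  have h₅ := h.dvd_index_NV hv
  have h₆ := Subgroup.index_dvd_of_le h₄
  have h₇ : ((NV M₂ W).comap (Units.map (algebraMap K E : K →* E))).index ∣ 2 := by
    rw [Subgroup.index_comap, ← h₃]
    exact Subgroup.relIndex_dvd_index_of_normal _ _
  exact Nat.dvd_antisymm (h₆.trans h₇) h₅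

lemma Kum.index_NV' {p : ℕ} (h : Kum p ζ α σ β) {v : Pl K} (hv : NS σ v) : (NV M v).index = p := by
  by_cases hp : p = 2
  · subst hp
    exact h.index_NV_two hv
  · have := isTotallyComplex_of_root h.prime hp h.hζ
    exact h.index_NV hv

lemma Kum.mem_zpowers_sup_NV {p : ℕ} (h : Kum p ζ α σ β) {v : Pl K} (hv : NS σ v) {b : Kˣ} (hb : b ∉ NV M v) (x : Kˣ) :
    x ∈ Subgroup.zpowers b ⊔ NV M v := by
  have h1 : (Subgroup.zpowers b ⊔ NV M v).index ∣ p := h.index_NV' hv ▸ Subgroup.index_dvd_of_le le_sup_right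
  have h2 : (Subgroup.zpowers b ⊔ NV M v).index ≠ p := fun h3 => by
    have h4 := Subgroup.relIndex_mul_index (le_sup_right : NV M v ≤ Subgroup.zpowers b ⊔ NV M v)
    rw [h3, h.index_NV' hv, Nat.mul_eq_right h.prime.ne_zero, Subgroup.relIndex_eq_one] at h4
    exact hb (h4 (Subgroup.mem_sup_left (Subgroup.mem_zpowers b)))
  rw [Subgroup.index_eq_one.1 (((Nat.dvd_prime h.prime).1 h1).resolve_right h2)]
  trivial

end
end CyclicSchur

namespace CyclicSchur
open NumberField IsDedekindDomain WithZero
open scoped WithZero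

section
variable {K : Type} [Field K] [NumberField K]

lemma exists_vl_natCast_lt_one {m : ℕ} (hm : 1 < m) : ∃ v : Pl K, vl v (m : K) < 1 := by
  have hu : ¬ IsUnit (m : 𝓞 K) := fun h => by
    have h1 := h.map (Algebra.norm ℤ)
    rw [show (m : 𝓞 K) = algebraMap ℤ (𝓞 K) (m : ℤ) by simp, Algebra.norm_algebraMap] at h1
    have h2 := (isUnit_pow_iff (Module.finrank_pos (R := ℤ) (M := 𝓞 K)).ne').1 h1
    rw [Int.isUnit_iff] at h2
    lia
  obtain ⟨I, hI, hmI⟩ := exists_max_ideal_of_mem_nonunits (mem_nonunits_iff.2 hu)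
  have hm0 : (m : 𝓞 K) ≠ 0 := by
    rw [Nat.cast_ne_zero]; lia
  refine ⟨⟨I, hI.isPrime, fun h => hm0 (by rwa [h] at hmI)⟩, ?_⟩
  rw [show (m : K) = ((m : 𝓞 K) : K) from (map_natCast (algebraMap (𝓞 K) K) m).symm]
  exact (HeightOneSpectrum.valuation_lt_one_iff_mem _ _).2 hmI

lemma exists_natCast_forall_lt_one (S : Finset (Pl K)) : ∃ m : ℕ, 1 < m ∧ ∀ v ∈ S, vl v (m : K) < 1 := by
  classical
  induction S using Finset.induction_on with
  | empty => exact ⟨2, by lia, by simp⟩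
  | insert v S _ ih =>
    obtain ⟨m, hm, h⟩ := ih
    obtain ⟨l, hl, h'⟩ := exists_natCast_lt_one v
    refine ⟨m * l, by nlinarith, fun w hw => ?_⟩
    rw [Nat.cast_mul, map_mul]
    rcases Finset.mem_insert.1 hw with rfl | hw
    · exact mul_lt_one_of_nonneg_of_lt_one_right (vl_natCast_le_one _ _) zero_le h'
    · exact mul_lt_one_of_nonneg_of_lt_one_left zero_le (h _ hw) (vl_natCast_le_one _ _)

lemma exists_place_notMem (S : Finset (Pl K)) : ∃ v : Pl K, v ∉ S := by
  obtain ⟨m, hm, h⟩ := exists_natCast_forall_lt_one S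
  obtain ⟨v, hv⟩ := exists_vl_natCast_lt_one (K := K) (m := m + 1) (by lia)
  refine ⟨v, fun hvS => ?_⟩
  have := (vl v).map_sub_lt hv (h v hvS)
  simp at this

lemma weak_approx_neg {S : Finset (Pl K)} (hS : S.Nonempty) {N : ℕ} (hN : N ≠ 0) (x : Pl K → Kˣ) :
    ∃ y : Kˣ, (∀ v ∈ S, (x v)⁻¹ * y ∈ U v N) ∧ ∀ φ : K →+* ℝ, φ y < 0 := by
  obtain ⟨y, hy⟩ := weak_approx S N x
  obtain ⟨m, hm, hmS⟩ := exists_natCast_forall_lt_one S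
  have h1 : ∀ᶠ j : ℕ in Filter.atTop, ∀ v ∈ S, vl v ((x v : K)⁻¹ * (m : K) ^ j) ≤ exp (-(N : ℤ)) := by
    rw [Filter.eventually_all_finset]
    intro v hv
    obtain ⟨j, hj⟩ := exists_mul_exp_le (vl v (x v : K)⁻¹) N
    filter_upwards [Filter.eventually_ge_atTop j] with i hi
    rw [map_mul, map_pow]
    refine le_trans (mul_le_mul_right ((pow_le_exp_neg (hmS v hv) i).trans ?_) _) hj
    rw [exp_le_exp]
    lia
  have : Finite (K →+* ℝ) := Finite.of_equiv _ (RingHom.equivRatAlgHom (R := K) (S := ℝ)).symm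
  have h2 : ∀ᶠ j : ℕ in Filter.atTop, ∀ φ : K →+* ℝ, φ y < (m : ℝ) ^ j := by
    rw [Filter.eventually_all]
    intro φ
    exact (tendsto_pow_atTop_atTop_of_one_lt (by exact_mod_cast hm)).eventually_gt_atTop (φ y)
  obtain ⟨j, hj1, hj2⟩ := (h1.and h2).exists
  have h3 : ∀ v ∈ S, vl v ((x v : K)⁻¹ * (y - (m : K) ^ j) - 1) ≤ exp (-(N : ℤ)) := fun v hv => by
    rw [show (x v : K)⁻¹ * (y - (m : K) ^ j) - 1 = (((x v)⁻¹ * y : Kˣ) - 1 : K) - (x v : K)⁻¹ * (m : K) ^ j by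
      push_cast; ring]
    exact (vl v).map_sub_le (hy v hv).2 (hj1 v hv)
  have h4 : (y : K) - (m : K) ^ j ≠ 0 := fun h => by
    obtain ⟨v, hv⟩ := hS
    have := h3 v hv
    rw [h, mul_zero, zero_sub, Valuation.map_neg, map_one, ← exp_zero, exp_le_exp] at this
    lia
  refine ⟨Units.mk0 _ h4, fun v hv => mem_U_of_sub hN ?_, fun φ => ?_⟩
  · simpa using h3 v hv
  · rw [Units.val_mk0, map_sub, map_pow, map_natCast]
    exact sub_neg.2 (hj2 φ)
end

section
variable {K L : Type} [Field K] [NumberField K] [Field L] [NumberField L] [Algebra K L]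

lemma mem_U_tr {g : L ≃ₐ[K] L} {W : Pl L} {N : ℕ} {z : Lˣ} :
    sg g z ∈ U (tr (g : L ≃+* L) W) N ↔ z ∈ U W N := by
  rw [mem_U, mem_U, sg_apply, vl_sg, ← map_one g, ← map_sub g, vl_sg, map_one]

variable [IsGalois K L]

lemma commute_gen {σ : L ≃ₐ[K] L} (hσ : ∀ τ, τ ∈ Subgroup.zpowers σ) (g h : L ≃ₐ[K] L) : g * h = h * g := by
  obtain ⟨i, rfl⟩ := hσ g
  obtain ⟨j, rfl⟩ := hσ h
  simp only [← zpow_add, add_comm]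

lemma exists_not_near_norm_place {p : ℕ} (hp : p.Prime) (k : ℕ) {σ : L ≃ₐ[K] L}
    (hσ : ∀ τ, τ ∈ Subgroup.zpowers σ) (hL : Module.finrank K L = p ^ (k + 1)) {ζ : Kˣ}
    (hζ : IsPrimitiveRoot ζ p) (v : Pl K) :
    ∃ (b : Kˣ) (N : ℕ), ∀ W : Pl L, dn K W = v → Inv (σ ^ p ^ k) W → ∀ x : Lˣ,
      (Units.map (algebraMap K L : K →* L) b)⁻¹ * pn (sg (σ ^ p ^ k)) p x ∉ U W N := by
  by_cases h : ∃ W : Pl L, dn K W = v ∧ Inv (σ ^ p ^ k) W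
  · obtain ⟨W₀, h1, h2⟩ := h
    obtain ⟨b, N, hb⟩ := exists_not_near_norm hp k hσ hL hζ h2
    refine ⟨b, N, fun W hW _ x hx => ?_⟩
    obtain ⟨g, rfl⟩ := exists_tr_eq (h1.trans hW.symm)
    refine hb (sg g⁻¹ x) (mem_U_tr (g := g).1 ?_)
    convert hx using 1
    rw [map_mul, map_inv]
    have e1 : sg g (Units.map (algebraMap K L : K →* L) b) = Units.map (algebraMap K L : K →* L) b := by
      ext; exact g.commutes _
    have e2 : sg g (sg g⁻¹ x) = x := by ext; exact g.apply_symm_apply _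
    rw [e1, pn_comm (s' := sg (σ ^ p ^ k)) (g := sg g), e2]
    intro x
    ext; exact DFunLike.congr_fun (commute_gen hσ g (σ ^ p ^ k)) (x : L)
  · exact ⟨1, 0, fun W h1 h2 => (h ⟨W, h1, h2⟩).elim⟩

lemma mem_range_of_fixed {σ : L ≃ₐ[K] L} (hσ : ∀ τ, τ ∈ Subgroup.zpowers σ) {x : L} (hx : σ x = x) :
    ∃ c, algebraMap K L c = x := by
  refine (IsGalois.mem_range_algebraMap_iff_fixed (F := K) x).2 fun f => ?_
  have : Subgroup.zpowers σ ≤ MulAction.stabilizer (L ≃ₐ[K] L) x := by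
    rw [Subgroup.zpowers_le]; exact hx
  exact this (hσ f)

lemma exists_eq_of_pow_eq {p : ℕ} (hp : p ≠ 0) {σ : L ≃ₐ[K] L} (hσ : ∀ τ, τ ∈ Subgroup.zpowers σ) {ζ : Kˣ}
    (hζ : IsPrimitiveRoot ζ p) {β : Lˣ} (hβ : σ β = algebraMap K L ζ * β) {b : K} {θ : Lˣ}
    (h : algebraMap K L b = θ ^ p) : ∃ (i : ℕ) (c : K), (θ : L) = algebraMap K L c * β ^ i := by
  have := NeZero.mk hp
  have hζL : IsPrimitiveRoot (algebraMap K L ζ) p :=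
    (IsPrimitiveRoot.coe_units_iff.2 hζ).map_of_injective (algebraMap K L).injective
  obtain ⟨i, -, hi⟩ := hζL.eq_pow_of_pow_eq_one (ξ := σ θ / θ) (by
    rw [div_pow, ← map_pow, ← h, AlgEquiv.commutes, h, div_self (pow_ne_zero _ θ.ne_zero)])
  obtain ⟨c, hc⟩ := mem_range_of_fixed hσ (x := θ / (β : L) ^ i) (by
    rw [map_div₀, map_pow, hβ, mul_pow, hi]
    field_simp)
  exact ⟨i, c, by rw [hc]; field_simp⟩

lemma exists_neg_not_near_norm {p : ℕ} (hp : p.Prime) (k : ℕ) {σ : L ≃ₐ[K] L}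
    (hσ : ∀ τ, τ ∈ Subgroup.zpowers σ) (hL : Module.finrank K L = p ^ (k + 1)) {ζ : Kˣ}
    (hζ : IsPrimitiveRoot ζ p) (S : Finset (Pl K)) :
    ∃ b : Kˣ, (∀ φ : K →+* ℝ, φ b < 0) ∧ Units.map (algebraMap K L : K →* L) b ∉ Pw L p ∧
      ∃ N, ∀ W : Pl L, dn K W ∈ S → Inv (σ ^ p ^ k) W → ∀ x : Lˣ,
        (Units.map (algebraMap K L : K →* L) b)⁻¹ * pn (sg (σ ^ p ^ k)) p x ∉ U W N := by
  classical
  have hζ1 : (ζ : K) ^ p = 1 := by rw [← Units.val_pow_eq_pow_val, hζ.pow_eq_one, Units.val_one]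
  obtain ⟨β, hβ⟩ := exists_eigenvector hσ (ζ := (ζ : K)) (by rw [hL, pow_succ', pow_mul, hζ1, one_pow])
  obtain ⟨γ, hγ⟩ := mem_range_of_fixed hσ (x := (β : L) ^ p) (by
    rw [map_pow, hβ, mul_pow, ← map_pow, hζ1, map_one, one_mul])
  have hγ0 : γ ≠ 0 := by
    rintro rfl
    rw [map_zero] at hγ
    exact pow_ne_zero p β.ne_zero hγ.symm
  obtain ⟨v₁, hv₁⟩ := exists_place_notMem (S ∪ (finite_support (Units.mk0 γ hγ0)).toFinset)
  rw [Finset.mem_union, not_or] at hv₁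
  have hvγ : vl v₁ γ = 1 := by simpa using hv₁.2
  choose b N hbN using exists_not_near_norm_place hp k hσ hL hζ
  obtain ⟨π, hπ⟩ := exists_unif v₁
  obtain ⟨y, hy, hneg⟩ := weak_approx_neg (Finset.insert_nonempty v₁ S) (Nat.succ_ne_zero (S.sup N))
    (Function.update b v₁ π)
  refine ⟨y, hneg, ?_, S.sup N + 1, fun W hW hinv x hx => ?_⟩
  · rintro ⟨θ, hθ⟩
    obtain ⟨i, c, hc⟩ := exists_eq_of_pow_eq hp.ne_zero hσ hζ hβ (b := y) (θ := θ)
      (by simpa using (congrArg Units.val hθ).symm)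
    have h1 : (y : K) = c ^ p * γ ^ i := by
      apply (algebraMap K L).injective
      have h2 : algebraMap K L y = (θ : L) ^ p := by simpa using (congrArg Units.val hθ).symm
      rw [h2, hc, map_mul, map_pow, map_pow, hγ]
      ring
    have h3 := (hy v₁ (Finset.mem_insert_self _ _)).1
    rw [Function.update_self, Units.val_mul, map_mul, Units.val_inv_eq_inv_val, map_inv₀, hπ,
      inv_mul_eq_one₀ (by simp), h1, map_mul, map_pow, map_pow, hvγ, one_pow, mul_one] at h3
    have hc0 : c ≠ 0 := by
      rintro rfl
      rw [map_zero, zero_pow hp.ne_zero] at h3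
      simp at h3
    obtain ⟨n, hn⟩ := exists_ord v₁ c hc0
    rw [hn, ← exp_nsmul, exp_inj, nsmul_eq_mul] at h3
    have := Int.isUnit_iff.1 (IsUnit.of_mul_eq_one (a := (p : ℤ)) (-n) (by linarith))
    have := hp.two_le
    lia
  · have hne : dn K W ≠ v₁ := fun h => hv₁.1 (h ▸ hW)
    have h1 := hy _ (Finset.mem_insert_of_mem hW)
    rw [Function.update_of_ne hne] at h1
    refine hbN _ W rfl hinv x (U_anti ((Finset.le_sup (f := N) hW).trans (Nat.le_succ _)) ?_)
    convert mul_mem (algebraMap_mem_U h1) hx using 1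
    rw [map_mul, map_inv]
    group
end
end CyclicSchur

namespace CyclicSchur
open NumberField IsDedekindDomain WithZero
open scoped WithZero

section
variable {K L : Type} [Field K] [NumberField K] [Field L] [NumberField L] [Algebra K L]

lemma exists_lift {p : ℕ} (hp : p.Prime) {b : Kˣ} (hb : Units.map (algebraMap K L : K →* L) b ∉ Pw L p)
    (σ : L ≃ₐ[K] L) :
    ∃ (E : Type) (_ : Field E) (_ : NumberField E) (_ : Algebra K E) (_ : Algebra L E) (_ : IsScalarTower K L E)
      (σ₁ : E ≃ₐ[K] E) (θ : Eˣ), Module.finrank L E = p ∧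
      (∀ x, σ₁ (algebraMap L E x) = algebraMap L E (σ x)) ∧ σ₁ θ = θ ∧ (θ : E) ^ p = algebraMap K E b ∧
      orderOf σ₁ = orderOf σ := by
  have hirr : Irreducible (Polynomial.X ^ p - Polynomial.C (algebraMap K L b)) :=
    X_pow_sub_C_irreducible_of_prime hp fun c hc => hb ⟨Units.mk0 c (by
      rintro rfl
      rw [zero_pow hp.ne_zero, eq_comm, map_eq_zero] at hc
      exact b.ne_zero hc), Units.ext (by simpa using hc)⟩
  have := Fact.mk hirr
  set f := Polynomial.X ^ p - Polynomial.C (algebraMap K L b) with hf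
  have hmonic : f.Monic := Polynomial.monic_X_pow_sub_C _ hp.ne_zero
  have : CharZero (AdjoinRoot f) := charZero_of_injective_algebraMap (algebraMap L (AdjoinRoot f)).injective
  have hfin : FiniteDimensional L (AdjoinRoot f) := hmonic.finite_adjoinRoot
  have : FiniteDimensional ℚ (AdjoinRoot f) := FiniteDimensional.trans ℚ L (AdjoinRoot f)
  have : FiniteDimensional K (AdjoinRoot f) := FiniteDimensional.trans K L (AdjoinRoot f)
  have hroot : AdjoinRoot.root f ^ p = algebraMap K (AdjoinRoot f) b := by
    have h1 := AdjoinRoot.eval₂_root f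
    rw [hf, Polynomial.eval₂_sub, Polynomial.eval₂_C, Polynomial.eval₂_pow, Polynomial.eval₂_X, sub_eq_zero] at h1
    rw [IsScalarTower.algebraMap_apply K L (AdjoinRoot f)]
    exact h1
  have hr0 : AdjoinRoot.root f ≠ 0 := fun h => by
    rw [h, zero_pow hp.ne_zero, eq_comm, map_eq_zero] at hroot
    exact b.ne_zero hroot
  let i : L →ₐ[K] AdjoinRoot f := (IsScalarTower.toAlgHom K L (AdjoinRoot f)).comp (σ : L →ₐ[K] L)
  have hev : Polynomial.eval₂ (i : L →+* AdjoinRoot f) (AdjoinRoot.root f) f = 0 := by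
    refine (Polynomial.eval₂_sub _).trans ?_
    rw [Polynomial.eval₂_C, Polynomial.eval₂_pow, Polynomial.eval₂_X, hroot, sub_eq_zero]
    exact (i.commutes b).symm
  let φ : AdjoinRoot f →ₐ[K] AdjoinRoot f := AdjoinRoot.liftAlgHom f i _ hev
  have h1 : ∀ x : L, φ (algebraMap L (AdjoinRoot f) x) = algebraMap L (AdjoinRoot f) (σ x) := fun x =>
    AdjoinRoot.liftAlgHom_of f i _ hev x
  have h2 : φ (AdjoinRoot.root f) = AdjoinRoot.root f := AdjoinRoot.liftAlgHom_root f i _ hev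
  let σ₁ : AdjoinRoot f ≃ₐ[K] AdjoinRoot f := AlgEquiv.ofBijective φ φ.bijective
  have h1' : ∀ (j : ℕ) (x : L), (σ₁ ^ j) (algebraMap L (AdjoinRoot f) x) = algebraMap L (AdjoinRoot f) ((σ ^ j) x) := by
    intro j
    induction j with
    | zero => intro x; simp
    | succ j ih =>
      intro x
      rw [pow_succ, pow_succ, AlgEquiv.mul_apply, AlgEquiv.mul_apply, ← ih]
      congr 1
      exact h1 x
  have h2' : ∀ j : ℕ, (σ₁ ^ j) (AdjoinRoot.root f) = AdjoinRoot.root f := by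
    intro j
    induction j with
    | zero => rfl
    | succ j ih =>
      rw [pow_succ, AlgEquiv.mul_apply]
      exact (congrArg _ h2).trans ih
  refine ⟨AdjoinRoot f, inferInstance, ⟨⟩, inferInstance, inferInstance, inferInstance, σ₁, Units.mk0 _ hr0, ?_, h1, h2,
    hroot, ?_⟩
  · rw [(AdjoinRoot.powerBasis hmonic.ne_zero).finrank, AdjoinRoot.powerBasis_dim, hf, Polynomial.natDegree_X_pow_sub_C]
  · refine orderOf_eq_orderOf_iff.2 fun j => ⟨fun h => ?_, fun h => ?_⟩
    · ext x
      apply (algebraMap L (AdjoinRoot f)).injective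
      rw [← h1' j x, h]
      rfl
    · apply AlgEquiv.ext
      intro x
      have h3 : ((σ₁ ^ j : AdjoinRoot f ≃ₐ[K] AdjoinRoot f) : AdjoinRoot f →+* AdjoinRoot f) = RingHom.id _ := by
        refine AdjoinRoot.ringHom_ext (RingHom.ext fun x => ?_) (h2' j)
        refine (h1' j x).trans ?_
        rw [h]
        rfl
      exact DFunLike.congr_fun h3 x
end
end CyclicSchur

namespace CyclicSchur
open NumberField IsDedekindDomain WithZero
open scoped WithZero

lemma pn_of_fixed {G : Type*} [CommGroup G] {s : G →* G} {x : G} (h : s x = x) (m : ℕ) : pn s m x = x ^ m := by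
  rw [pn_apply, Finset.prod_congr rfl fun i _ => Function.iterate_fixed h i, Finset.prod_const, Finset.card_range]

section
variable {K M : Type} [Field K] [NumberField K] [Field M] [NumberField M] [Algebra K M] {ζ α : Kˣ}
  {σ : M ≃ₐ[K] M} {β : Mˣ} {p : ℕ}

lemma Kum.mem_NV_of_unit (h : Kum p ζ α σ β) {W : Pl M} (hW : Inv σ W) (hp : vl W (p : M) = 1)
    (hα : vl W (algebraMap K M α) = 1) {x : Kˣ} (hx : vl W (algebraMap K M x) = 1) : x ∈ NV M (dn K W) := by
  have hdn : ∀ c : K, vl W (algebraMap K M c) = 1 → vl (dn K W) c = 1 := fun c hc => by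
    rw [vl_algebraMap] at hc
    exact (pow_eq_one_iff_of_nonneg zero_le (rI_pos W).ne').1 hc
  have := h.isGalois
  have hr : rI K W = 1 := h.rI_eq_one (hdn _ (by rwa [map_natCast])) (hdn _ hα)
  have hle : NV M (dn K W) ≤ Pw K p ⊔ U (dn K W) 0 := by
    refine (iInf_le _ 0).trans (sup_le ?_ le_sup_right)
    rintro _ ⟨z, rfl⟩
    obtain ⟨n, hn⟩ := exists_ord W (z : M) z.ne_zero
    obtain ⟨w, hw⟩ := exists_unif_zpow (dn K W) n
    have h1 := vl_norm h.gen hW (z : M)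
    rw [hr, pow_one, h.deg, hn, ← hw] at h1
    refine Subgroup.mem_sup.2 ⟨w ^ p, ⟨w, rfl⟩, (w ^ p)⁻¹ * Nm K z, mem_U_zero.2 ?_, by group⟩
    rw [Units.val_mul, map_mul, Units.val_inv_eq_inv_val, map_inv₀, Units.val_pow_eq_pow_val, map_pow]
    exact (congrArg _ h1).trans (inv_mul_cancel₀ (pow_ne_zero _ (by rw [hw]; simp)))
  have := NeZero.mk h.prime.ne_zero
  have h2 := Subgroup.relIndex_mul_index hle
  rw [h.index_NV' ⟨W, rfl, hW⟩, le_antisymm (index_Pw_sup_U_zero p (dn K W)).1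
    (index_Pw_sup_U_zero_ge h.prime (dn K W)), Nat.mul_eq_right h.prime.ne_zero, Subgroup.relIndex_eq_one] at h2
  exact h2 (Subgroup.mem_sup_right (mem_U_zero.2 (hdn _ hx)))
end

section
variable {M L F E : Type} [Field M] [NumberField M] [Field L] [NumberField L] [Field F] [NumberField F]
  [Field E] [NumberField E] [Algebra M L] [Algebra M F] [Algebra L E] [Algebra F E] [Algebra M E]
  [IsScalarTower M L E] [IsScalarTower M F E] [IsGalois M L] [IsGalois F E]
  {σ : L ≃ₐ[M] L} {τ : E ≃ₐ[F] E}

lemma map_Nm (hσ : ∀ g, g ∈ Subgroup.zpowers σ) (hτ : ∀ g, g ∈ Subgroup.zpowers τ)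
    (h : ∀ x, τ (algebraMap L E x) = algebraMap L E (σ x)) (hd : Module.finrank M L = Module.finrank F E) (x : Lˣ) :
    Units.map (algebraMap M F : M →* F) (Nm M x) = Nm F (Units.map (algebraMap L E : L →* E) x) := by
  apply Units.map_injective (f := (algebraMap F E : F →* E)) (algebraMap F E).injective
  rw [← pn_sg_eq_norm hτ, ← hd, ← pn_comm (s := sg σ), pn_sg_eq_norm hσ]
  · ext
    exact (IsScalarTower.algebraMap_apply M F E _).symm.trans (IsScalarTower.algebraMap_apply M L E _)
  · intro x
    ext; exact (h x).symm

lemma map_NV (hσ : ∀ g, g ∈ Subgroup.zpowers σ) (hτ : ∀ g, g ∈ Subgroup.zpowers τ)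
    (h : ∀ x, τ (algebraMap L E x) = algebraMap L E (σ x)) (hd : Module.finrank M L = Module.finrank F E)
    {V : Pl F} {x : Mˣ} (hx : x ∈ NV L (dn M V)) : Units.map (algebraMap M F : M →* F) x ∈ NV E V := by
  refine mem_NV.2 fun N => ?_
  obtain ⟨_, ⟨y, rfl⟩, u, hu, rfl⟩ := Subgroup.mem_sup.1 (mem_NV.1 hx N)
  rw [map_mul, map_Nm hσ hτ h hd]
  exact Subgroup.mul_mem_sup ⟨_, rfl⟩ (algebraMap_mem_U hu)
end

section
variable {K L : Type} [Field K] [NumberField K] [Field L] [NumberField L] [Algebra K L] [IsGalois K L]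

lemma sg_map (σ : L ≃ₐ[K] L) (a : Kˣ) :
    sg σ (Units.map (algebraMap K L : K →* L) a) = Units.map (algebraMap K L : K →* L) a := by
  ext; exact σ.commutes _

lemma exists_pn_eq {σ : L ≃ₐ[K] L} (hσ : ∀ g, g ∈ Subgroup.zpowers σ) {p q : ℕ} (hp : p ≠ 0)
    (hL : Module.finrank K L = q * p) {a : Kˣ} {y₀ : Lˣ} (h : Nm K y₀ = a ^ p) :
    ∃ y : Lˣ, pn (sg σ) q y = Units.map (algebraMap K L : K →* L) a ∧ (σ ^ q) (y : L) = y := by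
  obtain ⟨M, _, _, _, _, _, σ', ρ, _, _, hML, hKM, hσ', hσ'g, hρ, hρg⟩ := exists_mid hσ hp hL
  have hs : ∀ x, sg σ' x = (sg σ)^[q] x := fun x => by
    ext
    rw [sg_apply, hσ', coe_sg_iterate]
  have hsa : sg σ' (Units.map (algebraMap K L : K →* L) a) = Units.map (algebraMap K L : K →* L) a := by
    rw [hs, Function.iterate_fixed (sg_map σ a)]
  have hcomm : ∀ x, pn (sg σ) q (sg σ' x) = sg σ' (pn (sg σ) q x) := fun x => by
    refine (pn_comm (g := sg σ') (fun x => ?_) q x).symm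
    rw [hs, hs, ← Function.iterate_succ_apply, Function.iterate_succ_apply']
  have h1 : Algebra.norm M ((pn (sg σ) q y₀ / Units.map (algebraMap K L : K →* L) a : Lˣ) : L) = 1 := by
    apply (algebraMap M L).injective
    have h2 := congrArg Units.val (pn_sg_eq_norm hσ'g (pn (sg σ) q y₀ / Units.map (algebraMap K L : K →* L) a))
    rw [map_one]
    refine h2.symm.trans (Units.val_eq_one.2 ?_)
    rw [map_div, hML, ← pn_comm (s := sg σ') hcomm, ← pn_mul hs, ← hL, pn_sg_eq_norm hσ, h, map_pow,
      div_eq_one, pn_of_fixed hsa]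
  have : IsCyclic (L ≃ₐ[M] L) := ⟨σ', hσ'g⟩
  obtain ⟨z, hz⟩ := groupCohomology.exists_div_of_norm_eq_one hσ'g h1
  have hz' : z / sg σ' z = pn (sg σ) q y₀ / Units.map (algebraMap K L : K →* L) a := by
    ext
    rw [← hz]
    simp
  have h3 : pn (sg σ) q (y₀ * (sg σ z / z)) = Units.map (algebraMap K L : K →* L) a := by
    have h4 := iterate_eq_mul_pn (s := sg σ) (c := z) (w := sg σ z / z) (by simp) q
    rw [← hs] at h4
    rw [div_eq_div_iff_mul_eq_mul, h4, mul_left_comm, ← map_mul] at hz'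
    exact (mul_left_cancel hz').symm
  refine ⟨_, h3, ?_⟩
  have h5 := map_pn (sg σ) q (y₀ * (sg σ z / z))
  rw [h3, sg_map, eq_div_iff_mul_eq', mul_right_inj] at h5
  rw [← coe_sg_iterate, ← h5]
end
end CyclicSchur

namespace CyclicSchur
open NumberField IsDedekindDomain WithZero
open scoped WithZero

section
variable {M L F E : Type} [Field M] [NumberField M] [Field L] [NumberField L] [Field F] [NumberField F]
  [Field E] [NumberField E] [Algebra M L] [Algebra M F] [Algebra L E] [Algebra F E] [Algebra M E]
  [IsScalarTower M L E] [IsScalarTower M F E] [IsGalois F E]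
  {σ : L ≃ₐ[M] L} {τ : E ≃ₐ[F] E} {p : ℕ} {ζ α : Mˣ} {β : Lˣ}

lemma Kum.baseChange (h : Kum p ζ α σ β) (hd : Module.finrank F E = p)
    (hστ : ∀ x, τ (algebraMap L E x) = algebraMap L E (σ x)) :
    Kum p (Units.map (algebraMap M F : M →* F) ζ) (Units.map (algebraMap M F : M →* F) α) τ
      (Units.map (algebraMap L E : L →* E) β) where
  prime := h.prime
  hζ := h.hζ.map_of_injective (Units.map_injective (algebraMap M F).injective)
  hα := by
    change algebraMap F E (algebraMap M F α) = (algebraMap L E β) ^ p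
    rw [← IsScalarTower.algebraMap_apply, IsScalarTower.algebraMap_apply M L E, h.hα, map_pow]
  hσ := by
    change τ (algebraMap L E β) = algebraMap F E (algebraMap M F ζ) * algebraMap L E β
    rw [← IsScalarTower.algebraMap_apply, IsScalarTower.algebraMap_apply M L E, hστ, h.hσ, map_mul]
  deg := hd

lemma Kum.map_mem_Nm_range (h : Kum p ζ α σ β) (hτ : ∀ g, g ∈ Subgroup.zpowers τ) (hd : Module.finrank F E = p)
    (hστ : ∀ x, τ (algebraMap L E x) = algebraMap L E (σ x)) {b y : Mˣ} (hneg : ∀ φ : M →+* ℝ, φ b < 0)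
    {θ : Eˣ} (hθ : τ θ = θ) (hθp : (θ : E) ^ p = algebraMap M E b)
    (hb : ∀ W : Pl L, Inv σ W → (vl W (p : L) = 1 ∧ vl W (algebraMap M L α) = 1 ∧ vl W (algebraMap M L y) = 1) ∨
      b ∉ NV L (dn M W)) :
    Units.map (algebraMap M F : M →* F) y ∈ (Nm F (L := E)).range := by
  have hE := h.baseChange hd hστ
  have := h.isGalois
  obtain ⟨θ', hθ'⟩ := hE.mem_range hθ
  have : IsTotallyComplex F := by
    rcases eq_or_ne p 2 with rfl | hp2
    · refine isTotallyComplex_of_forall fun φ => ?_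
      have h1 := hneg (φ.comp (algebraMap M F))
      have h2 : algebraMap M F b = θ' ^ 2 := by
        apply (algebraMap F E).injective
        rw [map_pow, hθ', hθp, ← IsScalarTower.algebraMap_apply]
      rw [RingHom.comp_apply, h2, map_pow] at h1
      exact h1.not_ge (sq_nonneg _)
    · exact isTotallyComplex_of_root h.prime hp2 hE.hζ
  refine hE.mem_Nm_range ?_
  rintro _ ⟨W₁, rfl, hW₁⟩
  have hr := (rI_pos (K := L) W₁).ne'
  have hW : Inv σ (dn L W₁) := fun x => by
    have := hW₁ (algebraMap L E x)
    rw [hστ, vl_algebraMap, vl_algebraMap] at this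
    exact (pow_left_inj₀ zero_le zero_le hr).1 this
  rcases hb _ hW with ⟨h1, h2, h3⟩ | h1
  · have hup : ∀ c : M, vl (dn L W₁) (algebraMap M L c) = 1 → vl W₁ (algebraMap F E (algebraMap M F c)) = 1 :=
      fun c hc => by
        rw [← IsScalarTower.algebraMap_apply, IsScalarTower.algebraMap_apply M L E, vl_algebraMap, hc, one_pow]
    exact hE.mem_NV_of_unit hW₁ (by simpa using hup p (by simpa using h1)) (hup _ h2) (hup _ h3)
  · have h2 := h.mem_zpowers_sup_NV ⟨_, rfl, hW⟩ h1 y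
    rw [dn_dn, ← dn_dn (K := M) (M := F)] at h2
    obtain ⟨_, ⟨j, rfl⟩, z, hz, hy⟩ := Subgroup.mem_sup.1 h2
    simp only at hy
    rw [← hy, map_mul, map_zpow]
    refine mul_mem (zpow_mem (Nm_le_NV _ ⟨θ, ?_⟩) _) (map_NV h.gen hτ hστ (h.deg.trans hd.symm) hz)
    apply Units.map_injective (f := (algebraMap F E : F →* E)) (algebraMap F E).injective
    rw [← pn_sg_eq_norm hτ, hd, pn_of_fixed (Units.ext hθ)]
    ext
    rw [Units.val_pow_eq_pow_val, hθp]
    exact IsScalarTower.algebraMap_apply M F E _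
end

section
variable {K L : Type} [Field K] [NumberField K] [Field L] [NumberField L] [Algebra K L] [IsGalois K L]

/-- If `a ^ p` is a norm from the cyclic extension `L` of degree `p ^ (k + 1)`, then there is an extension
of degree `p` of `L`, together with an extension of `σ` of the same order, for which `a` is a norm. -/
lemma exists_extension_norm {p : ℕ} (hp : p.Prime) (k : ℕ) {σ : L ≃ₐ[K] L}
    (hσ : ∀ g, g ∈ Subgroup.zpowers σ) (hL : Module.finrank K L = p ^ (k + 1)) {ζ : Kˣ} (hζ : IsPrimitiveRoot ζ p)
    {a : Kˣ} {y₀ : Lˣ} (ha : Nm K y₀ = a ^ p) :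
    ∃ (E : Type) (_ : Field E) (_ : NumberField E) (_ : Algebra K E) (_ : Algebra L E) (_ : IsScalarTower K L E)
      (σ₁ : E ≃ₐ[K] E) (x : Eˣ), Module.finrank L E = p ∧
      (∀ x, σ₁ (algebraMap L E x) = algebraMap L E (σ x)) ∧ orderOf σ₁ = p ^ (k + 1) ∧
      pn (sg σ₁) (p ^ (k + 1)) x = Units.map (algebraMap K E : K →* E) a := by
  classical
  have hL' : Module.finrank K L = p ^ k * p := by rw [hL, pow_succ]
  have hζ1 : (ζ : K) ^ p = 1 := by rw [← Units.val_pow_eq_pow_val, hζ.pow_eq_one, Units.val_one]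
  obtain ⟨y, hy, hy'⟩ := exists_pn_eq hσ hp.ne_zero hL' ha
  obtain ⟨β, hβ⟩ := exists_eigenvector_pow hσ hp.ne_zero hL' hζ1
  obtain ⟨M, _, _, _, _, _, σ', ρ, _, _, hML, hKM, hσ', hσ'g, hρ, hρg⟩ := exists_mid hσ hp.ne_zero hL'
  have hζM : algebraMap K L ζ = algebraMap M L (algebraMap K M ζ) := IsScalarTower.algebraMap_apply _ _ _ _
  obtain ⟨γ, hγ⟩ := mem_range_of_fixed hσ'g (x := (β : L) ^ p) (by
    rw [map_pow, hσ', hβ, mul_pow, ← map_pow, hζ1, map_one, one_mul])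
  have hγ0 : γ ≠ 0 := by
    rintro rfl
    rw [map_zero] at hγ
    exact pow_ne_zero p β.ne_zero hγ.symm
  obtain ⟨y', hyM⟩ := mem_range_of_fixed hσ'g (x := (y : L)) (by rw [hσ', hy'])
  have hy0 : y' ≠ 0 := by
    rintro rfl
    rw [map_zero] at hyM
    exact y.ne_zero hyM.symm
  have hk : Kum p (Units.map (algebraMap K M : K →* M) ζ) (Units.mk0 γ hγ0) σ' β :=
    ⟨hp, hζ.map_of_injective (Units.map_injective (algebraMap K M).injective), hγ,
      by rw [hσ', hβ, hζM]; rfl, hML⟩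
  have hpL : (p : L) ≠ 0 := Nat.cast_ne_zero.2 hp.ne_zero
  obtain ⟨b, hneg, hbp, N, hbN⟩ := exists_neg_not_near_norm hp k hσ hL hζ
    (((finite_support (Units.mk0 (p : L) hpL)).toFinset ∪ (finite_support (β ^ p)).toFinset ∪
      (finite_support y).toFinset).image (dn K))
  obtain ⟨E, _, _, _, _, _, σ₁, θ, hLE, hσ₁, hθ, hθb, hord⟩ := exists_lift hp hbp σ
  have hordσ : orderOf σ = p ^ (k + 1) := (orderOf_gen hσ).trans hL
  refine ⟨E, inferInstance, inferInstance, inferInstance, inferInstance, inferInstance, σ₁, ?_⟩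
  let _ : Algebra M E := ((algebraMap L E).comp (algebraMap M L)).toAlgebra
  have : IsScalarTower M L E := IsScalarTower.of_algebraMap_eq fun _ => rfl
  have hKME : ∀ x : K, algebraMap K E x = algebraMap M E (algebraMap K M x) := fun x => by
    rw [IsScalarTower.algebraMap_apply K L E, IsScalarTower.algebraMap_apply K M L]; rfl
  have hpow : ∀ (i : ℕ) (x : L), (σ₁ ^ i) (algebraMap L E x) = algebraMap L E ((σ ^ i) x) := by
    intro i
    induction i with
    | zero => intro x; simp
    | succ i ih => intro x; rw [pow_succ, pow_succ, AlgEquiv.mul_apply, AlgEquiv.mul_apply, hσ₁, ih]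
  let τ₀ : E ≃ₐ[M] E := AlgEquiv.ofRingEquiv (f := ((σ₁ ^ p ^ k : E ≃ₐ[K] E) : E ≃+* E)) fun x => by
    change (σ₁ ^ p ^ k) (algebraMap L E (algebraMap M L x)) = algebraMap L E (algebraMap M L x)
    rw [hpow, ← hσ', AlgEquiv.commutes]
  have hτ₀ : ∀ x, τ₀ x = (σ₁ ^ p ^ k) x := fun _ => rfl
  have hτ₀' : ∀ (i : ℕ) (x : E), (τ₀ ^ i) x = ((σ₁ ^ p ^ k) ^ i) x := by
    intro i
    induction i with
    | zero => intro x; rfl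
    | succ i ih => intro x; rw [pow_succ, pow_succ, AlgEquiv.mul_apply, AlgEquiv.mul_apply, hτ₀, ih]
  have hordτ : orderOf τ₀ = p := by
    have h1 : orderOf τ₀ = orderOf (σ₁ ^ p ^ k) := orderOf_eq_orderOf_iff.2 fun i =>
      ⟨fun h => AlgEquiv.ext fun x => by rw [← hτ₀', h]; rfl, fun h => AlgEquiv.ext fun x => by rw [hτ₀', h]; rfl⟩
    rw [h1, orderOf_pow_of_dvd (pow_ne_zero _ hp.ne_zero) (by rw [hord, hordσ]; exact pow_dvd_pow _ k.le_succ),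
      hord, hordσ, pow_succ, Nat.mul_div_cancel_left _ (pow_pos hp.pos _)]
  obtain ⟨F, _, _, _, _, _, τ, _, hFE, -, hτ, hτg⟩ := exists_fixed τ₀
  rw [hordτ] at hFE
  obtain ⟨x, hx⟩ := hk.map_mem_Nm_range (b := Units.map (algebraMap K M : K →* M) b) (y := Units.mk0 y' hy0)
    (θ := θ) hτg hFE (fun x => by rw [hτ, hτ₀, hpow, hσ'])
    (fun φ => hneg (φ.comp (algebraMap K M)))
    (by
      rw [hτ, hτ₀]
      have : ∀ i : ℕ, (σ₁ ^ i) (θ : E) = θ := by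
        intro i
        induction i with
        | zero => rfl
        | succ i ih => rw [pow_succ, AlgEquiv.mul_apply, hθ, ih]
      exact this _) (hθb.trans (hKME _)) (fun W hW => by
      by_cases hWS : vl W (p : L) = 1 ∧ vl W ((β : L) ^ p) = 1 ∧ vl W (y : L) = 1
      · refine Or.inl ⟨hWS.1, ?_, ?_⟩
        · rw [Units.val_mk0, hγ]; exact hWS.2.1
        · rw [Units.val_mk0, hyM]; exact hWS.2.2
      · refine Or.inr fun hb => ?_
        obtain ⟨_, ⟨z, rfl⟩, u, hu, hzu⟩ := Subgroup.mem_sup.1 (mem_NV.1 hb N)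
        refine hbN W (Finset.mem_image_of_mem _ ?_) (fun x => by rw [← hσ', hW]) z ?_
        · simp only [Finset.mem_union, Set.Finite.mem_toFinset, Set.mem_ofPred_eq, Units.val_mk0,
            Units.val_pow_eq_pow_val]
          tauto
        · have h1 : pn (sg (σ ^ p ^ k)) p z = pn (sg σ') p z :=
            pn_comm (g := MonoidHom.id _) (fun x => by ext; exact (hσ' x).symm) p z
          have h2 : Units.map (algebraMap K L : K →* L) b =
              Units.map (algebraMap M L : M →* L) (Units.map (algebraMap K M : K →* M) b) := by
            ext; exact IsScalarTower.algebraMap_apply K M L _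
          rw [h1, h2, ← hzu, map_mul, ← pn_sg_eq_norm hσ'g, hML, mul_inv, mul_right_comm, inv_mul_cancel, one_mul]
          exact inv_mem (algebraMap_mem_U hu))
  refine ⟨x, hLE, hσ₁, hord.trans hordσ, ?_⟩
  rw [pow_succ, pn_mul (t := sg τ) (fun x => by ext; rw [sg_apply, hτ, hτ₀, coe_sg_iterate])]
  have h1 : pn (sg τ) p x = Units.map (algebraMap L E : L →* E) y := by
    rw [← hFE, pn_sg_eq_norm hτg, hx]
    ext
    change algebraMap F E (algebraMap M F y') = algebraMap L E y
    rw [← IsScalarTower.algebraMap_apply, ← hyM]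
    rfl
  rw [h1, ← pn_comm (s := sg σ) (fun x => by ext; exact (hσ₁ _).symm), hy]
  ext
  exact (IsScalarTower.algebraMap_apply K L E _).symm
end
end CyclicSchur

namespace CyclicSchur
open NumberField IsDedekindDomain WithZero
open scoped WithZero

/-- If `a ^ p ^ i` is a norm for an automorphism of order `p ^ (k + 1)`, then `a` is a norm for an extension of
this automorphism to a field extension of degree `p ^ i`. -/
lemma exists_extension_norm_pow {p : ℕ} (hp : p.Prime) (k : ℕ) (i : ℕ) : ∀ {L : Type} [Field L] [NumberField L]
    {σ : L ≃ₐ[ℚ] L} (_ : orderOf σ = p ^ (k + 1)) {ζ a : Lˣ} (_ : IsPrimitiveRoot ζ p) (_ : σ ζ = ζ) (_ : σ a = a)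
    {x₀ : Lˣ} (_ : pn (sg σ) (p ^ (k + 1)) x₀ = a ^ p ^ i),
    ∃ (E : Type) (_ : Field E) (_ : NumberField E) (_ : Algebra L E) (σ' : E ≃ₐ[ℚ] E) (x : Eˣ),
      Module.finrank L E = p ^ i ∧ (∀ x, σ' (algebraMap L E x) = algebraMap L E (σ x)) ∧
      σ' ^ p ^ (k + 1) = 1 ∧ pn (sg σ') (p ^ (k + 1)) x = Units.map (algebraMap L E : L →* E) a := by
  induction i with
  | zero =>
    intro L _ _ σ hord ζ a _ _ _ x₀ h
    refine ⟨L, inferInstance, inferInstance, inferInstance, σ, x₀, by simp, fun _ => rfl,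
      hord ▸ pow_orderOf_eq_one σ, ?_⟩
    rw [h, pow_zero, pow_one]
    rfl
  | succ i ih =>
    intro L _ _ σ hord ζ a hζ hσζ hσa x₀ h
    obtain ⟨K, _, _, _, _, _, σ', _, hKL, hfix, hσ', hgen⟩ := exists_fixed σ
    obtain ⟨ζ', hζ'⟩ := hfix _ hσζ
    obtain ⟨a', ha'⟩ := hfix _ hσa
    have hζ0 : ζ' ≠ 0 := by rintro rfl; rw [map_zero] at hζ'; exact ζ.ne_zero hζ'.symm
    have ha0 : a' ≠ 0 := by rintro rfl; rw [map_zero] at ha'; exact a.ne_zero ha'.symm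
    have hinj : Function.Injective (Units.map (algebraMap K L : K →* L)) :=
      Units.map_injective (algebraMap K L).injective
    have eζ : Units.map (algebraMap K L : K →* L) (Units.mk0 ζ' hζ0) = ζ := Units.ext hζ'
    have ea : Units.map (algebraMap K L : K →* L) (Units.mk0 a' ha0) = a := Units.ext ha'
    have hn : Nm K x₀ = (Units.mk0 a' ha0 ^ p ^ i) ^ p := by
      apply hinj
      rw [← pn_sg_eq_norm hgen, hKL, hord, ← pow_mul, ← pow_succ, map_pow, ea, ← h]
      exact pn_comm (g := MonoidHom.id _) (fun x => by ext; exact hσ' x) _ x₀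
    obtain ⟨E, _, _, _, _, _, σ₁, x, hLE, hσ₁, hord₁, hx⟩ := exists_extension_norm hp k hgen (hKL.trans hord)
      (ζ := Units.mk0 ζ' hζ0) (IsPrimitiveRoot.of_map_of_injective (eζ ▸ hζ) hinj) hn
    have hE : Function.Injective (Units.map (algebraMap L E : L →* E)) :=
      Units.map_injective (algebraMap L E).injective
    let σ₂ : E ≃ₐ[ℚ] E := σ₁.restrictScalars ℚ
    have hσ₂ : ∀ x, σ₂ (algebraMap L E x) = algebraMap L E (σ x) := fun x => by
      rw [← hσ']; exact hσ₁ x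
    have hord₂ : orderOf σ₂ = p ^ (k + 1) := by
      rw [← hord₁]
      have hpow : ∀ (i : ℕ) x, (σ₂ ^ i) x = (σ₁ ^ i) x := by
        intro i
        induction i with
        | zero => intro x; rfl
        | succ i ih => intro x; rw [pow_succ, pow_succ, AlgEquiv.mul_apply, AlgEquiv.mul_apply, ih]; rfl
      exact orderOf_eq_orderOf_iff.2 fun i =>
        ⟨fun h => AlgEquiv.ext fun x => by rw [← hpow, h]; rfl, fun h => AlgEquiv.ext fun x => by rw [hpow, h]; rfl⟩
    obtain ⟨E', _, _, _, σ₃, z, hEE, hσ₃, ho, hz⟩ := ih hord₂ (hζ.map_of_injective hE)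
      (a := Units.map (algebraMap L E : L →* E) a) ((hσ₂ _).trans (congrArg _ hσζ))
      ((hσ₂ _).trans (congrArg _ hσa)) (x₀ := x) (by
        rw [← ea, ← map_pow]
        refine (show pn (sg σ₂) (p ^ (k + 1)) x = pn (sg σ₁) (p ^ (k + 1)) x from rfl).trans (hx.trans ?_)
        rw [map_pow, map_pow]
        congr 1
        ext
        exact IsScalarTower.algebraMap_apply K L E _)
    let _ : Algebra L E' := ((algebraMap E E').comp (algebraMap L E)).toAlgebra
    have : IsScalarTower L E E' := IsScalarTower.of_algebraMap_eq fun _ => rfl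
    refine ⟨E', inferInstance, inferInstance, inferInstance, σ₃, z, ?_, fun x => ?_, ho, hz⟩
    · rw [← Module.finrank_mul_finrank L E E', hLE, hEE, pow_succ']
    · exact (hσ₃ _).trans (congrArg _ (hσ₂ x))
end CyclicSchur

namespace CyclicSchur
open NumberField IsDedekindDomain WithZero
open scoped WithZero

lemma exists_ringHom_of_cyclotomic (L E M : Type) [Field L] [Field E] [Field M] [Algebra L E] [Algebra L M]
    (p : ℕ) [NeZero p] [IsCyclotomicExtension {p} L E] (h : ∃ r : M, IsPrimitiveRoot r p) :
    ∃ f : E →+* M, ∀ x, f (algebraMap L E x) = algebraMap L M x := by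
  obtain ⟨f⟩ := IsCyclotomicExtension.nonempty_algEquiv_adjoin_of_exists_isPrimitiveRoot {p} L E M (by
    rintro n rfl -
    exact h)
  exact ⟨(IntermediateField.val _).comp f.toAlgHom, AlgHom.commutes ((IntermediateField.val _).comp f.toAlgHom)⟩

lemma exists_lift_cyclotomic (L : Type) [Field L] [NumberField L] (E : Type) [Field E] [NumberField E] [Algebra L E]
    (p : ℕ) [NeZero p] [IsCyclotomicExtension {p} L E] (τ : L ≃ₐ[ℚ] L) :
    ∃ τ' : E ≃ₐ[ℚ] E, ∀ x, τ' (algebraMap L E x) = algebraMap L E (τ x) := by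
  obtain ⟨ζ, hζ⟩ := IsCyclotomicExtension.exists_isPrimitiveRoot L E (Set.mem_singleton p) (NeZero.ne p)
  have h : ∃ f : E →+* E, ∀ x, f (algebraMap L E x) = algebraMap L E (τ x) := by
    exact @exists_ringHom_of_cyclotomic L E E _ _ _ _
      ((algebraMap L E).comp (τ : L →+* L)).toAlgebra p _ _ ⟨ζ, hζ⟩
  obtain ⟨f, hf⟩ := h
  exact ⟨AlgEquiv.ofBijective f.toRatAlgHom f.toRatAlgHom.bijective, hf⟩

lemma exists_lift_fixing_root {p : ℕ} (hp : p.Prime) {k : ℕ} {L : Type} [Field L] [NumberField L] {τ : L ≃ₐ[ℚ] L}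
    (hτ : τ ^ p ^ k = 1) :
    ∃ (E : Type) (_ : Field E) (_ : NumberField E) (_ : Algebra L E) (τ' : E ≃ₐ[ℚ] E) (ζ : Eˣ),
      IsPrimitiveRoot ζ p ∧ τ' ζ = ζ ∧ (∀ x, τ' (algebraMap L E x) = algebraMap L E (τ x)) ∧ τ' ^ p ^ k = 1 ∧
      Module.finrank L E < p := by
  have := NeZero.mk hp.ne_zero
  have := Fact.mk hp
  let E := CyclotomicField p L
  have : NumberField E := IsCyclotomicExtension.numberField {p} L E
  obtain ⟨ζ, hζ⟩ := IsCyclotomicExtension.exists_isPrimitiveRoot L E (Set.mem_singleton p) (NeZero.ne p)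
  obtain ⟨τ', hτ'⟩ := exists_lift_cyclotomic L E p τ
  have hpow : ∀ (i : ℕ) (x : L), (τ' ^ i) (algebraMap L E x) = algebraMap L E ((τ ^ i) x) := by
    intro i
    induction i with
    | zero => intro x; rfl
    | succ i ih => intro x; rw [pow_succ, pow_succ, AlgEquiv.mul_apply, AlgEquiv.mul_apply, hτ', ih]
  have hζp : (τ' ^ (p - 1)) ζ = ζ := by
    obtain ⟨j, -, hj⟩ := hζ.eq_pow_of_pow_eq_one (ξ := τ' ζ) (by rw [← map_pow, hζ.pow_eq_one, map_one])
    have h1 : ∀ i : ℕ, (τ' ^ i) ζ = ζ ^ j ^ i := by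
      intro i
      induction i with
      | zero => simp
      | succ i ih => rw [pow_succ, AlgEquiv.mul_apply, ← hj, map_pow, ih, ← pow_mul, ← pow_succ]
    have hj0 : (j : ZMod p) ≠ 0 := fun h0 => by
      rw [ZMod.natCast_eq_zero_iff] at h0
      rw [(hζ.pow_eq_one_iff_dvd j).2 h0, eq_comm, map_eq_one_iff _ τ'.injective] at hj
      exact hζ.ne_one hp.one_lt hj
    rw [h1]
    conv_rhs => rw [← pow_one ζ]
    have h2 : j ^ (p - 1) ≡ 1 [MOD p] := by
      rw [← ZMod.natCast_eq_natCast_iff, Nat.cast_pow, ZMod.pow_card_sub_one_eq_one hj0, Nat.cast_one]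
    rw [← pow_mod_orderOf, ← hζ.eq_orderOf, h2, Nat.mod_eq_of_lt hp.one_lt]
  obtain ⟨e, he1, he2⟩ := Nat.chineseRemainder (n := p ^ k) (m := p - 1)
    (Nat.Coprime.pow_left _ ((Nat.coprime_self_sub_right hp.one_le).2 (Nat.coprime_one_right p))) 1 0
  have hτe : τ ^ e = τ := by
    conv_rhs => rw [← pow_one τ]
    rw [pow_eq_pow_iff_modEq]
    exact he1.of_dvd (orderOf_dvd_of_pow_eq_one hτ)
  have hEe : ∀ x, (τ' ^ e) (algebraMap L E x) = algebraMap L E (τ x) := fun x => by rw [hpow, hτe]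
  have hζe : (τ' ^ e) ζ = ζ := by
    obtain ⟨c, rfl⟩ := (Nat.modEq_zero_iff_dvd).1 he2
    rw [pow_mul]
    clear * - hζp
    induction c with
    | zero => rfl
    | succ c ih => rw [pow_succ, AlgEquiv.mul_apply, hζp, ih]
  refine ⟨E, inferInstance, inferInstance, inferInstance, τ' ^ e, Units.mk0 ζ (hζ.ne_zero hp.ne_zero),
    IsPrimitiveRoot.coe_units_iff.1 hζ, hζe, hEe, ?_, ?_⟩
  · have h1 : ∀ i : ℕ, ((τ' ^ e) ^ i) ζ = ζ := by
      intro i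
      induction i with
      | zero => rfl
      | succ i ih => rw [pow_succ, AlgEquiv.mul_apply, hζe, ih]
    let g : E →ₐ[L] E := ⟨((τ' ^ e) ^ p ^ k : E ≃ₐ[ℚ] E), fun x => by
      change ((τ' ^ e) ^ p ^ k) (algebraMap L E x) = _
      rw [← pow_mul, hpow, pow_mul, hτe, hτ]
      rfl⟩
    have hg : g = AlgHom.id L E := (hζ.powerBasis L).algHom_ext (by
      rw [IsPrimitiveRoot.powerBasis_gen]
      exact h1 _)
    exact AlgEquiv.ext fun x => DFunLike.congr_fun hg x
  · have h1 : minpoly L ζ ∣ Polynomial.cyclotomic p L := minpoly.dvd _ _ (by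
      rw [Polynomial.aeval_def, ← Polynomial.eval_map, Polynomial.map_cyclotomic]
      exact hζ.isRoot_cyclotomic hp.pos)
    have h2 := Polynomial.natDegree_le_of_dvd h1 (Polynomial.cyclotomic_ne_zero _ _)
    rw [Polynomial.natDegree_cyclotomic, Nat.totient_prime hp] at h2
    rw [(hζ.powerBasis L).finrank, ← PowerBasis.natDegree_minpoly, IsPrimitiveRoot.powerBasis_gen]
    have := hp.pos
    lia
end CyclicSchur

namespace CyclicSchur

/-- Matrices over a `K`-algebra `D` acting on column vectors. -/
def mulVecAlgHom (K D : Type*) [Field K] [Ring D] [Algebra K D] (r : ℕ) :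
    Matrix (Fin r) (Fin r) D →ₐ[K] Module.End K (Fin r → D) :=
  AlgHom.ofLinearMap
    { toFun M :=
        { toFun := M.mulVec
          map_add' := M.mulVec_add
          map_smul' := fun c v => M.mulVec_smul c v }
      map_add' := fun M N => LinearMap.ext fun v => Matrix.add_mulVec M N v
      map_smul' := fun c M => LinearMap.ext fun v => Matrix.smul_mulVec c M v }
    (LinearMap.ext fun v => Matrix.one_mulVec v)
    (fun M N => LinearMap.ext fun v => (Matrix.mulVec_mulVec v M N).symm)

lemma dvd_finrank_of_matrix {K D V : Type*} [Field K] [DivisionRing D] [Algebra K D] [Module.Finite K D] {r : ℕ} [NeZero r]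
    [AddCommGroup V] [Module K V] [Module.Finite K V] (ρ : Matrix (Fin r) (Fin r) D →ₐ[K] Module.End K V) :
    r * Module.finrank K D ∣ Module.finrank K V := by
  let s (i j : Fin r) (d : D) : Matrix (Fin r) (Fin r) D := Matrix.single i j d
  let W : Submodule K V := LinearMap.range (ρ (s 0 0 1))
  have hs : ∀ i j k d d', s i j d * s j k d' = s i k (d * d') := fun i j k d d' => Matrix.single_mul_single_same ..
  have hs0 : ∀ i j j' k d d', j ≠ j' → s i j d * s j' k d' = 0 := fun i j j' k d d' h =>
    Matrix.single_mul_single_of_ne _ _ _ _ h _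
  have hρ : ∀ M N v, ρ M (ρ N v) = ρ (M * N) v := fun M N v => by rw [map_mul]; rfl
  have hmem : ∀ i d v, ρ (s 0 i d) v ∈ W := fun i d v => ⟨ρ (s 0 i d) v, by rw [hρ, hs, one_mul]⟩
  have hW : ∀ w ∈ W, ρ (s 0 0 1) w = w := by
    rintro _ ⟨v, rfl⟩
    rw [hρ, hs, one_mul]
  let f : D →+* Module.End K W :=
    { toFun d := (ρ (s 0 0 d)).restrict (p := W) (q := W) fun w _ => hmem 0 d w
      map_one' := LinearMap.ext fun w => Subtype.ext (hW w w.2)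
      map_mul' := fun d d' => LinearMap.ext fun w => Subtype.ext (by
        change ρ _ _ = ρ _ (ρ _ _)
        rw [hρ, hs])
      map_zero' := LinearMap.ext fun w => Subtype.ext (by
        change ρ (Matrix.single 0 0 0) _ = 0
        rw [Matrix.single_zero, map_zero]; rfl)
      map_add' := fun d d' => LinearMap.ext fun w => Subtype.ext (by
        change ρ (Matrix.single 0 0 (d + d')) _ = ρ (Matrix.single 0 0 d) _ + ρ (Matrix.single 0 0 d') _
        rw [Matrix.single_add, map_add]; rfl) }
  let _ : Module D W := Module.compHom W f
  have : IsScalarTower K D W := ⟨fun c d w => Subtype.ext (by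
    change ρ (Matrix.single 0 0 (c • d)) _ = c • ρ (Matrix.single 0 0 d) _
    rw [← Matrix.smul_single, map_smul]; rfl)⟩
  let e : V ≃ₗ[K] (Fin r → W) :=
    { toFun v i := ⟨ρ (s 0 i 1) v, hmem i 1 v⟩
      map_add' := fun v w => funext fun i => Subtype.ext (map_add _ _ _)
      map_smul' := fun c v => funext fun i => Subtype.ext (map_smul _ _ _)
      invFun w := ∑ i, ρ (s i 0 1) (w i)
      left_inv := fun v => by
        change ∑ i, ρ (s i 0 1) (ρ (s 0 i 1) v) = v
        simp_rw [hρ, hs, one_mul]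
        rw [← LinearMap.sum_apply, ← map_sum]
        have : ∑ i, s i i 1 = 1 := Matrix.sum_single_one
        rw [this, map_one]; rfl
      right_inv := fun w => funext fun i => Subtype.ext (by
        change ρ (s 0 i 1) (∑ j, ρ (s j 0 1) (w j)) = w i
        rw [map_sum, Finset.sum_eq_single i, hρ, hs, one_mul, hW _ (w i).2]
        · intro j _ hj
          rw [hρ, hs0 _ _ _ _ _ _ hj.symm, map_zero]; rfl
        · simp) }
  have : Module.Finite D W := Module.Finite.of_restrictScalars_finite K D W
  rw [e.finrank_eq, Module.finrank_pi_fintype, Finset.sum_const, Finset.card_univ, Fintype.card_fin, smul_eq_mul,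
    ← Module.finrank_mul_finrank K D W]
  exact mul_dvd_mul_left _ (dvd_mul_right _ _)

/-- Sequences which are twisted-periodic with respect to `ψ`. -/
def twistedSeq {K E : Type*} [Field K] [AddCommGroup E] [Module K E] (n : ℕ) (ψ : E →ₗ[K] E) :
    Submodule K (ℕ → E) where
  carrier := {f | ∀ j, f (j + n) = ψ (f j)}
  add_mem' hf hg j := by simp only [Pi.add_apply, map_add, hf j, hg j]
  zero_mem' j := by simp
  smul_mem' c f hf j := by simp only [Pi.smul_apply, map_smul, hf j]

lemma twistedSeq_add_mul {K E : Type*} [Field K] [AddCommGroup E] [Module K E] {n : ℕ} {ψ : E →ₗ[K] E} {f : ℕ → E}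
    (hf : f ∈ twistedSeq n ψ) (q j : ℕ) : f (j + n * q) = (ψ ^ q) (f j) := by
  induction q with
  | zero => rfl
  | succ q ih => rw [Nat.mul_succ, ← add_assoc, hf, ih, pow_succ']; rfl

lemma finrank_twistedSeq {K E : Type*} [Field K] [AddCommGroup E] [Module K E] [Module.Finite K E] {n : ℕ} (hn : 0 < n)
    (ψ : E →ₗ[K] E) :
    Module.Finite K (twistedSeq n ψ) ∧ Module.finrank K (twistedSeq n ψ) = n * Module.finrank K E := by
  let e : twistedSeq n ψ ≃ₗ[K] (Fin n → E) :=
    { toFun f i := f.1 i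
      map_add' := fun _ _ => rfl
      map_smul' := fun _ _ => rfl
      invFun g := ⟨fun j => (ψ ^ (j / n)) (g ⟨j % n, Nat.mod_lt _ hn⟩), fun j => by
        simp only [Nat.add_mod_right, Nat.add_div_right _ hn, pow_succ']
        rfl⟩
      left_inv := fun f => Subtype.ext (funext fun j => by
        change (ψ ^ (j / n)) (f.1 (j % n)) = f.1 j
        rw [← twistedSeq_add_mul f.2, Nat.mod_add_div])
      right_inv := fun g => funext fun i => by
        change (ψ ^ ((i : ℕ) / n)) (g ⟨(i : ℕ) % n, _⟩) = g i
        simp only [Nat.div_eq_of_lt i.2, Nat.mod_eq_of_lt i.2, pow_zero]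
        rfl }
  refine ⟨Module.Finite.equiv e.symm, ?_⟩
  rw [e.finrank_eq, Module.finrank_pi_fintype, Finset.sum_const, Finset.card_univ, Fintype.card_fin, smul_eq_mul]
end CyclicSchur

namespace CyclicSchur

/-- `ι` and `u` exhibit `A` as the cyclic algebra `(L/K, σ, a)`. -/
structure CyclicData {K L A : Type*} [Field K] [Field L] [Algebra K L] [Ring A] [Algebra K A] (σ : L ≃ₐ[K] L) (a : K)
    (ι : L →ₐ[K] A) (u : Aˣ) : Prop where
  pow_eq : (u : A) ^ Module.finrank K L = algebraMap K A a
  mul_eq : ∀ x, (u : A) * ι x = ι (σ x) * (u : A)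
  bij : Function.Bijective fun f : Fin (Module.finrank K L) → L => ∑ i, ι (f i) * (u : A) ^ (i : ℕ)

lemma semilinear_pow {K L A : Type*} [Field K] [Field L] [Algebra K L] [Ring A] [Algebra K A] {σ : L ≃ₐ[K] L}
    {ι : L →ₐ[K] A} {u : A} (h : ∀ x, u * ι x = ι (σ x) * u) (k : ℕ) (x : L) : u ^ k * ι x = ι ((σ ^ k) x) * u ^ k := by
  induction k generalizing x with
  | zero => simp
  | succ k ih => rw [pow_succ, mul_assoc, h, ← mul_assoc, ih, mul_assoc, pow_succ]; rfl

section
variable {K L A : Type*} [Field K] [Field L] [Algebra K L] [FiniteDimensional K L] [Ring A] [Algebra K A]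
  {σ : L ≃ₐ[K] L} {a : K} {ι : L →ₐ[K] A} {u : Aˣ}

/-- The coordinates of a cyclic algebra. -/
noncomputable def CyclicData.equiv (h : CyclicData σ a ι u) : (Fin (Module.finrank K L) → L) ≃ₗ[K] A :=
  LinearEquiv.ofBijective
    { toFun := fun f : Fin (Module.finrank K L) → L => ∑ i, ι (f i) * (u : A) ^ (i : ℕ)
      map_add' := fun f g => by simp only [Pi.add_apply, map_add, add_mul, Finset.sum_add_distrib]
      map_smul' := fun c f => by simp only [Pi.smul_apply, map_smul, smul_mul_assoc, Finset.smul_sum, RingHom.id_apply] }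
    h.bij

lemma CyclicData.equiv_apply (h : CyclicData σ a ι u) (f : Fin (Module.finrank K L) → L) :
    h.equiv f = ∑ i, ι (f i) * (u : A) ^ (i : ℕ) := rfl

lemma CyclicData.equiv_single (h : CyclicData σ a ι u) (i : Fin (Module.finrank K L)) (x : L) :
    h.equiv (Pi.single i x) = ι x * (u : A) ^ (i : ℕ) := by
  rw [h.equiv_apply, Finset.sum_eq_single i, Pi.single_eq_same]
  · intro j _ hj
    rw [Pi.single_eq_of_ne hj, map_zero, zero_mul]
  · simp

lemma CyclicData.finite (h : CyclicData σ a ι u) : Module.Finite K A := Module.Finite.equiv h.equiv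

lemma CyclicData.nontrivial (h : CyclicData σ a ι u) : Nontrivial A := by
  have : NeZero (Module.finrank K L) := ⟨Module.finrank_pos.ne'⟩
  exact h.equiv.symm.toEquiv.nontrivial

lemma CyclicData.finrank_eq (h : CyclicData σ a ι u) :
    Module.finrank K A = Module.finrank K L * Module.finrank K L := by
  rw [← h.equiv.finrank_eq, Module.finrank_pi_fintype, Finset.sum_const, Finset.card_univ, Fintype.card_fin, smul_eq_mul]

lemma CyclicData.exists_algHom (h : CyclicData σ a ι u) {B : Type*} [Ring B] [Algebra K B] {ι' : L →ₐ[K] B} {φ : B}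
    (hφ : φ ^ Module.finrank K L = algebraMap K B a) (hc : ∀ x, φ * ι' x = ι' (σ x) * φ) : Nonempty (A →ₐ[K] B) := by
  set n := Module.finrank K L with hn
  have hn0 : 0 < n := Module.finrank_pos
  let T : A →ₗ[K] B := (∑ i : Fin n, (LinearMap.mulRight K (φ ^ (i : ℕ))) ∘ₗ ι'.toLinearMap ∘ₗ LinearMap.proj i) ∘ₗ
    h.equiv.symm.toLinearMap
  have hT : ∀ f : Fin n → L, T (h.equiv f) = ∑ i, ι' (f i) * φ ^ (i : ℕ) := fun f => by
    simp [T]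
  have hT1 : ∀ (i : Fin n) (x : L), T (ι x * (u : A) ^ (i : ℕ)) = ι' x * φ ^ (i : ℕ) := fun i x => by
    rw [← h.equiv_single, hT, Finset.sum_eq_single i, Pi.single_eq_same]
    · intro j _ hj
      rw [Pi.single_eq_of_ne hj, map_zero, zero_mul]
    · simp
  have hT2 : ∀ (k : ℕ) (x : L), T (ι x * (u : A) ^ k) = ι' x * φ ^ k := fun k x => by
    have e1 : (u : A) ^ k = ι (algebraMap K L a ^ (k / n)) * (u : A) ^ (k % n) := by
      conv_lhs => rw [← Nat.div_add_mod k n, pow_add, pow_mul, h.pow_eq]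
      rw [map_pow, AlgHom.commutes]
    have e2 : φ ^ k = ι' (algebraMap K L a ^ (k / n)) * φ ^ (k % n) := by
      conv_lhs => rw [← Nat.div_add_mod k n, pow_add, pow_mul, hφ]
      rw [map_pow, AlgHom.commutes]
    rw [e1, e2, ← mul_assoc, ← mul_assoc, ← map_mul, ← map_mul]
    exact hT1 ⟨k % n, Nat.mod_lt _ hn0⟩ _
  have hmul : ∀ s t, T (s * t) = T s * T t := by
    intro s t
    obtain ⟨f, rfl⟩ := h.equiv.surjective s
    obtain ⟨g, rfl⟩ := h.equiv.surjective t
    rw [hT, hT, h.equiv_apply, h.equiv_apply, Finset.sum_mul_sum, Finset.sum_mul_sum, map_sum]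
    refine Finset.sum_congr rfl fun i _ => ?_
    rw [map_sum]
    refine Finset.sum_congr rfl fun j _ => ?_
    rw [mul_assoc, ← mul_assoc ((u : A) ^ (i : ℕ)), semilinear_pow h.mul_eq, mul_assoc (ι _), ← pow_add, ← mul_assoc,
      ← map_mul, hT2, map_mul, mul_assoc (ι' _) (φ ^ (i : ℕ)), ← mul_assoc (φ ^ (i : ℕ)), semilinear_pow hc, pow_add]
    simp only [mul_assoc]
  refine ⟨AlgHom.ofLinearMap T ?_ hmul⟩
  simpa using hT2 0 1

lemma CyclicData.isSimpleRing [IsGalois K L] (h : CyclicData σ a ι u) (hord : orderOf σ = Module.finrank K L) :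
    IsSimpleRing A := by
  have := h.nontrivial
  refine ⟨⟨fun I => or_iff_not_imp_left.2 fun hI => ?_⟩⟩
  obtain ⟨t, htI, ht0⟩ : ∃ t ∈ I, t ≠ 0 := by
    by_contra! hcon
    exact hI (eq_bot_iff.2 fun t ht => (TwoSidedIdeal.mem_bot A).2 (hcon t ht))
  obtain ⟨f, rfl⟩ := h.equiv.surjective t
  obtain ⟨i₀, hi₀⟩ : ∃ i, f i ≠ 0 := by
    by_contra! hcon
    exact ht0 (by rw [show f = 0 from funext hcon, map_zero])
  obtain ⟨α, hα⟩ := Field.exists_primitive_element K L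
  have hinj : ∀ i j : Fin (Module.finrank K L), (σ ^ (i : ℕ)) α = (σ ^ (j : ℕ)) α → i = j := fun i j hij => by
    have h1 : σ ^ (i : ℕ) = σ ^ (j : ℕ) := by
      have h2 : ((σ ^ (i : ℕ) : L ≃ₐ[K] L) : L →ₐ[K] L) = (σ ^ (j : ℕ) : L ≃ₐ[K] L) :=
        (Field.primitive_element_iff_algHom_eq_of_eval' K L (fun x => Normal.splits inferInstance x) α).1 hα hij
      exact AlgEquiv.ext fun x => DFunLike.congr_fun h2 x
    rw [pow_inj_mod, hord, Nat.mod_eq_of_lt i.2, Nat.mod_eq_of_lt j.2] at h1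
    exact Fin.ext h1
  let P : Polynomial L := ∏ j ∈ Finset.univ.erase i₀, (Polynomial.X - Polynomial.C ((σ ^ (j : ℕ)) α))
  have hP0 : ∀ j, j ≠ i₀ → P.eval ((σ ^ (j : ℕ)) α) = 0 := fun j hj => by
    rw [Polynomial.eval_prod]
    exact Finset.prod_eq_zero (Finset.mem_erase.2 ⟨hj, Finset.mem_univ _⟩) (by simp)
  have hP1 : P.eval ((σ ^ (i₀ : ℕ)) α) ≠ 0 := by
    rw [Polynomial.eval_prod, Finset.prod_ne_zero_iff]
    intro j hj
    rw [Polynomial.eval_sub, Polynomial.eval_X, Polynomial.eval_C, sub_ne_zero]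
    exact fun hh => (Finset.mem_erase.1 hj).1 (hinj _ _ hh).symm
  have key : ∑ k ∈ Finset.range (P.natDegree + 1), ι (P.coeff k) * h.equiv f * ι (α ^ k) =
      ι (f i₀ * P.eval ((σ ^ (i₀ : ℕ)) α)) * (u : A) ^ (i₀ : ℕ) := by
    have h1 : ∀ k, ι (P.coeff k) * h.equiv f * ι (α ^ k) =
        ∑ i, ι (f i * (P.coeff k * (σ ^ (i : ℕ)) α ^ k)) * (u : A) ^ (i : ℕ) := fun k => by
      rw [h.equiv_apply, Finset.mul_sum, Finset.sum_mul]
      refine Finset.sum_congr rfl fun i _ => ?_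
      rw [mul_assoc, mul_assoc, semilinear_pow h.mul_eq, ← mul_assoc, ← mul_assoc, ← map_mul, ← map_mul, map_pow]
      congr 2
      ring
    simp_rw [h1]
    rw [Finset.sum_comm, Finset.sum_eq_single i₀]
    · rw [← Finset.sum_mul, ← map_sum, ← Finset.mul_sum, Polynomial.eval_eq_sum_range]
    · intro i _ hi
      rw [← Finset.sum_mul, ← map_sum, ← Finset.mul_sum, ← Polynomial.eval_eq_sum_range, hP0 i hi, mul_zero, map_zero,
        zero_mul]
    · simp
  have hmem : ι (f i₀ * P.eval ((σ ^ (i₀ : ℕ)) α)) * (u : A) ^ (i₀ : ℕ) ∈ I := by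
    rw [← key]
    exact sum_mem fun k _ => I.mul_mem_right _ _ (I.mul_mem_left _ _ htI)
  have hunit : IsUnit (ι (f i₀ * P.eval ((σ ^ (i₀ : ℕ)) α)) * (u : A) ^ (i₀ : ℕ)) :=
    ((IsUnit.mk0 _ (mul_ne_zero hi₀ hP1)).map ι).mul (u.isUnit.pow _)
  obtain ⟨v, hv⟩ := hunit
  rw [← hv] at hmem
  have := I.mul_mem_left (↑v⁻¹) _ hmem
  rw [Units.inv_mul] at this
  exact I.one_mem_iff.1 this

end
end CyclicSchur

namespace CyclicSchur

section
variable {K L A : Type*} [Field K] [Field L] [Algebra K L] [FiniteDimensional K L] [IsGalois K L] [Ring A] [Algebra K A]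
  {σ : L ≃ₐ[K] L} {a : K} {ι : L →ₐ[K] A} {u : Aˣ}

lemma CyclicData.exists_norm_eq (h : CyclicData σ a ι u) (hσ : ∀ τ, τ ∈ Subgroup.zpowers σ) {V : Type*} [AddCommGroup V]
    [Module K V] [Module.Finite K V] (ρ : A →ₐ[K] Module.End K V) {d : ℕ}
    (hd : Module.finrank K V = Module.finrank K L * d) : ∃ x : L, Algebra.norm K x = a ^ d := by
  let _ : Module L V := Module.compHom V (ρ.comp ι).toRingHom
  have hsmul : ∀ (x : L) (v : V), x • v = ρ (ι x) v := fun _ _ => rfl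
  have : IsScalarTower K L V := ⟨fun c x v => by rw [hsmul, hsmul, map_smul, map_smul]; rfl⟩
  have : Module.Finite L V := Module.Finite.of_restrictScalars_finite K L V
  have hdL : Module.finrank L V = d := by
    rw [← Module.finrank_mul_finrank K L V] at hd
    exact Nat.eq_of_mul_eq_mul_left Module.finrank_pos hd
  let b : Module.Basis (Fin d) L V := Module.finBasisOfFinrankEq L V hdL
  have hu : ∀ (x : L) (v : V), ρ u (x • v) = σ x • ρ u v := fun x v => by
    rw [hsmul, hsmul, ← Module.End.mul_apply, ← Module.End.mul_apply, ← map_mul, ← map_mul, h.mul_eq]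
  let U : Matrix (Fin d) (Fin d) L := b.toMatrix fun j => ρ u (b j)
  have hU : ∀ j, ∑ i, U i j • b i = ρ u (b j) := fun j => b.sum_toMatrix_smul_self _ j
  have hP : ∀ k, ∃ P : Matrix (Fin d) (Fin d) L, P.det = ∏ i ∈ Finset.range k, (σ ^ i) U.det ∧
      ∀ j, ∑ i, P i j • b i = ρ ((u : A) ^ k) (b j) := by
    intro k
    induction k with
    | zero => exact ⟨1, by simp, fun j => by simp [Matrix.one_apply, ite_smul]⟩
    | succ k ih =>
      obtain ⟨P, hP1, hP2⟩ := ih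
      refine ⟨U * P.map σ, ?_, fun j => ?_⟩
      · rw [Matrix.det_mul, Finset.prod_range_succ', mul_comm]
        congr 1
        have : (P.map σ).det = σ P.det := ((σ : L →+* L).map_det P).symm
        rw [this, hP1, map_prod]
        refine Finset.prod_congr rfl fun i _ => ?_
        rw [pow_succ']; rfl
      · rw [pow_succ', map_mul, Module.End.mul_apply, ← hP2, map_sum]
        simp_rw [hu, ← hU, Finset.smul_sum, Matrix.mul_apply, Finset.sum_smul]
        rw [Finset.sum_comm]
        refine Finset.sum_congr rfl fun i _ => Finset.sum_congr rfl fun l _ => ?_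
        rw [Matrix.map_apply, mul_comm, mul_smul]
  obtain ⟨P, hP1, hP2⟩ := hP (Module.finrank K L)
  have hPa : P = algebraMap K L a • (1 : Matrix (Fin d) (Fin d) L) := by
    ext i j
    have h1 := hP2 j
    rw [h.pow_eq, AlgHom.commutes, Module.algebraMap_end_apply, ← algebraMap_smul L a (b j)] at h1
    have h2 := congrArg (fun v => b.repr v i) h1
    simp only [map_sum, map_smul, Module.Basis.repr_self, Finsupp.coe_finsetSum, Finset.sum_apply, Finsupp.smul_apply,
      Finsupp.single_apply, smul_eq_mul, mul_ite, mul_one, mul_zero, Finset.sum_ite_eq', Finset.mem_univ, if_true] at h2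
    rw [h2, Matrix.smul_apply, Matrix.one_apply]
    simp [eq_comm]
  refine ⟨U.det, (algebraMap K L).injective ?_⟩
  rw [norm_eq_prod_pow hσ, ← hP1, hPa, Matrix.det_smul, Matrix.det_one, mul_one, Fintype.card_fin, map_pow]

/-- If `a` is a twisted norm for an extension `τ'` of `σ ^ n'` to `L'`, then `A` acts on a vector space of dimension
`n' * [L' : K]`. -/
lemma CyclicData.exists_rep (h : CyclicData σ a ι u) {n' q : ℕ} (hn' : 0 < n') (hn : Module.finrank K L = n' * q)
    {L' : Type} [Field L'] [Algebra L L'] [Module.Finite L L'] (τ' : L' ≃+* L')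
    (hτ' : ∀ x, τ' (algebraMap L L' x) = algebraMap L L' ((σ ^ n') x)) (hq : τ' ^ q = 1) {x : L'}
    (hx : ∏ i ∈ Finset.range q, (τ' ^ i) x = algebraMap L L' (algebraMap K L a)) :
    ∃ (V : Type) (_ : AddCommGroup V) (_ : Module K V) (_ : Module.Finite K V), Nonempty (A →ₐ[K] Module.End K V) ∧
      Module.finrank K V = n' * (Module.finrank K L * Module.finrank L L') := by
  let _ : Algebra K L' := ((algebraMap L L').comp (algebraMap K L)).toAlgebra
  have : IsScalarTower K L L' := IsScalarTower.of_algebraMap_eq fun _ => rfl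
  have : Module.Finite K L' := Module.Finite.trans L L'
  let ψ : L' →ₗ[K] L' :=
    { toFun y := x * τ' y
      map_add' := fun y z => by rw [map_add, mul_add]
      map_smul' := fun c y => by
        rw [Algebra.smul_def, Algebra.smul_def, map_mul, IsScalarTower.algebraMap_apply K L L', hτ', AlgEquiv.commutes,
          RingHom.id_apply, mul_left_comm, IsScalarTower.algebraMap_apply K L L'] }
  have hψ : ∀ k y, (ψ ^ k) y = (∏ i ∈ Finset.range k, (τ' ^ i) x) * (τ' ^ k) y := by
    intro k
    induction k with
    | zero => intro y; simp
    | succ k ih =>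
      intro y
      rw [pow_succ, Module.End.mul_apply, ih, Finset.prod_range_succ, pow_succ, RingAut.mul_apply, mul_assoc, ← map_mul]
      rfl
  have hψq : ∀ y, (ψ ^ q) y = a • y := fun y => by
    rw [hψ, hx, hq, RingAut.one_apply, Algebra.smul_def]; rfl
  obtain ⟨hfin, hrank⟩ := finrank_twistedSeq hn' ψ
  refine ⟨twistedSeq n' ψ, inferInstance, inferInstance, hfin, ?_, ?_⟩
  · have hmem : ∀ (l : L) (f : ℕ → L'), f ∈ twistedSeq n' ψ →
        (fun j => algebraMap L L' ((σ ^ j) l) * f j) ∈ twistedSeq n' ψ := fun l f hf j => by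
      change algebraMap L L' ((σ ^ (j + n')) l) * f (j + n') = x * τ' (algebraMap L L' ((σ ^ j) l) * f j)
      rw [hf j, map_mul, hτ', add_comm, pow_add]
      exact mul_left_comm _ _ _
    let ι' : L →ₐ[K] Module.End K (twistedSeq n' ψ) := AlgHom.ofLinearMap
      { toFun := fun l =>
          { toFun := fun f => ⟨fun j => algebraMap L L' ((σ ^ j) l) * f.1 j, hmem l f.1 f.2⟩
            map_add' := fun f g => Subtype.ext (funext fun j => mul_add _ _ _)
            map_smul' := fun c f => Subtype.ext (funext fun j => mul_smul_comm c (algebraMap L L' ((σ ^ j) l)) (f.1 j)) }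
        map_add' := fun l l' => LinearMap.ext fun f => Subtype.ext (funext fun j => by
          change algebraMap L L' ((σ ^ j) (l + l')) * f.1 j = algebraMap L L' ((σ ^ j) l) * f.1 j +
            algebraMap L L' ((σ ^ j) l') * f.1 j
          rw [map_add, map_add, add_mul])
        map_smul' := fun c l => LinearMap.ext fun f => Subtype.ext (funext fun j => by
          change algebraMap L L' ((σ ^ j) (c • l)) * f.1 j = c • (algebraMap L L' ((σ ^ j) l) * f.1 j)
          rw [map_smul, ← smul_mul_assoc, Algebra.smul_def, map_mul, Algebra.smul_def c (algebraMap L L' _)]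
          rfl) }
      (LinearMap.ext fun f => Subtype.ext (funext fun j => by
        change algebraMap L L' ((σ ^ j) 1) * f.1 j = f.1 j
        rw [map_one, map_one, one_mul]))
      (fun l l' => LinearMap.ext fun f => Subtype.ext (funext fun j => by
        change algebraMap L L' ((σ ^ j) (l * l')) * f.1 j =
          algebraMap L L' ((σ ^ j) l) * (algebraMap L L' ((σ ^ j) l') * f.1 j)
        rw [map_mul, map_mul, mul_assoc]))
    let φ : Module.End K (twistedSeq n' ψ) :=
      { toFun := fun f => ⟨fun j => f.1 (j + 1), fun j => by
          change f.1 (j + n' + 1) = ψ (f.1 (j + 1))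
          rw [add_right_comm, f.2]⟩
        map_add' := fun f g => rfl
        map_smul' := fun c f => rfl }
    have hφ : ∀ (k : ℕ) (f : twistedSeq n' ψ) (j : ℕ), ((φ ^ k) f).1 j = f.1 (j + k) := by
      intro k
      induction k with
      | zero => intro f j; rfl
      | succ k ih => intro f j; rw [pow_succ, Module.End.mul_apply, ih, ← add_assoc]; rfl
    refine h.exists_algHom (ι' := ι') (φ := φ) ?_ fun l => ?_
    · refine LinearMap.ext fun f => Subtype.ext (funext fun j => ?_)
      rw [hφ, hn, twistedSeq_add_mul f.2, hψq]
      rfl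
    · refine LinearMap.ext fun f => Subtype.ext (funext fun j => ?_)
      change algebraMap L L' ((σ ^ (j + 1)) l) * f.1 (j + 1) = algebraMap L L' ((σ ^ j) (σ l)) * f.1 (j + 1)
      rw [pow_succ]; rfl
  · rw [hrank, Module.finrank_mul_finrank]
end
end CyclicSchur

namespace CyclicSchur

/-- If `a ^ p ^ i` is a norm for an automorphism of order `p ^ κ`, then `a` is a norm for an extension of this
automorphism to a field extension whose degree is divisible by `p` at most `i` times. -/
lemma exists_extension_norm_factorization {p : ℕ} (hp : p.Prime) {κ i : ℕ} (hi : i ≤ κ) {L : Type} [Field L] [NumberField L]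
    {τ : L ≃ₐ[ℚ] L} (hord : orderOf τ = p ^ κ) {a y : Lˣ} (ha : τ a = a) (hy : pn (sg τ) (p ^ κ) y = a ^ p ^ i) :
    ∃ (E : Type) (_ : Field E) (_ : NumberField E) (_ : Algebra L E) (τ' : E ≃ₐ[ℚ] E) (x : Eˣ),
      (∀ x, τ' (algebraMap L E x) = algebraMap L E (τ x)) ∧ τ' ^ p ^ κ = 1 ∧
      pn (sg τ') (p ^ κ) x = Units.map (algebraMap L E : L →* E) a ∧
      (Module.finrank L E).factorization p ≤ i := by
  obtain rfl | hi0 := Nat.eq_zero_or_pos i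
  · refine ⟨L, inferInstance, inferInstance, inferInstance, τ, y, fun _ => rfl, hord ▸ pow_orderOf_eq_one τ, ?_, by simp⟩
    rw [hy, pow_zero, pow_one]
    rfl
  obtain ⟨k, rfl⟩ : ∃ k, κ = k + 1 := ⟨κ - 1, by lia⟩
  obtain ⟨E, _, _, _, τ₁, ζ, hζ, hτζ, hτ₁, hpow, hlt⟩ := exists_lift_fixing_root hp (hord ▸ pow_orderOf_eq_one τ)
  have hpow' : ∀ (i : ℕ) (x : L), (τ₁ ^ i) (algebraMap L E x) = algebraMap L E ((τ ^ i) x) := by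
    intro i
    induction i with
    | zero => intro x; rfl
    | succ i ih => intro x; rw [pow_succ, pow_succ, AlgEquiv.mul_apply, AlgEquiv.mul_apply, hτ₁, ih]
  have hord₁ : orderOf τ₁ = p ^ (k + 1) := by
    refine Nat.dvd_antisymm (orderOf_dvd_of_pow_eq_one hpow) ?_
    rw [← hord]
    refine orderOf_dvd_of_pow_eq_one (AlgEquiv.ext fun x => (algebraMap L E).injective ?_)
    rw [← hpow', pow_orderOf_eq_one]
    rfl
  obtain ⟨E', _, _, _, τ₂, x, hfr, hτ₂, hpow₂, hx⟩ := exists_extension_norm_pow hp k i hord₁ hζ hτζ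
    (a := Units.map (algebraMap L E : L →* E) a) ((hτ₁ _).trans (congrArg _ ha))
    (x₀ := Units.map (algebraMap L E : L →* E) y) (by
      rw [← map_pow, ← hy]
      exact (pn_comm (g := Units.map (algebraMap L E : L →* E)) (fun x => by ext; exact (hτ₁ x).symm) _ y).symm)
  let _ : Algebra L E' := ((algebraMap E E').comp (algebraMap L E)).toAlgebra
  have : IsScalarTower L E E' := IsScalarTower.of_algebraMap_eq fun _ => rfl
  refine ⟨E', inferInstance, inferInstance, inferInstance, τ₂, x, fun x => (hτ₂ _).trans (congrArg _ (hτ₁ x)), hpow₂, hx, ?_⟩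
  rw [← Module.finrank_mul_finrank L E E', hfr, Nat.factorization_mul Module.finrank_pos.ne' (pow_pos hp.pos _).ne',
    Finsupp.add_apply, Nat.factorization_eq_zero_of_lt hlt, hp.factorization_pow, Finsupp.single_eq_same, zero_add]

section
variable {K L : Type} [Field K] [NumberField K] [Field L] [NumberField L] [Algebra K L] [FiniteDimensional K L] [IsGalois K L]
  {A : Type*} [Ring A] [Algebra K A] {σ : L ≃ₐ[K] L} {a : K} {ι : L →ₐ[K] A} {u : Aˣ}

lemma CyclicData.exists_rep_of_norm (h : CyclicData σ a ι u) (hσ : ∀ τ, τ ∈ Subgroup.zpowers σ) (ha : a ≠ 0) {m : ℕ}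
    (hm : 0 < m) {x : L} (hx : Algebra.norm K x = a ^ m) {p : ℕ} (hp : p.Prime) :
    ∃ (V : Type) (_ : AddCommGroup V) (_ : Module K V) (_ : Module.Finite K V) (d : ℕ),
      Nonempty (A →ₐ[K] Module.End K V) ∧ Module.finrank K V = Module.finrank K L * d ∧ d ≠ 0 ∧
      d.factorization p ≤ m.factorization p := by
  set n := Module.finrank K L with hn
  have hn0 : n ≠ 0 := Module.finrank_pos.ne'
  set κ := n.factorization p
  set n' := n / p ^ κ
  have hnn : n = n' * p ^ κ := (Nat.div_mul_cancel (Nat.ordProj_dvd n p)).symm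
  have hn'0 : n' ≠ 0 := left_ne_zero_of_mul (hnn ▸ hn0)
  have hn'p : n'.factorization p = 0 := Nat.factorization_eq_zero_of_not_dvd (Nat.not_dvd_ordCompl hp hn0)
  have hordσ : orderOf (σ ^ n') = p ^ κ := by
    rw [orderOf_pow_of_dvd hn'0 (by rw [orderOf_gen hσ, ← hn, hnn]; exact dvd_mul_right _ _), orderOf_gen hσ, ← hn]
    conv_lhs => rw [hnn]
    exact Nat.mul_div_cancel_left _ (Nat.pos_of_ne_zero hn'0)
  let τ : L ≃ₐ[ℚ] L := (σ ^ n').restrictScalars ℚ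
  have hτpow : ∀ (i : ℕ) x, (τ ^ i) x = ((σ ^ n') ^ i) x := by
    intro i
    induction i with
    | zero => intro x; rfl
    | succ i ih => intro x; rw [pow_succ, pow_succ, AlgEquiv.mul_apply, AlgEquiv.mul_apply, ih]; rfl
  have hord : orderOf τ = p ^ κ := by
    rw [← hordσ]
    exact orderOf_eq_orderOf_iff.2 fun i => ⟨fun h => AlgEquiv.ext fun x => by rw [← hτpow, h]; rfl,
      fun h => AlgEquiv.ext fun x => by rw [hτpow, h]; rfl⟩
  have hx0 : x ≠ 0 := by
    rintro rfl
    rw [Algebra.norm_zero] at hx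
    exact pow_ne_zero _ ha hx.symm
  let b : Lˣ := Units.map (algebraMap K L : K →* L) (Units.mk0 a ha)
  have hτb : τ b = b := (σ ^ n').commutes a
  have h1 : pn (sg τ) (p ^ κ) (pn (sg σ) n' (Units.mk0 x hx0)) = b ^ m := by
    have e1 : ∀ z, sg τ z = (sg σ)^[n'] z := fun z => (sg_pow σ n' z)
    have e2 : ∀ z, sg τ (pn (sg σ) n' z) = pn (sg σ) n' (sg τ z) := fun z =>
      pn_comm (g := sg τ) (fun z => by rw [e1, e1, ← Function.iterate_succ_apply, Function.iterate_succ_apply']) n' z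
    rw [← pn_comm (g := pn (sg σ) n') (fun z => (e2 z).symm), ← pn_mul e1, ← hnn, hn, pn_sg_eq_norm hσ, ← map_pow]
    congr 1
    ext
    exact hx
  have h2 : pn (sg τ) (p ^ κ) b = b ^ p ^ κ := pn_of_fixed (by ext; exact hτb) _
  obtain ⟨i, hi, hgcd⟩ := (Nat.dvd_prime_pow hp).1 (Nat.gcd_dvd_right m (p ^ κ))
  obtain ⟨y, hy⟩ : ∃ y, pn (sg τ) (p ^ κ) y = b ^ p ^ i := by
    refine ⟨pn (sg σ) n' (Units.mk0 x hx0) ^ m.gcdA (p ^ κ) * b ^ m.gcdB (p ^ κ), ?_⟩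
    rw [map_mul, map_zpow, map_zpow, h1, h2, ← hgcd, ← zpow_natCast b (m.gcd (p ^ κ)), Nat.gcd_eq_gcd_ab, zpow_add, zpow_mul,
      zpow_mul, zpow_natCast, zpow_natCast]
  have him : i ≤ m.factorization p := (hp.pow_dvd_iff_le_factorization hm.ne').1 (hgcd ▸ Nat.gcd_dvd_left m (p ^ κ))
  obtain ⟨E, _, _, _, τ', z, hτ', hpow, hz, hfac⟩ := exists_extension_norm_factorization hp hi hord hτb hy
  have hcoe : ∀ (i : ℕ) x, ((τ' : E ≃+* E) ^ i) x = (τ' ^ i) x := by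
    intro i
    induction i with
    | zero => intro x; rfl
    | succ i ih => intro x; rw [pow_succ, pow_succ, AlgEquiv.mul_apply, RingAut.mul_apply, ih]; rfl
  obtain ⟨V, _, _, _, hρ, hV⟩ := h.exists_rep (Nat.pos_of_ne_zero hn'0) hnn (τ' : E ≃+* E) hτ'
    (RingEquiv.ext fun x => by rw [hcoe, hpow]; rfl) (x := (z : E)) (by
      have := congrArg Units.val hz
      rw [coe_pn_sg] at this
      simp_rw [hcoe]
      exact this)
  refine ⟨V, inferInstance, inferInstance, inferInstance, n' * Module.finrank L E, hρ, by rw [hV, ← hn, mul_left_comm],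
    mul_ne_zero hn'0 Module.finrank_pos.ne', ?_⟩
  rw [Nat.factorization_mul hn'0 Module.finrank_pos.ne', Finsupp.add_apply, hn'p, zero_add]
  exact hfac.trans him

end
end CyclicSchur

namespace CyclicSchur
section
variable {K L : Type} [Field K] [NumberField K] [Field L] [NumberField L] [Algebra K L] [FiniteDimensional K L] [IsGalois K L]
  {A : Type*} [Ring A] [Algebra K A] {σ : L ≃ₐ[K] L} {a : K} {ι : L →ₐ[K] A} {u : Aˣ}

lemma finrank_of_algEquiv_matrix {K A D : Type*} [Field K] [Ring A] [Algebra K A] [DivisionRing D] [Algebra K D] {r : ℕ}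
    (e : A ≃ₐ[K] Matrix (Fin r) (Fin r) D) : Module.finrank K A = r * r * Module.finrank K D := by
  rw [e.toLinearEquiv.finrank_eq, Module.finrank_matrix, Fintype.card_fin]

lemma CyclicData.isLeast_of_algEquiv (h : CyclicData σ a ι u) (hσ : ∀ τ, τ ∈ Subgroup.zpowers σ) (ha : a ≠ 0)
    {D : Type} [DivisionRing D] [Algebra K D] {r m : ℕ} (e : A ≃ₐ[K] Matrix (Fin r) (Fin r) D)
    (hm : m * m = Module.finrank K D) : IsLeast {m : ℕ | 0 < m ∧ ∃ x : L, Algebra.norm K x = a ^ m} m := by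
  have hrm : Module.finrank K L = r * m := Nat.mul_self_inj.1 (by
    rw [← h.finrank_eq, finrank_of_algEquiv_matrix e, ← hm, mul_mul_mul_comm])
  have hn0 : 0 < Module.finrank K L := Module.finrank_pos
  have hr : NeZero r := ⟨left_ne_zero_of_mul (hrm ▸ hn0.ne')⟩
  have hm0 : 0 < m := Nat.pos_of_ne_zero (right_ne_zero_of_mul (hrm ▸ hn0.ne'))
  have : Module.Finite K D := Module.finite_of_finrank_pos (hm ▸ Nat.mul_pos hm0 hm0)
  refine ⟨⟨hm0, h.exists_norm_eq hσ ((mulVecAlgHom K D r).comp e.toAlgHom) (d := m) ?_⟩, ?_⟩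
  · rw [Module.finrank_pi_fintype, Finset.sum_const, Finset.card_univ, Fintype.card_fin, smul_eq_mul, ← hm, hrm, mul_assoc]
  · rintro m₀ ⟨hm₀, x, hx⟩
    refine Nat.le_of_dvd hm₀ ((Nat.factorization_prime_le_iff_dvd hm0.ne' hm₀.ne').1 fun p hp => ?_)
    obtain ⟨V, _, _, _, d, ⟨ρ⟩, hV, hd0, hd⟩ := h.exists_rep_of_norm hσ ha hm₀ hx hp
    have hdvd := dvd_finrank_of_matrix (ρ.comp e.symm.toAlgHom)
    rw [hV, ← hm, ← mul_assoc, ← hrm] at hdvd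
    exact ((Nat.factorization_le_iff_dvd hm0.ne' hd0).2 (Nat.dvd_of_mul_dvd_mul_left hn0 hdvd) p).trans hd

lemma CyclicData.exists_algEquiv {A : Type} [Ring A] [Algebra K A] {ι : L →ₐ[K] A} {u : Aˣ} (h : CyclicData σ a ι u)
    (hσ : ∀ τ, τ ∈ Subgroup.zpowers σ) : ∃ (m : ℕ) (D : Type) (_ : DivisionRing D) (_ : Algebra K D) (r : ℕ),
      Nonempty (A ≃ₐ[K] Matrix (Fin r) (Fin r) D) ∧ m * m = Module.finrank K D := by
  have := h.isSimpleRing (orderOf_gen hσ)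
  have := h.finite
  have : IsArtinianRing A := IsArtinianRing.of_finite K A
  obtain ⟨r, _, D, _, _, _, ⟨e⟩⟩ := IsSimpleRing.exists_algEquiv_matrix_divisionRing_finite K A
  have h1 := finrank_of_algEquiv_matrix e
  rw [h.finrank_eq] at h1
  obtain ⟨m, hm⟩ : r ∣ Module.finrank K L := (Nat.pow_dvd_pow_iff two_ne_zero).1 (by
    rw [sq, sq, h1]; exact dvd_mul_right _ _)
  refine ⟨m, D, inferInstance, inferInstance, r, ⟨e⟩, ?_⟩
  rw [hm, mul_mul_mul_comm] at h1
  exact Nat.eq_of_mul_eq_mul_left (Nat.mul_pos (NeZero.pos r) (NeZero.pos r)) h1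

end
end CyclicSchur

theorem schur_stmt5
    (K : Type) [Field K] [NumberField K]
    (L : Type) [Field L] [NumberField L] [Algebra K L] [FiniteDimensional K L] [IsGalois K L]
    (σ : L ≃ₐ[K] L) (hσ : ∀ τ : L ≃ₐ[K] L, τ ∈ Subgroup.zpowers σ)
    (a : K) (ha : a ≠ 0)
    (A : Type) [Ring A] [Algebra K A]
    (hA : IsCyclicAlgebra K L σ (algebraMap K L a) A) :
    IsLeast {m : ℕ | 0 < m ∧ ∃ x : L, Algebra.norm K x = a ^ m} (schurIndex K A) := by
  obtain ⟨ι, u, h1, h2, h3⟩ := hA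
  have h : CyclicSchur.CyclicData σ a ι u := ⟨by rw [h1, AlgHom.commutes], h2, h3⟩
  obtain ⟨D, _, _, r, ⟨e⟩, hm⟩ := Nat.sInf_mem (h.exists_algEquiv hσ)
  exact h.isLeast_of_algEquiv hσ ha e hm
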